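/- There is no pair of non-K-trivial computably enumerable reals X, Y for which min{K(X↾n), K(Y↾n)} − K(n) is bounded above by a constant; that is, if X and Y are c.e. reals and there exists a constant b with min{K(X↾n), K(Y↾n)} ≤ K(n) + b for all n, then at least one of X, Y is K-trivial. -/

import Mathlib

section Frozen

open Part Filter

open scoped Classical

namespace KPaper

/-- Binary strings. -/
abbrev Str := List Bool

/-! ### Oracle (Turing) reducibility -/

/-- The functions `ℕ →. ℕ` that are partial recursive relative to an oracle `O : ℕ →. ℕ`.
This mirrors Mathlib's `Nat.Partrec`, with an extra base case for the oracle. -/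
inductive RecursiveIn (O : ℕ →. ℕ) : (ℕ →. ℕ) → Prop
  | oracle : RecursiveIn O O
  | zero : RecursiveIn O (pure 0)
  | succ : RecursiveIn O ↑Nat.succ
  | left : RecursiveIn O ↑fun n : ℕ => n.unpair.1
  | right : RecursiveIn O ↑fun n : ℕ => n.unpair.2
  | pair {f g} : RecursiveIn O f → RecursiveIn O g →
      RecursiveIn O fun n => Nat.pair <$> f n <*> g n
  | comp {f g} : RecursiveIn O f → RecursiveIn O g → RecursiveIn O fun n => g n >>= f
  | prec {f g} : RecursiveIn O f → RecursiveIn O g → RecursiveIn O (Nat.unpaired fun a n =>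
      n.rec (f a) fun y IH => do let i ← IH; g (Nat.pair a (Nat.pair y i)))
  | rfind {f} : RecursiveIn O f →
      RecursiveIn O fun a => Nat.rfind fun n => (fun m => m = 0) <$> f (Nat.pair a n)

/-- The characteristic (partial) function of a set of naturals, used as a Turing oracle. -/
noncomputable def chi (A : Set ℕ) : ℕ →. ℕ := fun n => Part.some (if n ∈ A then 1 else 0)

/-- The characteristic function of an infinite binary sequence, used as a Turing oracle. -/
def chiSeq (X : ℕ → Bool) : ℕ →. ℕ := fun n => Part.some (cond (X n) 1 0)

/-- `A` is Turing reducible to `B`. -/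
noncomputable def TuringLeSet (A B : Set ℕ) : Prop := RecursiveIn (chi B) (chi A)

/-- `A` is Turing equivalent to `B`. -/
noncomputable def TuringEquivSet (A B : Set ℕ) : Prop := TuringLeSet A B ∧ TuringLeSet B A

/-- Turing equivalence between a set and an infinite binary sequence. -/
noncomputable def TuringEquivSetSeq (A : Set ℕ) (X : ℕ → Bool) : Prop :=
  RecursiveIn (chiSeq X) (chi A) ∧ RecursiveIn (chi A) (chiSeq X)

/-- The halting problem `∅'`. -/
def haltingSet : Set ℕ := {n | ((Denumerable.ofNat Nat.Partrec.Code n).eval n).Dom}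

/-- A set of naturals is computably enumerable iff it is the domain of a
partial computable function. -/
def CESet (A : Set ℕ) : Prop := ∃ f : ℕ →. ℕ, Nat.Partrec f ∧ ∀ n, n ∈ A ↔ (f n).Dom

/-! ### Machines and Kolmogorov complexity -/

/-- A (plain) machine is a partial computable map from binary strings to binary strings. -/
def PlainMachine (M : Str →. Str) : Prop := Partrec M

/-- A prefix-free machine: a partial computable map on binary strings whose
domain is an antichain under the prefix relation. -/
def PFMachine (M : Str →. Str) : Prop :=
  Partrec M ∧ ∀ ρ₁ ρ₂ : Str, (M ρ₁).Dom → (M ρ₂).Dom → ρ₁ <+: ρ₂ → ρ₁ = ρ₂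

/-- The Kolmogorov complexity of a string `σ` with respect to a machine `M`:
the least length of an `M`-description of `σ` (`⊤` if there is none). -/
noncomputable def KC (M : Str →. Str) (σ : Str) : ℕ∞ :=
  ⨅ ρ : {ρ : Str // σ ∈ M ρ}, ((ρ : Str).length : ℕ∞)

/-- An optimal prefix-free machine: a prefix-free machine whose associated complexity
is minimal, up to an additive constant, among all prefix-free machines. -/
def OptimalPF (U : Str →. Str) : Prop :=
  PFMachine U ∧ ∀ M : Str →. Str, PFMachine M → ∃ c : ℕ, ∀ σ : Str, KC U σ ≤ KC M σ + c

/-- An optimal plain machine. -/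
def OptimalPlain (V : Str →. Str) : Prop :=
  PlainMachine V ∧ ∀ M : Str →. Str, PlainMachine M → ∃ c : ℕ, ∀ σ : Str, KC V σ ≤ KC M σ + c

/-! ### Initial segments -/

/-- The first `n` bits of the characteristic sequence of a set of naturals. -/
noncomputable def restrSet (A : Set ℕ) (n : ℕ) : Str :=
  (List.range n).map fun i => decide (i ∈ A)

/-- The first `n` bits of an infinite binary sequence. -/
def restrSeq (X : ℕ → Bool) (n : ℕ) : Str := (List.range n).map X

/-- The string `0^n`; `K(n)` is identified with `K(0^n)`. -/
def zeroStr (n : ℕ) : Str := List.replicate n false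

/-! ### `≤_K`, `<_K`, `K`-triviality (and the `≤_C` analogues) -/

def KLeSet (U : Str →. Str) (A B : Set ℕ) : Prop :=
  ∃ c : ℕ, ∀ n, KC U (restrSet A n) ≤ KC U (restrSet B n) + c

def KLtSet (U : Str →. Str) (A B : Set ℕ) : Prop := KLeSet U A B ∧ ¬ KLeSet U B A

def KTrivialSet (U : Str →. Str) (A : Set ℕ) : Prop :=
  ∃ c : ℕ, ∀ n, KC U (restrSet A n) ≤ KC U (zeroStr n) + c

def KLeSeq (U : Str →. Str) (X Y : ℕ → Bool) : Prop :=
  ∃ c : ℕ, ∀ n, KC U (restrSeq X n) ≤ KC U (restrSeq Y n) + c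

def KLtSeq (U : Str →. Str) (X Y : ℕ → Bool) : Prop := KLeSeq U X Y ∧ ¬ KLeSeq U Y X

def KTrivialSeq (U : Str →. Str) (X : ℕ → Bool) : Prop :=
  ∃ c : ℕ, ∀ n, KC U (restrSeq X n) ≤ KC U (zeroStr n) + c

/-! ### Computably enumerable reals -/

/-- The real number in `[0,1]` whose binary expansion is the sequence `X`. -/
noncomputable def realOfSeq (X : ℕ → Bool) : ℝ := ∑' i : ℕ, cond (X i) ((2 : ℝ) ^ (i + 1))⁻¹ 0

/-- `X` (identified with the real it is the binary expansion of) is a computably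
enumerable real: it is the limit of a nondecreasing computable sequence of
(dyadic) rationals. -/
def CEReal (X : ℕ → Bool) : Prop :=
  ∃ f : ℕ → ℤ, Computable f ∧
    (∀ s, (f s : ℝ) / 2 ^ s ≤ (f (s + 1) : ℝ) / 2 ^ (s + 1)) ∧
    Tendsto (fun s => (f s : ℝ) / 2 ^ s) atTop (nhds (realOfSeq X))

/-- The characteristic sequence of a set of naturals. -/
noncomputable def seqOfSet (A : Set ℕ) : ℕ → Bool := fun i => decide (i ∈ A)

/-! ### Solovay reducibility -/

/-- Solovay reducibility on c.e. reals: `X ≤_S Y` iff there are nondecreasing computable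
rational approximations to `X` and `Y` and a constant `c` such that at each stage the
distance to `X` is bounded by `c` times the distance to `Y`. -/
def SolovayLe (X Y : ℕ → Bool) : Prop :=
  ∃ (c : ℕ) (f g : ℕ → ℤ), Computable f ∧ Computable g ∧
    (∀ s, (f s : ℝ) / 2 ^ s ≤ (f (s + 1) : ℝ) / 2 ^ (s + 1)) ∧
    (∀ s, (g s : ℝ) / 2 ^ s ≤ (g (s + 1) : ℝ) / 2 ^ (s + 1)) ∧
    Tendsto (fun s => (f s : ℝ) / 2 ^ s) atTop (nhds (realOfSeq X)) ∧
    Tendsto (fun s => (g s : ℝ) / 2 ^ s) atTop (nhds (realOfSeq Y)) ∧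
    ∀ s, realOfSeq X - (f s : ℝ) / 2 ^ s ≤ (c : ℝ) * (realOfSeq Y - (g s : ℝ) / 2 ^ s)


end KPaper

end Frozen

namespace KPaper

set_option linter.unusedSectionVars false

section PartA

theorem foldl_eq_rec {β σ : Type*} (l : List β) (g : σ) (h : σ → β → σ) :
    l.foldl h g = Nat.rec (motive := fun _ => σ) g
      (fun n s => (l[n]?).elim s (fun b => h s b)) l.length := by
  have key : ∀ n ≤ l.length, Nat.rec (motive := fun _ => σ) g
      (fun n s => (l[n]?).elim s (fun b => h s b)) n = (l.take n).foldl h g := by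
    intro n
    induction n with
    | zero => intro _; simp
    | succ n ih =>
      intro hn
      have := ih (by omega)
      simp only [this]
      rw [List.take_add_one, List.foldl_append, List.getElem?_eq_getElem (by omega)]
      simp
  have := key _ le_rfl
  rw [this, List.take_length]

section comp
variable {α β γ σ : Type*} [Primcodable α] [Primcodable β] [Primcodable γ] [Primcodable σ]

theorem comp_foldl {l : α → List β} {g : α → σ} {h : α → σ × β → σ} (hl : Computable l)
    (hg : Computable g) (hh : Computable₂ h) :
    Computable fun a => (l a).foldl (fun s b => h a (s, b)) (g a) := by
  have : Computable fun a => Nat.rec (motive := fun _ => σ) (g a)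
      (fun n s => ((l a)[n]?).elim s (fun b => h a (s, b))) (l a).length := by
    refine Computable.nat_rec (f := fun a => (l a).length) (g := g)
      (h := fun a (p : ℕ × σ) => ((l a)[p.1]?).elim p.2 (fun b => h a (p.2, b)))
      (Computable.list_length.comp hl) hg ?_
    have h1 : Computable₂ fun (a : α) (p : ℕ × σ) =>
      (Option.casesOn (motive := fun _ => σ) ((l a)[p.1]?) p.2 (fun b => h a (p.2, b))) := by
      refine Computable.option_casesOn (o := fun x : α × (ℕ × σ) => (l x.1)[x.2.1]?)
        (f := fun x => x.2.2) (g := fun x b => h x.1 (x.2.2, b)) ?_ ?_ ?_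
      · exact Computable.list_getElem?.comp (hl.comp Computable.fst)
          (Computable.fst.comp Computable.snd)
      · exact Computable.snd.comp Computable.snd
      · exact hh.comp (Computable.fst.comp Computable.fst)
          (Computable.pair (Computable.snd.comp (Computable.snd.comp Computable.fst))
            Computable.snd)
    refine h1.of_eq ?_
    rintro ⟨a, p⟩
    dsimp only
    cases (l a)[p.1]? <;> rfl
  refine this.of_eq fun a => ?_
  rw [foldl_eq_rec]

theorem comp_flatMap {l : α → List β} {f : α → β → List γ} (hl : Computable l)
    (hf : Computable₂ f) : Computable fun a => (l a).flatMap (f a) := by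
  have : Computable fun a => (l a).foldl (fun s b => s ++ f a b) ([] : List γ) :=
    comp_foldl (h := fun a p => p.1 ++ f a p.2) hl (Computable.const [])
      (Computable.list_append.comp (Computable.fst.comp Computable.snd)
        (hf.comp Computable.fst (Computable.snd.comp Computable.snd)))
  refine this.of_eq fun a => ?_
  have : ∀ (l' : List β) (s : List γ), l'.foldl (fun s b => s ++ f a b) s = s ++ l'.flatMap (f a) := by
    intro l'
    induction l' with
    | nil => simp
    | cons x xs ih => intro s; simp [ih]
  simpa using this (l a) []

theorem comp_map {l : α → List β} {f : α → β → γ} (hl : Computable l)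
    (hf : Computable₂ f) : Computable fun a => (l a).map (f a) := by
  have h2 : Computable₂ fun (a : α) (b : β) => [f a b] :=
    Computable.list_cons.comp hf (Computable.const [])
  refine (comp_flatMap hl h2).of_eq fun a => ?_
  induction l a with
  | nil => rfl
  | cons x xs ih => simpa using ih

theorem comp_filter {l : α → List β} {f : α → β → Bool} (hl : Computable l)
    (hf : Computable₂ f) : Computable fun a => (l a).filter (f a) := by
  have h2 : Computable₂ fun (a : α) (b : β) => (bif f a b then [b] else []) :=
    Computable.cond hf (Computable.list_cons.comp Computable.snd (Computable.const []))
      (Computable.const [])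
  refine (comp_flatMap hl h2).of_eq fun a => ?_
  induction l a with
  | nil => rfl
  | cons x xs ih => cases hx : f a x <;> simpa [hx] using ih

theorem comp_any {l : α → List β} {f : α → β → Bool} (hl : Computable l)
    (hf : Computable₂ f) : Computable fun a => (l a).any (f a) := by
  have : Computable fun a => (l a).foldl (fun s b => s || f a b) false :=
    comp_foldl (h := fun a p => p.1 || f a p.2) hl (Computable.const false)
      (Primrec.or.to_comp.comp (Computable.fst.comp Computable.snd)
        (hf.comp Computable.fst (Computable.snd.comp Computable.snd)))
  refine this.of_eq fun a => ?_
  have : ∀ (l' : List β) (s : Bool), l'.foldl (fun s b => s || f a b) s = (s || l'.any (f a)) := by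
    intro l'
    induction l' with
    | nil => simp
    | cons x xs ih => intro s; simp [ih, Bool.or_assoc]
  simpa using this (l a) false

theorem comp_not {f : α → Bool} (hf : Computable f) : Computable fun a => !(f a) :=
  Primrec.not.to_comp.comp hf
theorem comp_and {f g : α → Bool} (hf : Computable f) (hg : Computable g) :
    Computable fun a => (f a && g a) := Primrec.and.to_comp.comp hf hg
theorem comp_or {f g : α → Bool} (hf : Computable f) (hg : Computable g) :
    Computable fun a => (f a || g a) := Primrec.or.to_comp.comp hf hg

theorem comp_all {l : α → List β} {f : α → β → Bool} (hl : Computable l)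
    (hf : Computable₂ f) : Computable fun a => (l a).all (f a) := by
  have h2 : Computable₂ fun a b => !(f a b) := comp_not hf
  refine (comp_not (comp_any hl h2)).of_eq fun a => ?_
  induction l a with
  | nil => rfl
  | cons x xs ih => cases hx : f a x <;> simp_all

theorem comp_sum {l : α → List ℕ} (hl : Computable l) : Computable fun a => (l a).sum := by
  have : Computable fun a => (l a).foldl (fun s b => s + b) 0 :=
    comp_foldl (h := fun a p => p.1 + p.2) hl (Computable.const 0)
      (Primrec.nat_add.to_comp.comp (Computable.fst.comp Computable.snd)
        (Computable.snd.comp Computable.snd))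
  refine this.of_eq fun a => ?_
  rw [List.sum_eq_foldl]

theorem comp_add {f g : α → ℕ} (hf : Computable f) (hg : Computable g) :
    Computable fun a => f a + g a := Primrec.nat_add.to_comp.comp hf hg
theorem comp_mul {f g : α → ℕ} (hf : Computable f) (hg : Computable g) :
    Computable fun a => f a * g a := Primrec.nat_mul.to_comp.comp hf hg
theorem comp_sub {f g : α → ℕ} (hf : Computable f) (hg : Computable g) :
    Computable fun a => f a - g a := Primrec.nat_sub.to_comp.comp hf hg
theorem comp_div {f g : α → ℕ} (hf : Computable f) (hg : Computable g) :
    Computable fun a => f a / g a := Primrec.nat_div.to_comp.comp hf hg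
theorem comp_max {f g : α → ℕ} (hf : Computable f) (hg : Computable g) :
    Computable fun a => max (f a) (g a) := Primrec.nat_max.to_comp.comp hf hg
theorem comp_pow2 {f : α → ℕ} (hf : Computable f) :
    Computable fun a => 2 ^ (f a) := by
  have : Primrec₂ ((· ^ ·) : ℕ → ℕ → ℕ) := Primrec₂.unpaired'.1 Nat.Primrec.pow
  exact this.to_comp.comp (Computable.const 2) hf
theorem comp_le {f g : α → ℕ} (hf : Computable f) (hg : Computable g) :
    Computable fun a => Nat.ble (f a) (g a) := by
  have : Computable₂ fun a b : ℕ => Nat.ble a b :=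
    (Primrec.nat_le.decide.to_comp).of_eq fun p => by
      rw [Bool.eq_iff_iff]; simp
  exact this.comp hf hg
theorem comp_beq [DecidableEq β] {f g : α → β} (hf : Computable f) (hg : Computable g) :
    Computable fun a => decide (f a = g a) := by
  exact (Primrec.eq (α := β)).decide.to_comp.comp hf hg
theorem comp_range {f : α → ℕ} (hf : Computable f) :
    Computable fun a => List.range (f a) := Primrec.list_range.to_comp.comp hf
end comp

end PartA

section PartA2

/-- Numerical value of a binary string. -/
def sval (ρ : Str) : ℕ := ρ.foldl (fun a b => 2 * a + cond b 1 0) 0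

theorem sval_aux (τ : Str) : ∀ a : ℕ, τ.foldl (fun a b => 2 * a + cond b 1 0) a
    = a * 2 ^ τ.length + sval τ ∧ sval τ < 2 ^ τ.length := by
  induction τ with
  | nil => intro a; simp [sval]
  | cons x xs ih =>
    intro a
    have e1 : sval (x :: xs) = (cond x 1 0) * 2 ^ xs.length + sval xs := by
      have := (ih (2 * 0 + cond x 1 0)).1
      simpa [sval] using this
    refine ⟨?_, ?_⟩
    · rw [List.foldl_cons, (ih _).1, e1, List.length_cons, pow_succ]; ring
    · rw [e1, List.length_cons, pow_succ]
      have := (ih 0).2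
      cases x <;> simp <;> omega

theorem sval_append (ρ τ : Str) : sval (ρ ++ τ) = sval ρ * 2 ^ τ.length + sval τ := by
  unfold sval
  rw [List.foldl_append]
  exact (sval_aux τ _).1

theorem sval_lt (τ : Str) : sval τ < 2 ^ τ.length := (sval_aux τ 0).2

theorem exists_sval (R : ℕ) : ∀ q < 2 ^ R, ∃ ρ : Str, ρ.length = R ∧ sval ρ = q := by
  induction R with
  | zero => intro q hq; exact ⟨[], rfl, by simp at hq; simp [sval, hq]⟩
  | succ R ih =>
    intro q hq
    obtain ⟨ρ, h1, h2⟩ := ih (q / 2) (by rw [pow_succ] at hq; omega)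
    refine ⟨ρ ++ [decide (q % 2 = 1)], by simp [h1], ?_⟩
    rw [sval_append, h2]
    rcases Nat.mod_two_eq_zero_or_one q with h | h <;> simp [h, sval] <;> omega

theorem sval_inj {ρ τ : Str} (hl : ρ.length = τ.length) (h : sval ρ = sval τ) : ρ = τ := by
  induction ρ using List.reverseRecOn generalizing τ with
  | nil => exact (List.length_eq_zero_iff.1 hl.symm).symm
  | append_singleton ρ b ih =>
    rcases List.eq_nil_or_concat τ with rfl | ⟨τ', b', rfl⟩
    · simp at hl
    · simp only [List.concat_eq_append] at *
      rw [sval_append, sval_append] at h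
      have hb : sval [b] = cond b 1 0 := by cases b <;> rfl
      have hb' : sval [b'] = cond b' 1 0 := by cases b' <;> rfl
      rw [hb, hb'] at h
      have h2 : sval ρ = sval τ' ∧ b = b' := by
        cases b <;> cases b' <;> simp at h ⊢ <;> omega
      rw [ih (by simpa using hl) h2.1, h2.2]

theorem comp_sval : Computable sval := by
  refine comp_foldl (l := fun ρ : Str => ρ) (g := fun _ => 0)
    (h := fun _ p => 2 * p.1 + cond p.2 1 0) Computable.id (Computable.const 0) ?_
  refine comp_add (comp_mul (Computable.const 2) (Computable.fst.comp Computable.snd)) ?_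
  exact Computable.cond (Computable.snd.comp Computable.snd) (Computable.const 1)
    (Computable.const 0)

/-- index of the next dyadic interval of length `2^{-R}` to the right of `A/2^N`. -/
def kcq (p : ℕ × ℕ) (R : ℕ) : ℕ := (p.1 * 2 ^ R + (2 ^ p.2 - 1)) / 2 ^ p.2

def kcpos (w : ℕ → Option ℕ) (n : ℕ) : ℕ × ℕ :=
  Nat.rec (motive := fun _ => ℕ × ℕ) (0, 0)
    (fun k p => (w k).elim p (fun R => (kcq p R + 1, R))) n

theorem kcpos_succ (w : ℕ → Option ℕ) (k : ℕ) : kcpos w (k + 1) =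
    (w k).elim (kcpos w k) (fun R => (kcq (kcpos w k) R + 1, R)) := rfl

theorem comp_kcq : Computable₂ kcq := by
  refine comp_div (comp_add (comp_mul (Computable.fst.comp Computable.fst)
    (comp_pow2 Computable.snd)) (comp_sub (comp_pow2 (Computable.snd.comp Computable.fst))
      (Computable.const 1))) (comp_pow2 (Computable.snd.comp Computable.fst))

theorem comp_kcpos {w : ℕ → Option ℕ} (hw : Computable w) : Computable (kcpos w) := by
  refine Computable.nat_rec (f := fun n : ℕ => n) (g := fun _ => ((0, 0) : ℕ × ℕ))
    (h := fun _ p => (w p.1).elim p.2 (fun R => (kcq p.2 R + 1, R)))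
    Computable.id (Computable.const _) ?_
  have : Computable fun x : ℕ × (ℕ × (ℕ × ℕ)) =>
      Option.casesOn (motive := fun _ => ℕ × ℕ) (w x.2.1) x.2.2
        (fun R => (kcq x.2.2 R + 1, R)) := by
    refine Computable.option_casesOn (hw.comp (Computable.fst.comp Computable.snd))
      (Computable.snd.comp Computable.snd) ?_
    exact Computable.pair (Computable.succ.comp (comp_kcq.comp
      (Computable.snd.comp (Computable.snd.comp Computable.fst)) Computable.snd)) Computable.snd
  refine this.of_eq fun x => ?_
  dsimp only
  cases w x.2.1 <;> rfl

noncomputable def kcv (p : ℕ × ℕ) : ℝ := (p.1 : ℝ) / 2 ^ p.2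

theorem kcq_ge (p : ℕ × ℕ) (R : ℕ) : kcv p ≤ (kcq p R : ℝ) / 2 ^ R := by
  unfold kcv kcq
  rw [div_le_div_iff₀ (by positivity) (by positivity)]
  have h : p.1 * 2 ^ R ≤ (p.1 * 2 ^ R + (2 ^ p.2 - 1)) / 2 ^ p.2 * 2 ^ p.2 := by
    have := Nat.div_add_mod (p.1 * 2 ^ R + (2 ^ p.2 - 1)) (2 ^ p.2)
    have h2 := Nat.mod_lt (p.1 * 2 ^ R + (2 ^ p.2 - 1)) (show 0 < 2 ^ p.2 by positivity)
    rw [mul_comm] at this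
    have h3 : 0 < 2 ^ p.2 := by positivity
    omega
  exact_mod_cast h

theorem kcq_le (p : ℕ × ℕ) (R : ℕ) : ((kcq p R : ℝ) + 1) / 2 ^ R ≤ kcv p + 2 * (1 / 2) ^ R := by
  unfold kcv kcq
  have h : (p.1 * 2 ^ R + (2 ^ p.2 - 1)) / 2 ^ p.2 * 2 ^ p.2 ≤ p.1 * 2 ^ R + 2 ^ p.2 := by
    have := Nat.div_mul_le_self (p.1 * 2 ^ R + (2 ^ p.2 - 1)) (2 ^ p.2)
    have h3 : 0 < 2 ^ p.2 := by positivity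
    omega
  have h' : (((p.1 * 2 ^ R + (2 ^ p.2 - 1)) / 2 ^ p.2 : ℕ) : ℝ) * 2 ^ p.2 ≤
    (p.1 : ℝ) * 2 ^ R + 2 ^ p.2 := by exact_mod_cast h
  generalize (((p.1 * 2 ^ R + (2 ^ p.2 - 1)) / 2 ^ p.2 : ℕ) : ℝ) = x at h'
  have h3 : x ≤ p.1 / 2 ^ p.2 * 2 ^ R + 1 := by
    have : (0 : ℝ) < 2 ^ p.2 := by positivity
    have e : (p.1 : ℝ) / 2 ^ p.2 * 2 ^ R + 1 = ((p.1 : ℝ) * 2 ^ R + 2 ^ p.2) / 2 ^ p.2 := by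
      field_simp
    rw [e, le_div_iff₀ this]; exact h'
  rw [div_le_iff₀ (by positivity)]
  have : (1 / 2 : ℝ) ^ R * 2 ^ R = 1 := by rw [← mul_pow]; norm_num
  nlinarith

noncomputable def pw (o : Option ℕ) : ℝ := o.elim 0 (fun r => (1 / 2) ^ r)

theorem kcpos_le (w : ℕ → Option ℕ) (n : ℕ) :
    kcv (kcpos w n) ≤ 2 * ∑ k ∈ Finset.range n, pw (w k) := by
  induction n with
  | zero => simp [kcpos, kcv]
  | succ n ih =>
    rw [Finset.sum_range_succ, kcpos_succ]
    cases hw : w n with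
    | none => simpa [pw] using ih
    | some R =>
      have := kcq_le (kcpos w n) R
      simp only [Option.elim, pw, kcv] at *
      push_cast
      linarith

theorem kcpos_mono (w : ℕ → Option ℕ) : Monotone fun n => kcv (kcpos w n) := by
  refine monotone_nat_of_le_succ fun n => ?_
  rw [kcpos_succ]
  cases hw : w n with
  | none => simp
  | some R =>
    refine (kcq_ge (kcpos w n) R).trans ?_
    simp only [Option.elim, kcv]
    push_cast
    gcongr
    linarith

/-- value interval of prefixes. -/
theorem sval_prefix {ρ τ : Str} (h : ρ <+: τ) :
    (sval ρ : ℝ) / 2 ^ ρ.length ≤ (sval τ : ℝ) / 2 ^ τ.length ∧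
    (sval τ : ℝ) / 2 ^ τ.length < ((sval ρ : ℝ) + 1) / 2 ^ ρ.length := by
  obtain ⟨μ, rfl⟩ := h
  have h1 := sval_append ρ μ
  have h2 := sval_lt μ
  rw [h1, List.length_append, pow_add]
  constructor
  · rw [div_le_div_iff₀ (by positivity) (by positivity)]
    have : (0 : ℝ) ≤ sval μ := by positivity
    have : (0 : ℝ) < 2 ^ ρ.length := by positivity
    push_cast
    nlinarith
  · rw [div_lt_div_iff₀ (by positivity) (by positivity)]
    have h3 : (sval μ : ℝ) < 2 ^ μ.length := by exact_mod_cast h2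
    have : (0 : ℝ) < 2 ^ ρ.length := by positivity
    push_cast
    nlinarith

def kcm (w : ℕ → Option ℕ) (o : ℕ → Str) (ρ : Str) (k : ℕ) : Option Str :=
  bif (decide (w k = some ρ.length) && decide (kcq (kcpos w k) ρ.length = sval ρ))
  then some (o k) else none

theorem kcm_uniq {w : ℕ → Option ℕ} {ρ τ : Str} (h : ρ <+: τ ∨ τ <+: ρ) {k k' : ℕ} (hk : k < k')
    (h1 : w k = some ρ.length) (h2 : kcq (kcpos w k) ρ.length = sval ρ)
    (_ : w k' = some τ.length) (h2' : kcq (kcpos w k') τ.length = sval τ) : False := by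
  have e1 : kcv (kcpos w (k + 1)) = ((sval ρ : ℝ) + 1) / 2 ^ ρ.length := by
    rw [kcpos_succ, h1]; simp [kcv, h2]
  have e2 := kcq_ge (kcpos w k') τ.length
  rw [h2'] at e2
  have e3 := kcpos_mono w (show k + 1 ≤ k' from hk)
  simp only at e3
  rw [e1] at e3
  have e4 := e3.trans e2
  rcases h with h | h
  · have := (sval_prefix h).2; linarith
  · have := (sval_prefix h).1
    have : (sval ρ : ℝ) / 2 ^ ρ.length < ((sval ρ : ℝ) + 1) / 2 ^ ρ.length := by
      gcongr; linarith
    linarith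

theorem kc_core (w : ℕ → Option ℕ) (o : ℕ → Str) (hw : Computable w) (ho : Computable o)
    (hs : ∀ n, ∑ k ∈ Finset.range n, pw (w k) ≤ 1 / 2) :
    ∃ M : Str →. Str, PFMachine M ∧ ∀ k r, w k = some r → KC M (o k) ≤ r := by
  have hmem : ∀ ρ k σ, σ ∈ kcm w o ρ k ↔ w k = some ρ.length ∧
      kcq (kcpos w k) ρ.length = sval ρ ∧ o k = σ := by
    intro ρ k σ
    unfold kcm
    by_cases h1 : w k = some ρ.length <;> by_cases h2 : kcq (kcpos w k) ρ.length = sval ρ <;>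
      simp [h1, h2]
  have huniq : ∀ ρ τ k k' σ σ', (ρ <+: τ ∨ τ <+: ρ) → σ ∈ kcm w o ρ k → σ' ∈ kcm w o τ k' →
      k = k' := by
    intro ρ τ k k' σ σ' h h1 h2
    rw [hmem] at h1 h2
    rcases lt_trichotomy k k' with hk | hk | hk
    · exact (kcm_uniq h hk h1.1 h1.2.1 h2.1 h2.2.1).elim
    · exact hk
    · exact (kcm_uniq h.symm hk h2.1 h2.2.1 h1.1 h1.2.1).elim
  refine ⟨fun ρ => Nat.rfindOpt (kcm w o ρ), ⟨?_, ?_⟩, ?_⟩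
  · refine Partrec.rfindOpt ?_
    refine Computable.cond (comp_and (comp_beq (hw.comp Computable.snd)
      (Computable.option_some.comp (Computable.list_length.comp Computable.fst)))
      (comp_beq (comp_kcq.comp ((comp_kcpos hw).comp Computable.snd)
        (Computable.list_length.comp Computable.fst)) (comp_sval.comp Computable.fst)))
      (Computable.option_some.comp (ho.comp Computable.snd)) (Computable.const none)
  · intro ρ τ h1 h2 hp
    rw [Nat.rfindOpt_dom] at h1 h2
    obtain ⟨k, σ, h1⟩ := h1
    obtain ⟨k', σ', h2⟩ := h2
    have := huniq ρ τ k k' σ σ' (Or.inl hp) h1 h2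
    subst this
    rw [hmem] at h1 h2
    have := h1.1.symm.trans h2.1
    exact hp.eq_of_length (by simpa using this)
  · intro k r hk
    have hlt : kcq (kcpos w k) r < 2 ^ r := by
      have h1 := kcpos_le w (k + 1)
      have h2 := hs (k + 1)
      rw [kcpos_succ, hk] at h1
      simp only [Option.elim, kcv] at h1
      have h3 : ((kcq (kcpos w k) r + 1 : ℕ) : ℝ) / 2 ^ r ≤ 1 := by linarith
      rw [div_le_one (by positivity)] at h3
      have : kcq (kcpos w k) r + 1 ≤ 2 ^ r := by exact_mod_cast h3
      omega
    obtain ⟨ρ, hl, hv⟩ := exists_sval r _ hlt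
    have hm : o k ∈ kcm w o ρ k := by
      rw [hmem]; exact ⟨by rw [hl, hk], by rw [hl, hv], rfl⟩
    have hd : (Nat.rfindOpt (kcm w o ρ)).Dom := Nat.rfindOpt_dom.2 ⟨k, _, hm⟩
    have hmm : o k ∈ Nat.rfindOpt (kcm w o ρ) := by
      obtain ⟨k', hk'⟩ := Nat.rfindOpt_spec (Part.get_mem hd)
      have := huniq ρ ρ k k' _ _ (Or.inl List.prefix_rfl) hm hk'
      subst this
      have e : o k = (Nat.rfindOpt (kcm w o ρ)).get hd := by
        rw [Option.mem_def] at hm hk'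
        rw [hm] at hk'; simpa using hk'
      rw [e]; exact Part.get_mem hd
    have : KC (fun ρ => Nat.rfindOpt (kcm w o ρ)) (o k) ≤ ρ.length :=
      iInf_le (fun ρ : {ρ : Str // o k ∈ Nat.rfindOpt (kcm w o ρ)} => ((ρ : Str).length : ℕ∞))
        ⟨ρ, hmm⟩
    rwa [hl] at this

theorem sum_le_of_inj {ι κ : Type*} {s : Finset ι} {t : Finset κ} {f : ι → ℝ} {g : κ → ℝ}
    (i : ι → κ) (hi : ∀ a ∈ s, i a ∈ t) (inj : Set.InjOn i s) (hfg : ∀ a ∈ s, f a ≤ g (i a))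
    (hg : ∀ b ∈ t, 0 ≤ g b) : ∑ a ∈ s, f a ≤ ∑ b ∈ t, g b := by
  classical
  calc ∑ a ∈ s, f a ≤ ∑ a ∈ s, g (i a) := Finset.sum_le_sum hfg
    _ = ∑ b ∈ s.image i, g b := (Finset.sum_image inj).symm
    _ ≤ ∑ b ∈ t, g b := by
      refine Finset.sum_le_sum_of_subset_of_nonneg ?_ fun b hb _ => hg b hb
      intro b hb
      obtain ⟨a, ha, rfl⟩ := Finset.mem_image.1 hb
      exact hi a ha

/-- Machine existence for a computable enumeration of requests, counted as a set. -/
theorem kc_theorem {U : Str →. Str} (hU : OptimalPF U) (req : ℕ → Option (ℕ × Str))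
    (hreq : Computable req) (C : ℕ)
    (hb : ∀ F : Finset (ℕ × Str), (∀ p ∈ F, ∃ k, req k = some p) →
      ∑ p ∈ F, (1 / 2 : ℝ) ^ p.1 ≤ 2 ^ C) :
    ∃ c : ℕ, ∀ k r σ, req k = some (r, σ) → KC U σ ≤ (r : ℕ∞) + c := by
  let fresh : ℕ → Bool := fun k => (List.range k).all fun k' => !decide (req k' = req k)
  have hfresh : Computable fresh := by
    refine comp_all (comp_range Computable.id) ?_
    exact comp_not (comp_beq (hreq.comp Computable.snd) (hreq.comp Computable.fst))
  let w : ℕ → Option ℕ := fun k => bif fresh k then (req k).map (fun p => p.1 + (C + 1)) else none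
  have hw : Computable w := by
    refine Computable.cond hfresh ?_ (Computable.const none)
    refine Computable.option_map hreq ?_
    exact comp_add (Computable.fst.comp Computable.snd) (Computable.const _)
  let o : ℕ → Str := fun k => ((req k).map Prod.snd).getD []
  have ho : Computable o := by
    refine Computable.option_getD (Computable.option_map hreq ?_) (Computable.const [])
    exact Computable.snd.comp Computable.snd
  have hfr : ∀ k, fresh k = true ↔ ∀ k' < k, req k' ≠ req k := by
    intro k; simp [fresh]
  have hs : ∀ n, ∑ k ∈ Finset.range n, pw (w k) ≤ 1 / 2 := by
    intro n
    let F : Finset (ℕ × Str) := (Finset.range n).biUnion fun k => (req k).toFinset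
    have h1 : ∑ k ∈ Finset.range n, pw (w k) ≤ (1 / 2) ^ (C + 1) * ∑ p ∈ F, (1 / 2 : ℝ) ^ p.1 := by
      have h2 : ∑ k ∈ Finset.range n, pw (w k) = ∑ k ∈ (Finset.range n).filter (fun k => fresh k = true ∧ (req k).isSome), pw (w k) := by
        rw [Finset.sum_filter_of_ne]
        intro k _ hne
        by_contra hcon
        apply hne
        rw [not_and_or] at hcon
        rcases hcon with h | h
        · simp [w, Bool.not_eq_true _ ▸ h, pw]
        · have : req k = none := by simpa using h
          cases hf : fresh k <;> simp [w, hf, this, pw]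
      rw [h2, Finset.mul_sum]
      refine sum_le_of_inj (fun k => (req k).getD (0, [])) ?_ ?_ ?_ (fun _ _ => by positivity)
      · intro k hk
        simp only [Finset.mem_filter, Finset.mem_range] at hk
        obtain ⟨p, hp⟩ := Option.isSome_iff_exists.1 hk.2.2
        simp only [F, Finset.mem_biUnion, Option.mem_toFinset, Finset.mem_range]
        exact ⟨k, hk.1, by simp [hp]⟩
      · intro k hk k' hk' he
        simp only [Finset.coe_filter, Set.mem_setOf_eq] at hk hk'
        obtain ⟨p, hp⟩ := Option.isSome_iff_exists.1 hk.2.2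
        obtain ⟨p', hp'⟩ := Option.isSome_iff_exists.1 hk'.2.2
        simp only [hp, hp', Option.getD_some] at he
        subst he
        have h3 := (hfr k).1 hk.2.1
        have h4 := (hfr k').1 hk'.2.1
        rcases lt_trichotomy k k' with h | h | h
        · exact (h4 k h (hp.trans hp'.symm)).elim
        · exact h
        · exact (h3 k' h (hp'.trans hp.symm)).elim
      · intro k hk
        simp only [Finset.mem_filter] at hk
        obtain ⟨p, hp⟩ := Option.isSome_iff_exists.1 hk.2.2
        simp only [w, hk.2.1, hp, pw]
        simp [pow_add, mul_comm]
    have h2 := hb F (by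
      intro p hp
      simp only [F, Finset.mem_biUnion, Option.mem_toFinset] at hp
      obtain ⟨k, _, hk⟩ := hp
      exact ⟨k, hk⟩)
    calc _ ≤ _ := h1
      _ ≤ (1 / 2) ^ (C + 1) * 2 ^ C := by gcongr
      _ = 1 / 2 := by rw [pow_succ, mul_right_comm, ← mul_pow]; norm_num
  obtain ⟨M, hM, hMk⟩ := kc_core w o hw ho hs
  obtain ⟨c, hc⟩ := hU.2 M hM
  refine ⟨C + 1 + c, fun k r σ hk => ?_⟩
  have hex : ∃ k, req k = some (r, σ) := ⟨k, hk⟩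
  have hk0 := Nat.find_spec hex
  have hmin : fresh (Nat.find hex) = true := by
    rw [hfr]; intro k' hk' he
    exact Nat.find_min hex hk' (he.trans hk0)
  have h1 := hMk (Nat.find hex) (r + (C + 1)) (by simp [w, hmin, hk0])
  have h2 : o (Nat.find hex) = σ := by simp [o, hk0]
  rw [h2] at h1
  refine (hc σ).trans ?_
  calc KC M σ + c ≤ ((r + (C + 1) : ℕ) : ℕ∞) + c := by gcongr
    _ = _ := by push_cast; ring

end PartA2

section PartB

open Nat.Partrec (Code)

theorem prefixFree_ud {S : Set Str} (hS : ∀ ρ ∈ S, ∀ τ ∈ S, ρ <+: τ → ρ = τ)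
    (hnil : [] ∉ S) : InformationTheory.UniquelyDecodable S := by
  intro L₁
  induction L₁ with
  | nil =>
    intro L₂ _ h2 h
    cases L₂ with
    | nil => rfl
    | cons x xs =>
      exfalso
      have hx := h2 x (by simp)
      simp only [List.flatten_nil, List.flatten_cons] at h
      have := (List.append_eq_nil_iff.1 h.symm).1
      exact hnil (this ▸ hx)
  | cons y ys ih =>
    intro L₂ h1 h2 h
    cases L₂ with
    | nil =>
      exfalso
      have hx := h1 y (by simp)
      simp only [List.flatten_nil, List.flatten_cons] at h
      have := (List.append_eq_nil_iff.1 h).1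
      exact hnil (this ▸ hx)
    | cons x xs =>
      simp only [List.flatten_cons] at h
      have hy := h1 y (by simp)
      have hx := h2 x (by simp)
      have hxy : y = x := by
        have p1 : y <+: y ++ ys.flatten := List.prefix_append _ _
        have p2 : x <+: y ++ ys.flatten := h ▸ List.prefix_append _ _
        rcases List.prefix_or_prefix_of_prefix p1 p2 with hp | hp
        · exact hS _ hy _ hx hp
        · exact (hS _ hx _ hy hp).symm
      subst hxy
      rw [ih xs (fun w hw => h1 w (by simp [hw])) (fun w hw => h2 w (by simp [hw]))
        (List.append_cancel_left h)]

theorem kraft_pf (S : Finset Str) (hS : ∀ ρ ∈ S, ∀ τ ∈ S, ρ <+: τ → ρ = τ) :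
    ∑ ρ ∈ S, (1 / 2 : ℝ) ^ ρ.length ≤ 1 := by
  by_cases hnil : [] ∈ S
  · have : S = {[]} := by
      ext τ
      simp only [Finset.mem_singleton]
      constructor
      · intro h; exact (hS _ hnil _ h List.nil_prefix).symm
      · rintro rfl; exact hnil
    rw [this]; simp
  · have := InformationTheory.kraft_mcmillan_inequality (S := S)
      (prefixFree_ud (S := (S : Set Str)) (by simpa using hS) (by simpa using hnil))
    simpa using this

theorem exists_en {U : Str →. Str} (hU : PFMachine U) : ∃ en : ℕ → Option (ℕ × Str),
    Computable en ∧ (∀ F : Finset ℕ, ∑ e ∈ F, pw ((en e).map Prod.fst) ≤ 1) ∧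
    (∀ (σ : Str) (ℓ : ℕ), KC U σ ≤ ℓ ↔ ∃ e l, l ≤ ℓ ∧ en e = some (l, σ)) := by
  obtain ⟨c, hc⟩ := Code.exists_code.1 hU.1
  have hcU : ∀ (ρ σ : Str), σ ∈ U ρ ↔ Encodable.encode σ ∈ c.eval (Encodable.encode ρ) := by
    intro ρ σ
    rw [hc]
    simp
  let en1 : ℕ → Option (Str × Str) := fun e =>
    bif (Code.evaln (e.unpair.1 - 1) c e.unpair.2).isSome then none else
      (Code.evaln e.unpair.1 c e.unpair.2).bind fun o =>
        (Encodable.decode (α := Str) e.unpair.2).bind fun ρ =>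
          bif decide (Encodable.encode ρ = e.unpair.2) then
            (Encodable.decode (α := Str) o).map fun σ => (ρ, σ) else none
  have hev : Computable fun p : ℕ × ℕ => Code.evaln p.1 c p.2 :=
    (Code.primrec_evaln.comp ((Primrec.fst.pair (Primrec.const c)).pair Primrec.snd)).to_comp
  have hen1 : Computable en1 := by
    have hu : Computable Nat.unpair := Primrec.unpair.to_comp
    refine Computable.cond ?_ (Computable.const none) ?_
    · exact Primrec.option_isSome.to_comp.comp (hev.comp (Computable.pair
        (comp_sub (Computable.fst.comp hu) (Computable.const 1)) (Computable.snd.comp hu)))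
    · refine Computable.option_bind (hev.comp (Computable.pair
        (Computable.fst.comp hu) (Computable.snd.comp hu))) ?_
      refine Computable.option_bind (Computable.decode.comp
        (Computable.snd.comp (hu.comp Computable.fst))) ?_
      refine Computable.cond (comp_beq (Computable.encode.comp Computable.snd)
        (Computable.snd.comp (hu.comp (Computable.fst.comp Computable.fst)))) ?_
        (Computable.const none)
      refine Computable.option_map (Computable.decode.comp (Computable.snd.comp Computable.fst)) ?_
      exact Computable.pair (Computable.snd.comp Computable.fst) Computable.snd
  have h1 : ∀ e ρ σ, en1 e = some (ρ, σ) ↔ Code.evaln (e.unpair.1 - 1) c e.unpair.2 = none ∧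
      Code.evaln e.unpair.1 c e.unpair.2 = some (Encodable.encode σ) ∧
      e.unpair.2 = Encodable.encode ρ := by
    intro e ρ σ
    simp only [en1]
    cases hs : Code.evaln (e.unpair.1 - 1) c e.unpair.2 with
    | some _ => simp
    | none =>
      simp only [Option.isSome_none, cond_false, true_and]
      cases ho : Code.evaln e.unpair.1 c e.unpair.2 with
      | none => simp
      | some o =>
        simp only [Option.bind_some, Option.some.injEq]
        constructor
        · intro h
          rw [Option.bind_eq_some_iff] at h
          obtain ⟨ρ', hρ', h⟩ := h
          by_cases hd : Encodable.encode ρ' = e.unpair.2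
          · simp only [hd, decide_true, cond_true, Option.map_eq_some_iff, Prod.mk.injEq] at h
            obtain ⟨σ', hσ', rfl, rfl⟩ := h
            refine ⟨?_, hd.symm⟩
            have h3 := Code.evaln_sound (Option.mem_def.2 ho)
            rw [← hd, hc] at h3
            simp only [Encodable.encodek, Part.coe_some, Part.bind_some, Part.mem_map_iff] at h3
            obtain ⟨a, _, ha⟩ := h3
            rw [← ha, Encodable.encodek] at hσ'
            rw [← ha]; simpa using hσ'
          · simp [hd] at h
        · rintro ⟨rfl, h⟩
          simp [h]
  let en : ℕ → Option (ℕ × Str) := fun e => (en1 e).map fun p => (p.1.length, p.2)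
  have hen : Computable en := Computable.option_map hen1 (Computable.pair
    (Computable.list_length.comp (Computable.fst.comp Computable.snd))
    (Computable.snd.comp Computable.snd))
  have hinj : ∀ e e' ρ σ σ', en1 e = some (ρ, σ) → en1 e' = some (ρ, σ') → e = e' := by
    intro e e' ρ σ σ' h h'
    rw [h1] at h h'
    have hp : e.unpair.2 = e'.unpair.2 := h.2.2.trans h'.2.2.symm
    have hs : e.unpair.1 = e'.unpair.1 := by
      rcases lt_trichotomy e.unpair.1 e'.unpair.1 with hlt | hlt | hlt
      · have := Code.evaln_mono (show e.unpair.1 ≤ e'.unpair.1 - 1 by omega)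
          (Option.mem_def.2 h.2.1)
        rw [hp, h'.1] at this; simp at this
      · exact hlt
      · have := Code.evaln_mono (show e'.unpair.1 ≤ e.unpair.1 - 1 by omega)
          (Option.mem_def.2 h'.2.1)
        rw [← hp, h.1] at this; simp at this
    rw [← Nat.pair_unpair e, ← Nat.pair_unpair e', hs, hp]
  have hdom : ∀ e ρ σ, en1 e = some (ρ, σ) → σ ∈ U ρ := by
    intro e ρ σ h
    rw [h1] at h
    rw [hcU, ← h.2.2]
    exact Code.evaln_sound (Option.mem_def.2 h.2.1)
  have hall : ∀ ρ σ, σ ∈ U ρ → ∃ e, en1 e = some (ρ, σ) := by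
    intro ρ σ h
    rw [hcU, Code.evaln_complete] at h
    have hk := Nat.find_spec h
    refine ⟨Nat.pair (Nat.find h) (Encodable.encode ρ), ?_⟩
    rw [h1]
    simp only [Nat.unpair_pair]
    refine ⟨?_, hk, trivial⟩
    by_contra hne
    obtain ⟨x, hx⟩ := Option.ne_none_iff_exists'.1 hne
    have hx2 := Code.evaln_mono (Nat.sub_le _ 1) (Option.mem_def.2 hx)
    rw [Option.mem_def.1 hk] at hx2
    have hx3 : x = Encodable.encode σ := (Option.mem_some_iff.1 hx2).symm
    rw [hx3] at hx
    by_cases h0 : Nat.find h = 0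
    · rw [h0] at hk; simp [Code.evaln] at hk
    · exact Nat.find_min h (show Nat.find h - 1 < Nat.find h by omega) hx
  refine ⟨en, hen, ?_, ?_⟩
  · intro F
    classical
    let S : Finset Str := F.biUnion fun e => ((en1 e).map Prod.fst).toFinset
    have hS : ∀ ρ ∈ S, ∃ e σ, en1 e = some (ρ, σ) := by
      intro ρ hρ
      simp only [S, Finset.mem_biUnion, Option.mem_toFinset, Option.mem_def, Option.map_eq_some_iff,
        Prod.exists] at hρ
      obtain ⟨e, _, ρ', σ, h, rfl⟩ := hρ
      exact ⟨e, σ, h⟩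
    have hk := kraft_pf S (by
      intro ρ hρ τ hτ hp
      obtain ⟨e, σ, h⟩ := hS ρ hρ
      obtain ⟨e', σ', h'⟩ := hS τ hτ
      exact hU.2 ρ τ (Part.dom_iff_mem.2 ⟨_, hdom _ _ _ h⟩) (Part.dom_iff_mem.2 ⟨_, hdom _ _ _ h'⟩) hp)
    refine le_trans ?_ hk
    have h2 : ∑ e ∈ F, pw ((en e).map Prod.fst) =
        ∑ e ∈ F.filter (fun e => (en1 e).isSome), pw ((en e).map Prod.fst) := by
      rw [Finset.sum_filter_of_ne]
      intro e _ hne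
      by_contra hcon
      have : en1 e = none := by simpa using hcon
      simp [en, this, pw] at hne
    rw [h2]
    refine sum_le_of_inj (fun e => ((en1 e).map Prod.fst).getD []) ?_ ?_ ?_
      (fun _ _ => by positivity)
    · intro e he
      simp only [Finset.mem_filter] at he
      obtain ⟨p, hp⟩ := Option.isSome_iff_exists.1 he.2
      simp only [S, Finset.mem_biUnion, Option.mem_toFinset]
      exact ⟨e, he.1, by simp [hp]⟩
    · intro e he e' he' heq
      simp only [Finset.mem_coe, Finset.mem_filter] at he he'
      obtain ⟨p, hp⟩ := Option.isSome_iff_exists.1 he.2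
      obtain ⟨p', hp'⟩ := Option.isSome_iff_exists.1 he'.2
      simp only [hp, hp', Option.map_some, Option.getD_some] at heq
      exact hinj e e' p.1 p.2 p'.2 hp (by rw [hp', heq])
    · intro e he
      simp only [Finset.mem_filter] at he
      obtain ⟨p, hp⟩ := Option.isSome_iff_exists.1 he.2
      simp [en, hp, pw]
  · intro σ ℓ
    constructor
    · intro h
      have hlt : KC U σ < ((ℓ + 1 : ℕ) : ℕ∞) :=
        lt_of_le_of_lt h (by exact_mod_cast Nat.lt_succ_self ℓ)
      unfold KC at hlt
      rw [iInf_lt_iff] at hlt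
      obtain ⟨⟨ρ, hρ⟩, hl⟩ := hlt
      obtain ⟨e, he⟩ := hall ρ σ hρ
      refine ⟨e, ρ.length, ?_, by simp [en, he]⟩
      have : ρ.length < ℓ + 1 := by exact_mod_cast hl
      omega
    · rintro ⟨e, l, hl, he⟩
      simp only [en, Option.map_eq_some_iff, Prod.mk.injEq, Prod.exists] at he
      obtain ⟨ρ, σ', he, hle, rfl⟩ := he
      have : KC U σ' ≤ ρ.length :=
        iInf_le (fun ρ : {ρ : Str // σ' ∈ U ρ} => ((ρ : Str).length : ℕ∞)) ⟨ρ, hdom _ _ _ he⟩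
      refine this.trans ?_
      exact_mod_cast hle.le.trans hl

end PartB

section PartD

theorem ktriv_of {U : Str →. Str} {X : ℕ → Bool} (c : ℕ)
    (h : ∀ n l : ℕ, KC U (zeroStr n) ≤ l → KC U (restrSeq X n) ≤ (l : ℕ∞) + c) :
    KTrivialSeq U X := by
  refine ⟨c, fun n => ?_⟩
  cases hk : KC U (zeroStr n) with
  | top => simp
  | coe l => exact h n l hk.le

theorem zeroStr_length (n : ℕ) : (zeroStr n).length = n := by simp [zeroStr]

theorem ktriv_of_computable {U : Str →. Str} (hU : OptimalPF U) {X : ℕ → Bool}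
    (hX : Computable X) : KTrivialSeq U X := by
  obtain ⟨en, hen, hkr, hKC⟩ := exists_en hU.1
  let req : ℕ → Option (ℕ × Str) := fun e => (en e).map fun p => (p.1, restrSeq X p.2.length)
  have hreq : Computable req := by
    refine Computable.option_map hen (Computable.pair (Computable.fst.comp Computable.snd) ?_)
    refine comp_map (comp_range (Computable.list_length.comp
      (Computable.snd.comp Computable.snd))) ?_
    exact hX.comp Computable.snd
  obtain ⟨c, hc⟩ := kc_theorem hU req hreq 0 (by
    intro F hF
    classical
    choose! k hk using hF
    have h1 := hkr (F.image k)
    rw [pow_zero]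
    refine le_trans ?_ h1
    refine sum_le_of_inj k (fun a ha => Finset.mem_image_of_mem _ ha) ?_ ?_ ?_
    · intro a ha b hb hab
      have h2 := hk a ha
      rw [hab, hk b hb] at h2
      simpa using h2.symm
    · intro a ha
      have h2 := hk a ha
      simp only [req, Option.map_eq_some_iff] at h2
      obtain ⟨q, hq, rfl⟩ := h2
      simp [hq, pw]
    · intro b _
      cases en b <;> simp [pw])
  refine ktriv_of c fun n l hl => ?_
  obtain ⟨e, l', hl', he⟩ := (hKC _ _).1 hl
  have := hc e l' (restrSeq X n) (by simp [req, he, zeroStr_length])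
  refine this.trans ?_
  gcongr

theorem comp_toNat {f : ℕ → ℤ} (hf : Computable f) : Computable fun t => (f t).toNat := by
  have h1 : Computable fun t => Encodable.encode (f t) := Computable.encode.comp hf
  have h2 : Computable fun t => bif (decide (Encodable.encode (f t) % 2 = 0)) then
      Encodable.encode (f t) / 2 else 0 := by
    refine Computable.cond (comp_beq ?_ (Computable.const 0))
      (comp_div h1 (Computable.const 2)) (Computable.const 0)
    exact Primrec.nat_mod.to_comp.comp h1 (Computable.const 2)
  refine h2.of_eq fun t => ?_
  cases f t with
  | ofNat n =>
    have : Encodable.encode (Int.ofNat n) = 2 * n := rfl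
    rw [this]; simp
  | negSucc n =>
    have : Encodable.encode (Int.negSucc n) = 2 * n + 1 := rfl
    rw [this]
    have h3 : (2 * n + 1) % 2 = 1 := by omega
    rw [h3]; simp

theorem sval_restr_succ (X : ℕ → Bool) (n : ℕ) :
    sval (restrSeq X (n + 1)) = 2 * sval (restrSeq X n) + cond (X n) 1 0 := by
  unfold restrSeq
  rw [List.range_succ, List.map_append, sval_append]
  simp only [List.map_cons, List.map_nil, List.length_singleton]
  have : sval [X n] = cond (X n) 1 0 := by cases X n <;> rfl
  rw [this]; ring

theorem restr_length (X : ℕ → Bool) (n : ℕ) : (restrSeq X n).length = n := by simp [restrSeq]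

theorem geo_hasSum (n : ℕ) :
    HasSum (fun i : ℕ => ((2 : ℝ) ^ (i + n + 1))⁻¹) ((2 : ℝ) ^ n)⁻¹ := by
  have h := (hasSum_geometric_two' ((2 : ℝ) ^ n)⁻¹)
  have e : (fun i : ℕ => ((2 : ℝ) ^ (i + n + 1))⁻¹) =
      fun i : ℕ => ((2 : ℝ) ^ n)⁻¹ / 2 / 2 ^ i := by
    funext i
    rw [pow_succ, pow_add]
    field_simp
  rw [e]; exact h

theorem tail_summable (X : ℕ → Bool) (n : ℕ) :
    Summable fun i : ℕ => cond (X (i + n)) ((2 : ℝ) ^ (i + n + 1))⁻¹ 0 := by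
  refine Summable.of_nonneg_of_le ?_ ?_ (geo_hasSum n).summable
  · intro i; cases X (i + n) <;> simp
  · intro i; cases X (i + n) <;> simp

theorem real_split (X : ℕ → Bool) (n : ℕ) : realOfSeq X = sval (restrSeq X n) / 2 ^ n +
    ∑' i : ℕ, cond (X (i + n)) ((2 : ℝ) ^ (i + n + 1))⁻¹ 0 := by
  induction n with
  | zero => simp [restrSeq, sval, realOfSeq]
  | succ n ih =>
    rw [ih, (tail_summable X n).tsum_eq_zero_add, sval_restr_succ]
    have : ∀ i, i + 1 + n = i + (n + 1) := fun i => by omega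
    simp only [this, zero_add]
    rw [← add_assoc]
    congr 1
    push_cast
    rw [pow_succ]
    cases X n <;> simp <;> field_simp

theorem tail_pos {X : ℕ → Bool} {n : ℕ} (h : ∃ i, X (i + n) = true) :
    0 < ∑' i : ℕ, cond (X (i + n)) ((2 : ℝ) ^ (i + n + 1))⁻¹ 0 := by
  obtain ⟨i, hi⟩ := h
  refine (tail_summable X n).tsum_pos (fun i => ?_) i ?_
  · cases X (i + n) <;> simp
  · rw [hi]; simp

theorem tail_lt {X : ℕ → Bool} {n : ℕ} (h : ∃ i, X (i + n) = false) :
    ∑' i : ℕ, cond (X (i + n)) ((2 : ℝ) ^ (i + n + 1))⁻¹ 0 < ((2 : ℝ) ^ n)⁻¹ := by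
  obtain ⟨i, hi⟩ := h
  rw [← (geo_hasSum n).tsum_eq]
  refine Summable.tsum_lt_tsum (i := i) (fun i => ?_) ?_ (tail_summable X n) (geo_hasSum n).summable
  · cases X (i + n) <;> simp
  · rw [hi]; simp

theorem computable_of_ev_const {X : ℕ → Bool} {n : ℕ} {b : Bool} (h : ∀ i, X (i + n) = b) :
    Computable X := by
  have : Computable fun i => ((restrSeq X n)[i]?).getD b :=
    Computable.option_getD (Computable.list_getElem?.comp (Computable.const _) Computable.id)
      (Computable.const b)
  refine this.of_eq fun i => ?_
  by_cases hi : i < n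
  · simp [restrSeq, hi]
  · have := h (i - n)
    rw [Nat.sub_add_cancel (by omega)] at this
    simp [restrSeq, hi, this]

/-- The properties of an approximation of a non-dyadic c.e. real by strings. -/
structure Approx (X : ℕ → Bool) (xs : ℕ → ℕ → Str) : Prop where
  comp : Computable₂ xs
  len : ∀ t n, (xs t n).length = n
  pre : ∀ t n m, n ≤ m → xs t n = (xs t m).take n
  noret : ∀ t t' t'' n, t ≤ t' → t' ≤ t'' → xs t n = xs t'' n → xs t' n = xs t n
  lim : ∀ n, ∃ T, ∀ t ≥ T, xs t n = restrSeq X n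

theorem ce_approx {U : Str →. Str} (hU : OptimalPF U) {X : ℕ → Bool} (hX : CEReal X) :
    KTrivialSeq U X ∨ ∃ xs, Approx X xs := by
  by_cases hc : ∃ n b, ∀ i, X (i + n) = b
  · obtain ⟨n, b, h⟩ := hc
    exact Or.inl (ktriv_of_computable hU (computable_of_ev_const h))
  right
  push Not at hc
  have htrue : ∀ n, ∃ i, X (i + n) = true := fun n => by
    obtain ⟨i, hi⟩ := hc n false; exact ⟨i, by simpa using hi⟩
  have hfalse : ∀ n, ∃ i, X (i + n) = false := fun n => by
    obtain ⟨i, hi⟩ := hc n true; exact ⟨i, by simpa using hi⟩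
  obtain ⟨f, hf, hmono, hlim⟩ := hX
  have hmono' : Monotone fun s => (f s : ℝ) / 2 ^ s := monotone_nat_of_le_succ hmono
  have hle : ∀ s, (f s : ℝ) / 2 ^ s ≤ realOfSeq X := fun s => hmono'.ge_of_tendsto hlim s
  have hup : ∀ n, realOfSeq X * 2 ^ n < sval (restrSeq X n) + 1 := by
    intro n
    have h1 := real_split X n
    have h2 := tail_lt (hfalse n)
    rw [h1]
    have : (0 : ℝ) < 2 ^ n := by positivity
    rw [add_mul, div_mul_cancel₀ _ this.ne']
    have h3 := (mul_lt_mul_iff_left₀ this).2 h2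
    rw [inv_mul_cancel₀ this.ne'] at h3
    linarith
  have hlow : ∀ n, (sval (restrSeq X n) : ℝ) / 2 ^ n < realOfSeq X := by
    intro n
    have h1 := real_split X n
    have h2 := tail_pos (htrue n)
    linarith
  let a : ℕ → ℕ → ℕ := fun t n => (f t).toNat * 2 ^ n / 2 ^ t
  have ha : ∀ t n, a t n = ⌊max 0 ((f t : ℝ) / 2 ^ t) * 2 ^ n⌋₊ := by
    intro t n
    have h1 : ((f t).toNat : ℝ) = max 0 (f t : ℝ) := by
      have : (((f t).toNat : ℤ) : ℝ) = ((max (f t) 0 : ℤ) : ℝ) := by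
        rw [Int.toNat_eq_max]
      push_cast at this
      rw [max_comm]; exact this
    have h2 : max 0 ((f t : ℝ) / 2 ^ t) = ((f t).toNat : ℝ) / 2 ^ t := by
      rw [h1, ← max_div_div_right (by positivity : (0 : ℝ) ≤ 2 ^ t)]; simp
    rw [h2]
    have h3 : ((f t).toNat : ℝ) / 2 ^ t * 2 ^ n =
      (((f t).toNat * 2 ^ n : ℕ) : ℝ) / ((2 ^ t : ℕ) : ℝ) := by push_cast; ring
    rw [h3, Nat.floor_div_eq_div]
  have hxpos : 0 < realOfSeq X := by
    have := hlow 0; simpa [restrSeq, sval] using this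
  have hmax : ∀ t, max 0 ((f t : ℝ) / 2 ^ t) ≤ realOfSeq X := fun t =>
    max_le hxpos.le (hle t)
  have hale : ∀ t n, a t n ≤ sval (restrSeq X n) := by
    intro t n
    rw [ha, ← Nat.lt_succ_iff, Nat.floor_lt (by positivity)]
    refine lt_of_le_of_lt ?_ ((hup n).trans_le (by push_cast; rfl))
    gcongr
    exact hmax t
  have ham : ∀ n, Monotone fun t => a t n := by
    intro n t t' htt
    simp only [ha]
    refine Nat.floor_mono (mul_le_mul_of_nonneg_right ?_ (by positivity))
    exact max_le_max le_rfl (hmono' htt)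
  let bt : ℕ → ℕ → Bool := fun t i => decide (a t (i + 1) % 2 = 1)
  have hsv : ∀ t n, sval (restrSeq (bt t) n) = a t n := by
    intro t n
    induction n with
    | zero =>
      have := hale t 0
      have h0 : sval (restrSeq X 0) = 0 := rfl
      have h1 : sval (restrSeq (bt t) 0) = 0 := rfl
      omega
    | succ n ih =>
      rw [sval_restr_succ, ih]
      have h1 : a t n = a t (n + 1) / 2 := by
        simp only [a]
        rw [Nat.div_div_eq_div_mul, pow_succ, ← mul_assoc, Nat.mul_div_mul_right _ _ two_pos]
      rw [h1]
      simp only [bt]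
      rcases Nat.mod_two_eq_zero_or_one (a t (n + 1)) with h | h <;> simp [h] <;> omega
  refine ⟨fun t n => restrSeq (bt t) n, ?_, fun t n => restr_length _ _, ?_, ?_, ?_⟩
  · refine comp_map (comp_range Computable.snd) ?_
    refine comp_beq (Primrec.nat_mod.to_comp.comp (comp_div (comp_mul
      ((comp_toNat hf).comp (Computable.fst.comp Computable.fst))
      (comp_pow2 (Computable.succ.comp Computable.snd)))
      (comp_pow2 (Computable.fst.comp Computable.fst))) (Computable.const 2)) (Computable.const 1)
  · intro t n m hnm
    simp only [restrSeq]
    rw [← List.map_take, List.take_range, min_eq_left hnm]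
  · intro t t' t'' n h1 h2 h3
    have e1 := ham n h1
    have e2 := ham n h2
    have e3 := congrArg sval h3
    simp only [hsv] at e1 e2 e3
    refine sval_inj (by simp [restr_length]) ?_
    simp only [hsv]
    omega
  · intro n
    have h1 := hlim.eventually (lt_mem_nhds (hlow n))
    obtain ⟨T, hT⟩ := Filter.eventually_atTop.1 h1
    refine ⟨T, fun t ht => ?_⟩
    refine sval_inj (by simp [restr_length]) ?_
    rw [hsv]
    refine le_antisymm (hale t n) ?_
    rw [ha]
    refine Nat.le_floor ?_
    have h2 := hT t ht
    rw [div_lt_iff₀ (by positivity)] at h2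
    refine h2.le.trans ?_
    gcongr
    exact le_max_right _ _

end PartD

section PartC1

/-- Data for the strategy: an enumeration of the universal machine, the approximations to
the two reals (`true` is the first, `false` the second) and the constant. -/
structure Env where
  en : ℕ → Option (ℕ × Str)
  xs : Bool → ℕ → ℕ → Str
  b : ℕ

/-- Pool entries. -/
structure Ent where
  v : ℕ
  r : ℕ
  eX : ℕ
  eY : ℕ
  side : Option Bool

/-- States of the strategy. -/
structure St where
  t : ℕ
  pool : List Ent
  prom : List Ent
  jX : ℕ
  jY : ℕ
  reqs : List (ℕ × ℕ)
  stuck : Bool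

abbrev Args := ℕ × ℕ × ℕ × ℕ
abbrev Res := List (ℕ × ℕ) × Option (List (ℕ × ℕ) × ℕ)

def Ent.tag (E : Ent) (z : Bool) : ℕ := bif z then E.eX else E.eY
def St.j (s : St) (z : Bool) : ℕ := bif z then s.jX else s.jY

def heavy (l : List ℕ) (k : ℕ) : Bool :=
  Nat.ble (2 ^ l.sum) (2 ^ k * (l.map fun r => 2 ^ (l.sum - r)).sum)

def descOf (V : Env) (t : ℕ) (σ : Str) (ℓ : ℕ) : Bool :=
  (List.range t).any fun e =>
    ((V.en e).map fun p => Nat.ble p.1 ℓ && decide (p.2 = σ)).getD false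

def newSide (V : Env) (d t : ℕ) (E : Ent) : Option Bool :=
  bif descOf V t (V.xs true t E.v) (E.r + (V.b + d)) then some true
  else bif descOf V t (V.xs false t E.v) (E.r + (V.b + d)) then some false else none

def settle (V : Env) (d t : ℕ) (E : Ent) : Ent :=
  ⟨E.v, E.r, E.eX, E.eY, E.side.casesOn (newSide V d t E) (fun z => some z)⟩

def moved (V : Env) (t t' : ℕ) (E : Ent) : Bool :=
  (E.side.map fun z => !decide (V.xs z t E.v = V.xs z t' E.v)).getD false

def advance (V : Env) (d t' : ℕ) (new : List Ent) (s : St) : St :=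
  ⟨t', (s.pool.filter fun E => !moved V s.t t' E).map (settle V d t') ++ new,
    s.prom ++ s.pool.filter (fun E => moved V s.t t' E), s.jX, s.jY, s.reqs, s.stuck⟩

def zsel (z : Bool) (e : ℕ) (E : Ent) : Bool := decide (E.side = some z) && decide (E.tag z = e)

def lack (V : Env) (K : ℕ) (pool : List Ent) (z : Bool) (e : ℕ) : Bool :=
  ((V.en e).map fun p => !heavy ((pool.filter (zsel z e)).map Ent.r) (K + p.1)).getD false

def lackE (V : Env) (K : ℕ) (s : St) (z : Bool) : Option ℕ :=
  ((List.range (s.j z)).filter (lack V K s.pool z)).head?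

def waiting (s : St) : Bool := s.pool.any fun E => decide (E.side = none)

def enL (V : Env) (e : ℕ) : ℕ := ((V.en e).map fun p => p.1).getD 0
def enN (V : Env) (e : ℕ) : ℕ := ((V.en e).map fun p => p.2.length).getD 0

def tagE (V : Env) (K : ℕ) (s : St) (z : Bool) : ℕ := (lackE V K s z).getD 0

def argK (V : Env) (K : ℕ) (s : St) : ℕ :=
  K + max (enL V (tagE V K s true)) (enL V (tagE V K s false))
def argT (V : Env) (K : ℕ) (s : St) : ℕ :=
  max (max s.t (enN V (tagE V K s true))) (enN V (tagE V K s false)) + 1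

def argsOf (V : Env) (d K T : ℕ) (s : St) : Args := (d, argK V K s, argT V K s, T)

def bump (z : Bool) (s : St) : St :=
  ⟨s.t, s.pool, s.prom, bif z then s.jX + 1 else s.jX, bif z then s.jY else s.jY + 1,
    s.reqs, s.stuck⟩

def addReqs (l : List (ℕ × ℕ)) (s : St) : St :=
  ⟨s.t, s.pool, s.prom, s.jX, s.jY, s.reqs ++ l, s.stuck⟩

def setStuck (s : St) : St :=
  ⟨s.t, s.pool, s.prom, s.jX, s.jY, s.reqs, true⟩

def mkEnt (e0 e1 : ℕ) (p : ℕ × ℕ) : Ent := ⟨p.1, p.2, e0, e1, none⟩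

def doneH (k : ℕ) (s : St) : Bool := heavy (s.prom.map Ent.r) k

def callPost (V : Env) (d K : ℕ) (s : St) (res : Res) : St :=
  res.2.casesOn (setStuck (addReqs res.1 s))
    (fun q => addReqs res.1 (advance V d q.2
      (q.1.map (mkEnt (tagE V K s true) (tagE V K s false))) s))

/-- One step. -/
def post (V : Env) (d k K : ℕ) (s : St) (res : Res) : St :=
  bif s.stuck || doneH k s then s
  else bif waiting s then advance V d (s.t + 1) [] s
  else bif (lackE V K s true).isNone then bump true (advance V d (s.t + 1) [] s)
  else bif (lackE V K s false).isNone then bump false (advance V d (s.t + 1) [] s)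
  else callPost V d K s res

def initSt (t0 : ℕ) : St := ⟨t0, [], [], 0, 0, [], false⟩

def runSt (V : Env) (g : Args → Res) (d k K t0 T m : ℕ) : St :=
  Nat.rec (motive := fun _ => St) (initSt t0)
    (fun _ s => post V d k K s (g (argsOf V d K T s))) m

def outSt (k : ℕ) (s : St) : Res :=
  (s.reqs, bif (!s.stuck && doneH k s) then some (s.prom.map (fun E => (E.v, E.r)), s.t) else none)

def Pzero (x : Args) : Res := ([(x.2.2.1, x.2.1)], some ([(x.2.2.1, x.2.1)], x.2.2.1 + 1))

def Psucc (V : Env) (i : ℕ) (g : Args → Res) (x : Args) : Res :=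
  outSt x.2.1 (runSt V g x.1 x.2.1 (x.2.1 + (i + 6)) x.2.2.1 x.2.2.2 x.2.2.2)

def P (V : Env) (i : ℕ) : Args → Res :=
  Nat.rec (motive := fun _ => Args → Res) Pzero (fun i g => Psucc V i g) i

/-! computability -/

def Ent.equiv : Ent ≃ ℕ × ℕ × ℕ × ℕ × Option Bool where
  toFun E := (E.v, E.r, E.eX, E.eY, E.side)
  invFun p := ⟨p.1, p.2.1, p.2.2.1, p.2.2.2.1, p.2.2.2.2⟩
  left_inv _ := rfl
  right_inv _ := rfl

instance : Primcodable Ent := Primcodable.ofEquiv _ Ent.equiv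

def St.equiv : St ≃ ℕ × List Ent × List Ent × ℕ × ℕ × List (ℕ × ℕ) × Bool where
  toFun s := (s.t, s.pool, s.prom, s.jX, s.jY, s.reqs, s.stuck)
  invFun p := ⟨p.1, p.2.1, p.2.2.1, p.2.2.2.1, p.2.2.2.2.1, p.2.2.2.2.2.1, p.2.2.2.2.2.2⟩
  left_inv _ := rfl
  right_inv _ := rfl

instance : Primcodable St := Primcodable.ofEquiv _ St.equiv

section comp
variable {α : Type*} [Primcodable α]

theorem c1 {β γ : Type*} [Primcodable β] [Primcodable γ] {f : α → β × γ} (h : Computable f) :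
    Computable fun a => (f a).1 := Computable.fst.comp h
theorem c2 {β γ : Type*} [Primcodable β] [Primcodable γ] {f : α → β × γ} (h : Computable f) :
    Computable fun a => (f a).2 := Computable.snd.comp h

theorem comp_entE : Computable Ent.equiv := (Primrec.of_equiv (e := Ent.equiv)).to_comp
theorem comp_stE : Computable St.equiv := (Primrec.of_equiv (e := St.equiv)).to_comp

theorem comp_v {f : α → Ent} (h : Computable f) : Computable fun a => (f a).v :=
  c1 (comp_entE.comp h)
theorem comp_r {f : α → Ent} (h : Computable f) : Computable fun a => (f a).r :=
  c1 (c2 (comp_entE.comp h))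
theorem comp_eX {f : α → Ent} (h : Computable f) : Computable fun a => (f a).eX :=
  c1 (c2 (c2 (comp_entE.comp h)))
theorem comp_eY {f : α → Ent} (h : Computable f) : Computable fun a => (f a).eY :=
  c1 (c2 (c2 (c2 (comp_entE.comp h))))
theorem comp_side {f : α → Ent} (h : Computable f) : Computable fun a => (f a).side :=
  c2 (c2 (c2 (c2 (comp_entE.comp h))))
theorem comp_mkE {a1 a2 a3 a4 : α → ℕ} {a5 : α → Option Bool} (h1 : Computable a1)
    (h2 : Computable a2) (h3 : Computable a3) (h4 : Computable a4) (h5 : Computable a5) :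
    Computable fun a => Ent.mk (a1 a) (a2 a) (a3 a) (a4 a) (a5 a) :=
  ((Primrec.of_equiv_symm (e := Ent.equiv)).to_comp).comp
    (Computable.pair h1 (Computable.pair h2 (Computable.pair h3 (Computable.pair h4 h5))))

theorem comp_t {f : α → St} (h : Computable f) : Computable fun a => (f a).t :=
  c1 (comp_stE.comp h)
theorem comp_pool {f : α → St} (h : Computable f) : Computable fun a => (f a).pool :=
  c1 (c2 (comp_stE.comp h))
theorem comp_prom {f : α → St} (h : Computable f) : Computable fun a => (f a).prom :=
  c1 (c2 (c2 (comp_stE.comp h)))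
theorem comp_jX {f : α → St} (h : Computable f) : Computable fun a => (f a).jX :=
  c1 (c2 (c2 (c2 (comp_stE.comp h))))
theorem comp_jY {f : α → St} (h : Computable f) : Computable fun a => (f a).jY :=
  c1 (c2 (c2 (c2 (c2 (comp_stE.comp h)))))
theorem comp_reqs {f : α → St} (h : Computable f) : Computable fun a => (f a).reqs :=
  c1 (c2 (c2 (c2 (c2 (c2 (comp_stE.comp h))))))
theorem comp_stuck {f : α → St} (h : Computable f) : Computable fun a => (f a).stuck :=
  c2 (c2 (c2 (c2 (c2 (c2 (comp_stE.comp h))))))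

theorem comp_mkS0 : Computable St.equiv.symm := (Primrec.of_equiv_symm (e := St.equiv)).to_comp

theorem comp_mkS1 {a1 : α → ℕ} {a2 a3 : α → List Ent} {a4 a5 : α → ℕ} {a6 : α → List (ℕ × ℕ)}
    {a7 : α → Bool} (h1 : Computable a1)
    (h2 : Computable a2) (h3 : Computable a3) (h4 : Computable a4) (h5 : Computable a5)
    (h6 : Computable a6) (h7 : Computable a7) : 
    Computable fun a => (a1 a, a2 a, a3 a, a4 a, a5 a, a6 a, a7 a) := by
  have q6 := Computable.pair h6 h7
  have q5 := Computable.pair h5 q6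
  have q4 := Computable.pair h4 q5
  have q3 := Computable.pair h3 q4
  have q2 := Computable.pair h2 q3
  exact Computable.pair h1 q2

theorem comp_mkS {a1 : α → ℕ} {a2 a3 : α → List Ent} {a4 a5 : α → ℕ} {a6 : α → List (ℕ × ℕ)}
    {a7 : α → Bool} (h1 : Computable a1)
    (h2 : Computable a2) (h3 : Computable a3) (h4 : Computable a4) (h5 : Computable a5)
    (h6 : Computable a6) (h7 : Computable a7) :
    Computable fun a => St.mk (a1 a) (a2 a) (a3 a) (a4 a) (a5 a) (a6 a) (a7 a) := by
  have hp := comp_mkS1 h1 h2 h3 h4 h5 h6 h7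
  have := comp_mkS0.comp hp
  exact this

theorem comp_tag {f : α → Ent} {z : α → Bool} (h : Computable f) (hz : Computable z) :
    Computable fun a => (f a).tag (z a) := Computable.cond hz (comp_eX h) (comp_eY h)
theorem comp_j {f : α → St} {z : α → Bool} (h : Computable f) (hz : Computable z) :
    Computable fun a => (f a).j (z a) := Computable.cond hz (comp_jX h) (comp_jY h)

theorem comp_heavy {l : α → List ℕ} {k : α → ℕ} (hl : Computable l) (hk : Computable k) :
    Computable fun a => heavy (l a) (k a) := by
  refine comp_le (comp_pow2 (comp_sum hl)) (comp_mul (comp_pow2 hk) (comp_sum (comp_map hl ?_)))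
  exact comp_pow2 (comp_sub (comp_sum (hl.comp Computable.fst)) Computable.snd)

/-- Computability of the environment. -/
structure EnvComp (V : Env) : Prop where
  en : Computable V.en
  xs : Computable fun p : Bool × ℕ × ℕ => V.xs p.1 p.2.1 p.2.2


theorem comp_xs {V : Env} (hV : EnvComp V) {z : α → Bool} {t n : α → ℕ} (hz : Computable z) (ht : Computable t)
    (hn : Computable n) : Computable fun a => V.xs (z a) (t a) (n a) :=
  hV.xs.comp (Computable.pair hz (Computable.pair ht hn))

theorem comp_desc {V : Env} (hV : EnvComp V) {t ℓ : α → ℕ} {σ : α → Str} (ht : Computable t) (hσ : Computable σ)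
    (hℓ : Computable ℓ) : Computable fun a => descOf V (t a) (σ a) (ℓ a) := by
  refine comp_any (comp_range ht) ?_
  refine Computable.option_getD (Computable.option_map (hV.en.comp Computable.snd) ?_)
    (Computable.const false)
  exact comp_and (comp_le (c1 Computable.snd) (hℓ.comp (c1 Computable.fst)))
    (comp_beq (c2 Computable.snd) (hσ.comp (c1 Computable.fst)))

theorem comp_settle {V : Env} (hV : EnvComp V) {d t : α → ℕ} {E : α → Ent} (hd : Computable d) (ht : Computable t)
    (hE : Computable E) : Computable fun a => settle V (d a) (t a) (E a) := by
  refine comp_mkE (comp_v hE) (comp_r hE) (comp_eX hE) (comp_eY hE) ?_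
  refine Computable.option_casesOn (comp_side hE) ?_ (Computable.option_some.comp Computable.snd)
  have hl : Computable fun a => (E a).r + (V.b + d a) :=
    comp_add (comp_r hE) (comp_add (Computable.const _) hd)
  exact Computable.cond
    (comp_desc hV ht (comp_xs hV (Computable.const true) ht (comp_v hE)) hl)
    (Computable.const _) (Computable.cond
    (comp_desc hV ht (comp_xs hV (Computable.const false) ht (comp_v hE)) hl)
    (Computable.const _) (Computable.const _))

theorem comp_moved {V : Env} (hV : EnvComp V) {t t' : α → ℕ} {E : α → Ent} (ht : Computable t) (ht' : Computable t')
    (hE : Computable E) : Computable fun a => moved V (t a) (t' a) (E a) := by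
  refine Computable.option_getD (Computable.option_map (comp_side hE) ?_) (Computable.const false)
  have hf := fun {β : Type} [Primcodable β] {f : α → β} (h : Computable f) =>
    h.comp (Computable.fst (α := α) (β := Bool))
  exact comp_not (comp_beq (comp_xs hV Computable.snd (ht.comp Computable.fst)
      (comp_v (hE.comp Computable.fst)))
    (comp_xs hV Computable.snd (ht'.comp Computable.fst) (comp_v (hE.comp Computable.fst))))

theorem comp_advance {V : Env} (hV : EnvComp V) {d t' : α → ℕ} {new : α → List Ent} {s : α → St} (hd : Computable d)
    (ht' : Computable t') (hn : Computable new) (hs : Computable s) :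
    Computable fun a => advance V (d a) (t' a) (new a) (s a) := by
  refine comp_mkS ht' ?_ ?_ (comp_jX hs) (comp_jY hs) (comp_reqs hs) (comp_stuck hs)
  · refine Computable.list_append.comp (comp_map (comp_filter (comp_pool hs) ?_) ?_) hn
    · exact comp_not (comp_moved hV (comp_t (hs.comp Computable.fst)) (ht'.comp Computable.fst)
        Computable.snd)
    · exact comp_settle hV (hd.comp Computable.fst) (ht'.comp Computable.fst) Computable.snd
  · refine Computable.list_append.comp (comp_prom hs) (comp_filter (comp_pool hs) ?_)
    exact comp_moved hV (comp_t (hs.comp Computable.fst)) (ht'.comp Computable.fst) Computable.snd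

theorem comp_lackE {V : Env} (hV : EnvComp V) {K : α → ℕ} {s : α → St} {z : α → Bool} (hK : Computable K)
    (hs : Computable s) (hz : Computable z) : Computable fun a => lackE V (K a) (s a) (z a) := by
  refine Primrec.list_head?.to_comp.comp (comp_filter (comp_range (comp_j hs hz)) ?_)
  refine Computable.option_getD (Computable.option_map (hV.en.comp Computable.snd) ?_)
    (Computable.const false)
  refine comp_not (comp_heavy (comp_map (comp_filter
    (comp_pool (hs.comp (c1 Computable.fst))) ?_) (comp_r Computable.snd))
    (comp_add (hK.comp (c1 Computable.fst)) (c1 Computable.snd)))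
  have hz' := hz.comp (c1 (c1 (Computable.fst (α := (α × ℕ) × (ℕ × Str)) (β := Ent))))
  exact comp_and (comp_beq (comp_side Computable.snd) (Computable.option_some.comp hz'))
    (comp_beq (comp_tag Computable.snd hz') (c2 (c1 Computable.fst)))

theorem comp_tagE {V : Env} (hV : EnvComp V) {K : α → ℕ} {s : α → St} {z : α → Bool} (hK : Computable K)
    (hs : Computable s) (hz : Computable z) : Computable fun a => tagE V (K a) (s a) (z a) :=
  Computable.option_getD (comp_lackE hV hK hs hz) (Computable.const 0)

theorem comp_enL {V : Env} (hV : EnvComp V) {e : α → ℕ} (he : Computable e) : Computable fun a => enL V (e a) :=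
  Computable.option_getD (Computable.option_map (hV.en.comp he) (c1 Computable.snd))
    (Computable.const 0)
theorem comp_enN {V : Env} (hV : EnvComp V) {e : α → ℕ} (he : Computable e) : Computable fun a => enN V (e a) :=
  Computable.option_getD (Computable.option_map (hV.en.comp he)
    (Computable.list_length.comp (c2 Computable.snd))) (Computable.const 0)

theorem comp_args {V : Env} (hV : EnvComp V) {d K T : α → ℕ} {s : α → St} (hd : Computable d) (hK : Computable K)
    (hT : Computable T) (hs : Computable s) :
    Computable fun a => argsOf V (d a) (K a) (T a) (s a) := by
  have t1 := comp_tagE hV hK hs (Computable.const true)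
  have t0 := comp_tagE hV hK hs (Computable.const false)
  refine Computable.pair hd (Computable.pair ?_ (Computable.pair ?_ hT))
  · exact comp_add hK (comp_max (comp_enL hV t1) (comp_enL hV t0))
  · exact Computable.succ.comp (comp_max (comp_max (comp_t hs) (comp_enN hV t1)) (comp_enN hV t0))

theorem comp_waiting {V : Env} (hV : EnvComp V) {s : α → St} (hs : Computable s) : Computable fun a => waiting (s a) :=
  comp_any (comp_pool hs) (comp_beq (comp_side Computable.snd) (Computable.const none))

theorem comp_doneH {V : Env} (hV : EnvComp V) {s : α → St} {k : α → ℕ} (hs : Computable s) (hk : Computable k) :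
    Computable fun a => doneH (k a) (s a) :=
  comp_heavy (comp_map (comp_prom hs) (comp_r Computable.snd)) hk

theorem comp_bump {V : Env} (hV : EnvComp V) {s : α → St} (z : Bool) (hs : Computable s) :
    Computable fun a => bump z (s a) := by
  refine comp_mkS (comp_t hs) (comp_pool hs) (comp_prom hs) ?_ ?_ (comp_reqs hs) (comp_stuck hs)
  · exact Computable.cond (Computable.const z) (Computable.succ.comp (comp_jX hs)) (comp_jX hs)
  · exact Computable.cond (Computable.const z) (comp_jY hs) (Computable.succ.comp (comp_jY hs))

theorem comp_addReqs {V : Env} (hV : EnvComp V) {s : α → St} {l : α → List (ℕ × ℕ)} (hl : Computable l) (hs : Computable s) :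
    Computable fun a => addReqs (l a) (s a) :=
  comp_mkS (comp_t hs) (comp_pool hs) (comp_prom hs) (comp_jX hs) (comp_jY hs)
    (Computable.list_append.comp (comp_reqs hs) hl) (comp_stuck hs)

theorem comp_setStuck {V : Env} (hV : EnvComp V) {s : α → St} (hs : Computable s) : Computable fun a => setStuck (s a) :=
  comp_mkS (comp_t hs) (comp_pool hs) (comp_prom hs) (comp_jX hs) (comp_jY hs)
    (comp_reqs hs) (Computable.const true)

theorem comp_callPost {V : Env} (hV : EnvComp V) {d K : α → ℕ} {s : α → St} {res : α → Res} (hd : Computable d)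
    (hK : Computable K) (hs : Computable s) (hr : Computable res) :
    Computable fun a => callPost V (d a) (K a) (s a) (res a) := by
  have hr1 : Computable fun a => (res a).1 := Computable.fst.comp hr
  have hA : Computable fun a => setStuck (addReqs (res a).1 (s a)) :=
    comp_setStuck hV (comp_addReqs hV hr1 hs)
  have hB : Computable₂ fun (a : α) (q : List (ℕ × ℕ) × ℕ) => addReqs (res a).1
      (advance V (d a) q.2 (q.1.map (mkEnt (tagE V (K a) (s a) true) (tagE V (K a) (s a) false)))
        (s a)) := by
    refine comp_addReqs hV (hr1.comp Computable.fst) (comp_advance hV (hd.comp Computable.fst)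
      (c2 Computable.snd) (comp_map (c1 Computable.snd) ?_) (hs.comp Computable.fst))
    have hf : Computable fun x : (α × (List (ℕ × ℕ) × ℕ)) × (ℕ × ℕ) => x.1.1 := c1 Computable.fst
    exact comp_mkE (c1 Computable.snd) (c2 Computable.snd)
      (comp_tagE hV (hK.comp hf) (hs.comp hf) (Computable.const true))
      (comp_tagE hV (hK.comp hf) (hs.comp hf) (Computable.const false)) (Computable.const none)
  exact Computable.option_casesOn (c2 hr) hA hB

theorem comp_post {V : Env} (hV : EnvComp V) {d k K : α → ℕ} {s : α → St} {res : α → Res} (hd : Computable d)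
    (hk : Computable k) (hK : Computable K) (hs : Computable s) (hr : Computable res) :
    Computable fun a => post V (d a) (k a) (K a) (s a) (res a) := by
  have hadv : Computable fun a => advance V (d a) ((s a).t + 1) [] (s a) :=
    comp_advance hV hd (Computable.succ.comp (comp_t hs)) (Computable.const []) hs
  have hnone : ∀ z, Computable fun a => (lackE V (K a) (s a) z).isNone := fun z => by
    refine (comp_not (Primrec.option_isSome.to_comp.comp
      (comp_lackE hV hK hs (Computable.const z)))).of_eq fun a => ?_
    simp
  exact Computable.cond (comp_or (comp_stuck hs) (comp_doneH hV hs hk)) hs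
    (Computable.cond (comp_waiting hV hs) hadv
      (Computable.cond (hnone true) (comp_bump hV true hadv)
        (Computable.cond (hnone false) (comp_bump hV false hadv)
          (comp_callPost hV hd hK hs hr))))

theorem comp_out {V : Env} (hV : EnvComp V) {s : α → St} {k : α → ℕ} (hs : Computable s) (hk : Computable k) :
    Computable fun a => outSt (k a) (s a) := by
  refine Computable.pair (comp_reqs hs) (Computable.cond
    (comp_and (comp_not (comp_stuck hs)) (comp_doneH hV hs hk)) ?_ (Computable.const none))
  exact Computable.option_some.comp (Computable.pair (comp_map (comp_prom hs)
    (Computable.pair (comp_v Computable.snd) (comp_r Computable.snd))) (comp_t hs))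

theorem comp_initSt {V : Env} (hV : EnvComp V) {t0 : α → ℕ} (h : Computable t0) : Computable fun a => initSt (t0 a) :=
  comp_mkS h (Computable.const []) (Computable.const []) (Computable.const 0)
    (Computable.const 0) (Computable.const []) (Computable.const false)

theorem comp_run {V : Env} (hV : EnvComp V) {g : Args → Res} (hg : Computable g) {d k K t0 T m : α → ℕ} (hd : Computable d)
    (hk : Computable k) (hK : Computable K) (ht : Computable t0) (hT : Computable T)
    (hm : Computable m) :
    Computable fun a => runSt V g (d a) (k a) (K a) (t0 a) (T a) (m a) := by
  have hf : Computable fun x : α × (ℕ × St) => x.1 := Computable.fst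
  refine Computable.nat_rec (f := m) (g := fun a => initSt (t0 a))
    (h := fun a p => post V (d a) (k a) (K a) p.2 (g (argsOf V (d a) (K a) (T a) p.2)))
    hm (comp_initSt hV ht) ?_
  exact comp_post hV (hd.comp hf) (hk.comp hf) (hK.comp hf) (c2 Computable.snd)
    (hg.comp (comp_args hV (hd.comp hf) (hK.comp hf) (hT.comp hf) (c2 Computable.snd)))

end comp

end PartC1

section PartC2

open Nat.Partrec (Code)

theorem P_succ (V : Env) (i : ℕ) : P V (i + 1) = Psucc V i (P V i) := rfl

theorem code_of {α σ : Type*} [Primcodable α] [Primcodable σ] {f : α →. σ} (hf : Partrec f) :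
    ∃ c : Code, ∀ a, c.eval (Encodable.encode a) = (f a).map Encodable.encode := by
  obtain ⟨c, hc⟩ := Code.exists_code.1 hf
  refine ⟨c, fun a => ?_⟩
  rw [hc]; simp

abbrev PhiArgs := (ℕ × Code) × Args

def phiStep (V : Env) (a : PhiArgs) (s : St) : Part St :=
  (a.1.2.eval (Encodable.encode (argsOf V a.2.1 (a.2.2.1 + (a.1.1 + 6)) a.2.2.2.2 s))).map
    fun o => post V a.2.1 a.2.2.1 (a.2.2.1 + (a.1.1 + 6)) s
      ((Encodable.decode (α := Res) o).getD ([], none))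

def phiLoop (V : Env) (a : PhiArgs) : Part St :=
  Nat.rec (motive := fun _ => Part St) (Part.some (initSt a.2.2.2.1))
    (fun _ IH => IH.bind fun s => phiStep V a s) a.2.2.2.2

theorem phiStep_partrec {V : Env} (hV : EnvComp V) :
    Partrec₂ fun (a : PhiArgs) (s : St) => phiStep V a s := by
  have hd : Computable fun x : PhiArgs × St => x.1.2.1 := c1 (c2 Computable.fst)
  have hk : Computable fun x : PhiArgs × St => x.1.2.2.1 := c1 (c2 (c2 Computable.fst))
  have hT : Computable fun x : PhiArgs × St => x.1.2.2.2.2 := c2 (c2 (c2 (c2 Computable.fst)))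
  have hi : Computable fun x : PhiArgs × St => x.1.1.1 := c1 (c1 Computable.fst)
  have hc : Computable fun x : PhiArgs × St => x.1.1.2 := c2 (c1 Computable.fst)
  have hK : Computable fun x : PhiArgs × St => x.1.2.2.1 + (x.1.1.1 + 6) :=
    comp_add hk (comp_add hi (Computable.const 6))
  have hs : Computable fun x : PhiArgs × St => x.2 := Computable.snd
  have h1 : Partrec fun x : PhiArgs × St => x.1.1.2.eval (Encodable.encode
      (argsOf V x.1.2.1 (x.1.2.2.1 + (x.1.1.1 + 6)) x.1.2.2.2.2 x.2)) :=
    Code.eval_part.comp hc (Computable.encode.comp (comp_args hV hd hK hT hs))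
  have h2 : Computable₂ fun (x : PhiArgs × St) (o : ℕ) => post V x.1.2.1 x.1.2.2.1
      (x.1.2.2.1 + (x.1.1.1 + 6)) x.2 ((Encodable.decode (α := Res) o).getD ([], none)) := by
    have hf : Computable fun y : (PhiArgs × St) × ℕ => y.1 := Computable.fst
    refine comp_post hV (hd.comp hf) (hk.comp hf) (hK.comp hf) (hs.comp hf) ?_
    exact Computable.option_getD (Computable.decode.comp Computable.snd) (Computable.const _)
  exact h1.map h2

theorem phiLoop_partrec {V : Env} (hV : EnvComp V) : Partrec (phiLoop V) := by
  refine Partrec.nat_rec (f := fun a : PhiArgs => a.2.2.2.2)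
    (g := fun a => Part.some (initSt a.2.2.2.1)) (h := fun a p => phiStep V a p.2)
    (c2 (c2 (c2 Computable.snd))) ?_ ?_
  · exact comp_initSt hV (c1 (c2 (c2 Computable.snd)))
  · exact (phiStep_partrec hV).comp Computable.fst (c2 Computable.snd)

theorem phiLoop_eq {V : Env} {i : ℕ} {c : Code} {g : Args → Res}
    (hc : ∀ x, c.eval (Encodable.encode x) = Part.some (Encodable.encode (g x))) (x : Args) :
    phiLoop V ((i, c), x) =
      Part.some (runSt V g x.1 x.2.1 (x.2.1 + (i + 6)) x.2.2.1 x.2.2.2 x.2.2.2) := by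
  unfold phiLoop runSt
  have hstep : ∀ s, phiStep V ((i, c), x) s = Part.some (post V x.1 x.2.1 (x.2.1 + (i + 6)) s
      (g (argsOf V x.1 (x.2.1 + (i + 6)) x.2.2.2 s))) := by
    intro s
    unfold phiStep
    simp only [hc, Part.map_some, Encodable.encodek, Option.getD_some]
  generalize hm : x.2.2.2 = m
  rw [hm] at hstep
  simp only [hm]
  have key : ∀ n : ℕ, (Nat.rec (motive := fun _ => Part St) (Part.some (initSt x.2.2.1))
      (fun _ IH => IH.bind fun s => phiStep V ((i, c), x) s) n) =
      Part.some (Nat.rec (motive := fun _ => St) (initSt x.2.2.1)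
        (fun _ s => post V x.1 x.2.1 (x.2.1 + (i + 6)) s
          (g (argsOf V x.1 (x.2.1 + (i + 6)) m s))) n) := by
    intro n
    induction n with
    | zero => rfl
    | succ n ih =>
      simp only [ih, Part.bind_some]
      exact hstep _
  exact key m

theorem comp_P {V : Env} (hV : EnvComp V) : Computable fun p : ℕ × Args => P V p.1 p.2 := by
  have hPz : Computable Pzero := by
    have h1 : Computable fun x : Args => x.2.1 := c1 Computable.snd
    have h2 : Computable fun x : Args => x.2.2.1 := c1 (c2 Computable.snd)
    have h3 : Computable fun x : Args => [(x.2.2.1, x.2.1)] :=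
      Computable.list_cons.comp (Computable.pair h2 h1) (Computable.const [])
    exact Computable.pair h3 (Computable.option_some.comp
      (Computable.pair h3 (Computable.succ.comp h2)))
  obtain ⟨c0, hc0⟩ := code_of hPz
  have hphi : Partrec fun a : PhiArgs => (phiLoop V a).map fun s => outSt a.2.2.1 s :=
    (phiLoop_partrec hV).map (comp_out hV Computable.snd (c1 (c2 (c2 Computable.fst))))
  obtain ⟨cf, hcf⟩ := code_of hphi
  let C : ℕ → Code := fun i => Nat.rec (motive := fun _ => Code) c0
    (fun i c => Code.curry cf (Encodable.encode (i, c))) i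
  have hC : Computable C := by
    refine Computable.nat_rec (f := fun i : ℕ => i) (g := fun _ => c0)
      (h := fun _ p => Code.curry cf (Encodable.encode (p.1, p.2)))
      Computable.id (Computable.const _) ?_
    exact Code.primrec₂_curry.to_comp.comp (Computable.const cf)
      (Computable.encode.comp Computable.snd)
  have hCP : ∀ i x, (C i).eval (Encodable.encode x) = Part.some (Encodable.encode (P V i x)) := by
    intro i
    induction i with
    | zero =>
      intro x
      have h0 : c0.eval (Encodable.encode x) = Part.some (Encodable.encode (Pzero x)) := by
        rw [hc0 x]; exact Part.map_some _ _
      exact h0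
    | succ i ih =>
      intro x
      have : C (i + 1) = Code.curry cf (Encodable.encode (i, C i)) := rfl
      rw [this, Code.eval_curry]
      have h2 := hcf ((i, C i), x)
      rw [phiLoop_eq ih x] at h2
      rw [Part.map_some, Part.map_some] at h2
      exact h2
  have hpart : Partrec fun p : ℕ × Args => (C p.1).eval (Encodable.encode p.2) :=
    Code.eval_part.comp (hC.comp Computable.fst) (Computable.encode.comp Computable.snd)
  have h3 : Partrec fun p : ℕ × Args => ((C p.1).eval (Encodable.encode p.2)).map
      fun o => (Encodable.decode (α := Res) o).getD ([], none) :=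
    hpart.map (Computable.option_getD (Computable.decode.comp Computable.snd)
      (Computable.const _))
  refine h3.of_eq fun p => ?_
  rw [hCP, Part.map_some, Encodable.encodek]; rfl

end PartC2

section PartC3

/-! weights of lists -/

noncomputable def wt {α : Type*} (f : α → ℕ) (l : List α) : ℝ := (l.map fun a => (1/2 : ℝ) ^ (f a)).sum

section wt
variable {α β : Type*} (f : α → ℕ)

@[simp] theorem wt_nil : wt f [] = 0 := rfl
@[simp] theorem wt_cons (a : α) (l : List α) : wt f (a :: l) = (1/2 : ℝ) ^ (f a) + wt f l := by
  simp [wt]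
@[simp] theorem wt_append (l l' : List α) : wt f (l ++ l') = wt f l + wt f l' := by
  simp [wt]
theorem wt_nonneg (l : List α) : 0 ≤ wt f l := by
  induction l with
  | nil => simp
  | cons a l ih => rw [wt_cons]; positivity
theorem wt_map (g : β → α) (l : List β) : wt f (l.map g) = wt (fun b => f (g b)) l := by
  simp [wt, Function.comp_def]
theorem wt_filter_add (p : α → Bool) (l : List α) :
    wt f (l.filter fun a => !p a) + wt f (l.filter fun a => p a) = wt f l := by
  induction l with
  | nil => simp
  | cons a l ih =>
    cases h : p a <;> simp [h] <;> linarith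
theorem wt_filter_le (p : α → Bool) (l : List α) : wt f (l.filter p) ≤ wt f l := by
  have := wt_filter_add f p l
  have := wt_nonneg f (l.filter fun a => !p a)
  linarith
theorem wt_filter_mono {p q : α → Bool} {l : List α} (h : ∀ a ∈ l, p a = true → q a = true) :
    wt f (l.filter p) ≤ wt f (l.filter q) := by
  induction l with
  | nil => simp
  | cons a l ih =>
    have ih' := ih fun b hb => h b (List.mem_cons_of_mem _ hb)
    have ha := h a List.mem_cons_self
    cases hp : p a <;> cases hq : q a <;> simp [hp, hq] at ha ⊢
    · exact ih'
    · have : (0:ℝ) < (2 ^ f a)⁻¹ := by positivity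
      linarith
    · exact ih'
theorem wt_le_group (S : Finset ℕ) (q : ℕ → α → Bool) {l : List α}
    (h : ∀ a ∈ l, ∃ e ∈ S, q e a = true) :
    wt f l ≤ ∑ e ∈ S, wt f (l.filter (q e)) := by
  induction l with
  | nil => simp
  | cons a l ih =>
    have ih' := ih fun b hb => h b (List.mem_cons_of_mem _ hb)
    obtain ⟨e, he, hq⟩ := h a List.mem_cons_self
    have key : ∀ e, wt f ((a :: l).filter (q e)) =
        (if q e a = true then (1/2:ℝ) ^ f a else 0) + wt f (l.filter (q e)) := by
      intro e
      cases hh : q e a <;> simp [hh]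
    simp only [key, Finset.sum_add_distrib, wt_cons]
    have : (1/2:ℝ) ^ f a ≤ ∑ e ∈ S, if q e a = true then (1/2:ℝ) ^ f a else 0 := by
      have := Finset.single_le_sum (f := fun e => if q e a = true then (1/2:ℝ) ^ f a else 0)
        (s := S) (fun i _ => by positivity) he
      simpa [hq] using this
    linarith
theorem group_le_wt (S : Finset ℕ) (q : ℕ → α → Bool) {l : List α}
    (h : ∀ a ∈ l, ∀ e e', q e a = true → q e' a = true → e = e') :
    ∑ e ∈ S, wt f (l.filter (q e)) ≤ wt f l := by
  induction l with
  | nil => simp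
  | cons a l ih =>
    have ih' := ih fun b hb => h b (List.mem_cons_of_mem _ hb)
    have key : ∀ e, wt f ((a :: l).filter (q e)) =
        (if q e a = true then (1/2:ℝ) ^ f a else 0) + wt f (l.filter (q e)) := by
      intro e
      cases hh : q e a <;> simp [hh]
    simp only [key, Finset.sum_add_distrib, wt_cons]
    have : ∑ e ∈ S, (if q e a = true then (1/2:ℝ) ^ f a else 0) ≤ (1/2:ℝ) ^ f a := by
      by_cases hx : ∃ e ∈ S, q e a = true
      · obtain ⟨e, he, hq⟩ := hx
        rw [Finset.sum_eq_single_of_mem e he]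
        · simp [hq]
        · intro b _ hb
          rw [if_neg]
          intro hqb
          exact hb (h a List.mem_cons_self _ _ hqb hq)
      · push Not at hx
        rw [Finset.sum_eq_zero]
        · positivity
        · intro e he; rw [if_neg (hx e he)]
    linarith
end wt

theorem heavy_iff (l : List ℕ) (k : ℕ) :
    heavy l k = true ↔ (1/2:ℝ) ^ k ≤ wt (fun r => r) l := by
  have key : ∀ (l' : List ℕ) (N : ℕ), (∀ r ∈ l', r ≤ N) →
      (((l'.map fun r => 2 ^ (N - r)).sum : ℕ) : ℝ) = 2 ^ N * wt (fun r => r) l' := by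
    intro l' N hN
    induction l' with
    | nil => simp
    | cons a l' ih =>
      have ha := hN a List.mem_cons_self
      simp only [List.map_cons, List.sum_cons, Nat.cast_add, wt_cons,
        ih fun r hr => hN r (List.mem_cons_of_mem _ hr), mul_add]
      congr 1
      push_cast
      rw [pow_sub₀ _ (by norm_num) ha]
      simp
  have hs : ∀ r ∈ l, r ≤ l.sum := fun r hr => List.single_le_sum (by simp) r hr
  have hk := key l l.sum hs
  unfold heavy
  rw [Nat.ble_eq, ← Nat.cast_le (α := ℝ)]
  push_cast at hk ⊢
  rw [hk, one_div, inv_pow, inv_le_iff_one_le_mul₀ (by positivity)]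
  have h2 : (0:ℝ) < 2 ^ l.sum := by positivity
  constructor
  · intro h
    have : (2:ℝ) ^ l.sum * 1 ≤ 2 ^ l.sum * (wt (fun r => r) l * 2 ^ k) := by
      linarith
    exact le_of_mul_le_mul_left this h2
  · intro h
    nlinarith

theorem doneH_iff (k : ℕ) (s : St) : doneH k s = true ↔ (1/2:ℝ) ^ k ≤ wt Ent.r s.prom := by
  unfold doneH
  rw [heavy_iff, wt_map]

theorem doneH_false (k : ℕ) (s : St) (h : doneH k s = false) : wt Ent.r s.prom < (1/2:ℝ) ^ k := by
  by_contra hc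
  push Not at hc
  rw [← doneH_iff, h] at hc
  exact absurd hc (by simp)

/-! environment -/

structure EnvOK (V : Env) : Prop where
  kraft : ∀ F : Finset ℕ, ∑ e ∈ F, pw ((V.en e).map Prod.fst) ≤ 1
  len : ∀ z t n, (V.xs z t n).length = n
  pre : ∀ z t n m, n ≤ m → V.xs z t n = (V.xs z t m).take n
  noret : ∀ z n t t' t'', t ≤ t' → t' ≤ t'' → V.xs z t n = V.xs z t'' n → V.xs z t' n = V.xs z t n

theorem descOf_iff (V : Env) (t : ℕ) (σ : Str) (ℓ : ℕ) :
    descOf V t σ ℓ = true ↔ ∃ e l, e < t ∧ l ≤ ℓ ∧ V.en e = some (l, σ) := by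
  unfold descOf
  rw [List.any_eq_true]
  constructor
  · rintro ⟨e, he, h⟩
    rw [List.mem_range] at he
    cases hp : V.en e with
    | none => simp [hp] at h
    | some p =>
      simp [hp] at h
      exact ⟨e, p.1, he, h.1, by rw [← h.2, hp]⟩
  · rintro ⟨e, l, he, hl, hp⟩
    exact ⟨e, List.mem_range.2 he, by simp [hp, hl]⟩

theorem descOf_mono (V : Env) {t t' : ℕ} (h : t ≤ t') (σ : Str) (ℓ : ℕ)
    (hd : descOf V t σ ℓ = true) : descOf V t' σ ℓ = true := by
  rw [descOf_iff] at hd ⊢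
  obtain ⟨e, l, he, h2⟩ := hd
  exact ⟨e, l, by omega, h2⟩

def staleSet (V : Env) (d t v r : ℕ) (z : Bool) : Finset Str :=
  ((Finset.range t).image fun s => V.xs z s v).filter fun σ =>
    σ ≠ V.xs z t v ∧ descOf V t σ (r + (V.b + d)) = true

def stale (V : Env) (d t v r : ℕ) : ℕ :=
  (staleSet V d t v r true).card + (staleSet V d t v r false).card

section

theorem staleSet_mono {V : Env} (hV : EnvOK V) {d t t' v r : ℕ} {z : Bool} (h : t ≤ t') :
    staleSet V d t v r z ⊆ staleSet V d t' v r z := by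
  intro σ hσ
  simp only [staleSet, Finset.mem_filter, Finset.mem_image, Finset.mem_range] at hσ ⊢
  obtain ⟨⟨s, hs, rfl⟩, hne, hd⟩ := hσ
  refine ⟨⟨s, by omega, rfl⟩, ?_, descOf_mono V h _ _ hd⟩
  intro heq
  exact hne (hV.noret z v s t t' hs.le h heq).symm

theorem stale_mono {V : Env} (hV : EnvOK V) {d t t' v r : ℕ} (h : t ≤ t') : stale V d t v r ≤ stale V d t' v r :=
  Nat.add_le_add (Finset.card_le_card (staleSet_mono hV h))
    (Finset.card_le_card (staleSet_mono hV h))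

theorem stale_moved {V : Env} (hV : EnvOK V) {d t t' v r : ℕ} {z : Bool} (h : t < t')
    (hd : descOf V t (V.xs z t v) (r + (V.b + d)) = true) (hm : V.xs z t v ≠ V.xs z t' v) :
    stale V d t v r + 1 ≤ stale V d t' v r := by
  have hlt : (staleSet V d t v r z).card < (staleSet V d t' v r z).card := by
    apply Finset.card_lt_card
    refine ⟨staleSet_mono hV h.le, fun hsub => ?_⟩
    have hin : V.xs z t v ∈ staleSet V d t' v r z := by
      simp only [staleSet, Finset.mem_filter, Finset.mem_image, Finset.mem_range]
      exact ⟨⟨t, h, rfl⟩, hm, descOf_mono V h.le _ _ hd⟩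
    have := hsub hin
    simp [staleSet] at this
  have h1 := Finset.card_le_card (staleSet_mono hV (d := d) (v := v) (r := r) (z := true) h.le)
  have h2 := Finset.card_le_card (staleSet_mono hV (d := d) (v := v) (r := r) (z := false) h.le)
  unfold stale
  cases z <;> omega
end

/-! the specification -/

noncomputable def cc (i : ℕ) : ℝ := 2 - (1/2) ^ i

theorem cc_ge (i : ℕ) : 1 ≤ cc i := by
  have : (1/2:ℝ) ^ i ≤ 1 := pow_le_one₀ (by norm_num) (by norm_num)
  unfold cc; linarith
theorem cc_le (i : ℕ) : cc i ≤ 2 := by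
  have : (0:ℝ) < (1/2:ℝ) ^ i := by positivity
  unfold cc; linarith

structure SpecAt (V : Env) (i d k t0 : ℕ) (res : Res) : Prop where
  wreq : wt Prod.snd res.1 ≤ cc i * (1/2) ^ k
  lo : ∀ q, res.2 = some q → (1/2:ℝ) ^ k ≤ wt Prod.snd q.1
  hi : ∀ q, res.2 = some q → wt Prod.snd q.1 ≤ cc i * (1/2) ^ k
  time : ∀ q, res.2 = some q → t0 < q.2
  nodup : ∀ q, res.2 = some q → (q.1.map Prod.fst).Nodup
  mem : ∀ q, res.2 = some q → ∀ p ∈ q.1, t0 ≤ p.1 ∧ p.1 < q.2 ∧ i ≤ stale V d q.2 p.1 p.2 ∧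
    p ∈ res.1

def Spec (V : Env) (i d : ℕ) (g : Args → Res) : Prop :=
  ∀ k t0 T, SpecAt V i d k t0 (g (d, k, t0, T))

def zfree (z : Bool) (e : ℕ) (E : Ent) : Bool := decide (E.tag z = e) && !decide (E.side = some !z)

structure EntOK (V : Env) (t0 t : ℕ) (reqs : List (ℕ × ℕ)) (E : Ent) : Prop where
  lo : t0 ≤ E.v
  hi : E.v < t
  tag : ∀ z, ∃ l σ, V.en (E.tag z) = some (l, σ) ∧ σ.length < E.v
  req : (E.v, E.r) ∈ reqs

structure Inv (V : Env) (i d k K t0 : ℕ) (s : St) : Prop where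
  time : t0 ≤ s.t
  poolz : ∀ z e l σ, V.en e = some (l, σ) →
    wt Ent.r (s.pool.filter (zfree z e)) ≤ 3 * (1/2) ^ (K + l)
  tot : wt Ent.r s.prom + wt Ent.r s.pool ≤ (1/2) ^ k + 8 * (1/2) ^ K
  reqw : wt Prod.snd s.reqs ≤ cc i * (wt Ent.r s.prom + wt Ent.r s.pool) +
    (bif s.stuck then 2 * (1/2) ^ K else 0)
  nodup : ((s.prom ++ s.pool).map Ent.v).Nodup
  ent : ∀ E ∈ s.prom ++ s.pool, EntOK V t0 s.t s.reqs E
  side : ∀ E ∈ s.pool, ∀ z, E.side = some z →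
    descOf V s.t (V.xs z s.t E.v) (E.r + (V.b + d)) = true
  stpool : ∀ E ∈ s.pool, i ≤ stale V d s.t E.v E.r
  stprom : ∀ E ∈ s.prom, i + 1 ≤ stale V d s.t E.v E.r

theorem inv_init (V : Env) (i d k K t0 : ℕ) : Inv V i d k K t0 (initSt t0) := by
  constructor <;> simp [initSt]
  positivity

theorem inv_bump {V : Env} {i d k K t0 : ℕ} {s : St} (z : Bool) (h : Inv V i d k K t0 s) :
    Inv V i d k K t0 (bump z s) :=
  ⟨h.time, h.poolz, h.tot, h.reqw, h.nodup, h.ent, h.side, h.stpool, h.stprom⟩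

theorem inv_stuck {V : Env} {i d k K t0 : ℕ} {s : St} (h : Inv V i d k K t0 s)
    (hs : s.stuck = false) {l : List (ℕ × ℕ)} (hl : wt Prod.snd l ≤ 2 * (1/2) ^ K) :
    Inv V i d k K t0 (setStuck (addReqs l s)) := by
  refine ⟨h.time, h.poolz, h.tot, ?_, h.nodup, ?_, h.side, h.stpool, h.stprom⟩
  · have := h.reqw
    simp only [hs, cond_false] at this
    simp only [setStuck, addReqs, wt_append, cond_true]
    linarith
  · intro E hE
    have := h.ent E hE
    exact ⟨this.lo, this.hi, this.tag, List.mem_append_left _ this.req⟩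

theorem moved_iff (V : Env) (t t' : ℕ) (E : Ent) :
    moved V t t' E = true ↔ ∃ z, E.side = some z ∧ V.xs z t E.v ≠ V.xs z t' E.v := by
  unfold moved
  cases E.side <;> simp

theorem not_moved (V : Env) {t t' : ℕ} {E : Ent} {z : Bool} (h : moved V t t' E = false)
    (hz : E.side = some z) : V.xs z t E.v = V.xs z t' E.v := by
  unfold moved at h
  simpa [hz] using h

theorem settle_side {V : Env} {d t : ℕ} {E : Ent} {z : Bool}
    (h : (settle V d t E).side = some z) :
    E.side = some z ∨ (E.side = none ∧
      descOf V t (V.xs z t E.v) (E.r + (V.b + d)) = true) := by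
  unfold settle at h
  cases hs : E.side with
  | some z' => left; simpa [hs] using h
  | none =>
    right
    refine ⟨rfl, ?_⟩
    simp only [hs, newSide] at h
    cases h1 : descOf V t (V.xs true t E.v) (E.r + (V.b + d)) <;>
      cases h2 : descOf V t (V.xs false t E.v) (E.r + (V.b + d)) <;>
      simp [h1, h2] at h <;> subst h <;> assumption

theorem settle_of_some {V : Env} {d t : ℕ} {E : Ent} {z : Bool} (h : E.side = some z) :
    settle V d t E = E := by
  cases E; simp only at h; subst h; rfl

theorem zfree_settle {V : Env} {d t : ℕ} {E : Ent} {z : Bool} {e : ℕ}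
    (h : zfree z e (settle V d t E) = true) : zfree z e E = true := by
  cases hs : E.side with
  | some z' => rwa [settle_of_some hs] at h
  | none =>
    simp [zfree, hs] at h ⊢
    exact h.1

theorem wt_adv (V : Env) (d t' : ℕ) (new : List Ent) (s : St) :
    wt Ent.r (advance V d t' new s).prom + wt Ent.r (advance V d t' new s).pool =
      wt Ent.r s.prom + wt Ent.r s.pool + wt Ent.r new := by
  simp only [advance, wt_append, wt_map, settle]
  have := wt_filter_add Ent.r (fun E => moved V s.t t' E) s.pool
  linarith

theorem inv_adv {V : Env} (hV : EnvOK V) {i d k K t0 : ℕ} {s : St} (h : Inv V i d k K t0 s)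
    {t' : ℕ} (ht : s.t < t') {new : List Ent} {lr : List (ℕ × ℕ)}
    (hnew : ∀ E ∈ new, E.side = none ∧ s.t ≤ E.v ∧ EntOK V t0 t' lr E ∧ i ≤ stale V d t' E.v E.r)
    (hnd : (new.map Ent.v).Nodup)
    (hz : ∀ z e l σ, V.en e = some (l, σ) → wt Ent.r (s.pool.filter (zfree z e)) +
      wt Ent.r (new.filter (zfree z e)) ≤ 3 * (1/2) ^ (K + l))
    (htot : wt Ent.r s.prom + wt Ent.r s.pool + wt Ent.r new ≤ (1/2) ^ k + 8 * (1/2) ^ K)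
    (hreq : wt Prod.snd lr ≤ cc i * wt Ent.r new) :
    Inv V i d k K t0 (addReqs lr (advance V d t' new s)) := by
  have hold : ∀ E ∈ s.prom ++ s.pool, EntOK V t0 t' (s.reqs ++ lr) E := by
    intro E hE
    have := h.ent E hE
    exact ⟨this.lo, this.hi.trans ht, this.tag, List.mem_append_left _ this.req⟩
  constructor
  · exact h.time.trans ht.le
  · intro z e l σ he
    refine le_trans ?_ (hz z e l σ he)
    simp only [addReqs, advance, List.filter_append, wt_append]
    gcongr
    rw [List.filter_map, wt_map, List.filter_filter]
    refine wt_filter_mono Ent.r ?_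
    intro E _ hE
    simp only [Bool.and_eq_true, Function.comp] at hE
    exact zfree_settle hE.1
  · exact (wt_adv V d t' new s).le.trans htot
  · have hw := wt_adv V d t' new s
    have hr := h.reqw
    simp only [addReqs, wt_append]
    rw [hw]
    have e1 : (advance V d t' new s).stuck = s.stuck := rfl
    have e2 : (advance V d t' new s).reqs = s.reqs := rfl
    rw [e1, e2]
    linarith
  · have hn := h.nodup
    have hlt : ∀ E ∈ s.prom ++ s.pool, E.v < s.t := fun E hE => (h.ent E hE).hi
    have hperm : (((s.prom ++ s.pool) ++ new).map Ent.v).Perm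
        (((addReqs lr (advance V d t' new s)).prom ++
          (addReqs lr (advance V d t' new s)).pool).map Ent.v) := by
      simp only [addReqs, advance, List.map_append, List.map_map]
      have e : Ent.v ∘ settle V d t' = Ent.v := rfl
      rw [e]
      have hp := (List.filter_append_perm (fun E => moved V s.t t' E) s.pool).map Ent.v
      rw [List.map_append] at hp
      rw [List.append_assoc, List.append_assoc]
      refine List.Perm.append_left _ ?_
      rw [← List.append_assoc]
      exact (hp.symm).append_right _
    refine hperm.nodup ?_
    rw [List.map_append]
    refine List.Nodup.append hn hnd ?_
    intro a ha hb
    rw [List.mem_map] at ha hb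
    obtain ⟨E, hE, rfl⟩ := ha
    obtain ⟨E', hE', he⟩ := hb
    have := hlt E hE
    have := (hnew E' hE').2.1
    omega
  · intro E hE
    simp only [addReqs, advance, List.mem_append, List.mem_map, List.mem_filter] at hE
    rcases hE with (hE | ⟨hE, _⟩) | ⟨E', ⟨hE, _⟩, rfl⟩ | hE
    · exact hold E (List.mem_append_left _ hE)
    · exact hold E (List.mem_append_right _ hE)
    · have := hold E' (List.mem_append_right _ hE)
      exact ⟨this.lo, this.hi, this.tag, this.req⟩
    · have := (hnew E hE).2.2.1
      exact ⟨this.lo, this.hi, this.tag, List.mem_append_right _ this.req⟩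
  · intro E hE z hz
    simp only [addReqs, advance, List.mem_append, List.mem_map, List.mem_filter] at hE hz ⊢
    rcases hE with ⟨E', ⟨hE, hm⟩, rfl⟩ | hE
    · simp only [Bool.not_eq_true'] at hm
      rcases settle_side hz with hs | ⟨_, hd⟩
      · have := h.side E' hE z hs
        rw [not_moved V hm hs] at this
        exact descOf_mono V ht.le _ _ this
      · exact hd
    · rw [(hnew E hE).1] at hz
      exact absurd hz (by simp)
  · intro E hE
    simp only [addReqs, advance, List.mem_append, List.mem_map, List.mem_filter] at hE ⊢
    rcases hE with ⟨E', ⟨hE, hm⟩, rfl⟩ | hE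
    · exact (h.stpool E' hE).trans (stale_mono hV ht.le)
    · exact (hnew E hE).2.2.2
  · intro E hE
    simp only [addReqs, advance, List.mem_append, List.mem_filter] at hE ⊢
    rcases hE with hE | ⟨hE, hm⟩
    · exact (h.stprom E hE).trans (stale_mono hV ht.le)
    · rw [moved_iff] at hm
      obtain ⟨z, hz, hm⟩ := hm
      have h1 := stale_moved hV ht (h.side E hE z hz) hm
      have h2 := h.stpool E hE
      omega

theorem inv_adv0 {V : Env} (hV : EnvOK V) {i d k K t0 : ℕ} {s : St} (h : Inv V i d k K t0 s) :
    Inv V i d k K t0 (advance V d (s.t + 1) [] s) := by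
  have := inv_adv hV h (Nat.lt_succ_self s.t) (new := []) (lr := []) (by simp) (by simp)
    (by intro z e l σ he; simpa using h.poolz z e l σ he) (by simpa using h.tot) (by simp)
  have e : addReqs [] (advance V d (s.t + 1) [] s) = advance V d (s.t + 1) [] s := by
    simp [addReqs, advance]
  rwa [e] at this

end PartC3

section PartC4

theorem lack_iff (V : Env) (K : ℕ) (pool : List Ent) (z : Bool) (e : ℕ) :
    lack V K pool z e = true ↔ ∃ l σ, V.en e = some (l, σ) ∧
      wt Ent.r (pool.filter (zsel z e)) < (1/2) ^ (K + l) := by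
  unfold lack
  cases he : V.en e with
  | none => simp
  | some p =>
    have : (!heavy ((pool.filter (zsel z e)).map Ent.r) (K + p.1)) = true ↔
        wt Ent.r (pool.filter (zsel z e)) < (1/2) ^ (K + p.1) := by
      rw [Bool.not_eq_true', ← Bool.not_eq_true, heavy_iff, wt_map, not_le]
    simp only [Option.map_some, Option.getD_some]
    rw [this]
    constructor
    · intro h; exact ⟨p.1, p.2, rfl, h⟩
    · rintro ⟨l, σ, h, h2⟩
      cases h; exact h2

theorem lackE_some {V : Env} {K : ℕ} {s : St} {z : Bool} {e : ℕ} (h : lackE V K s z = some e) :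
    e < s.j z ∧ ∃ l σ, V.en e = some (l, σ) ∧
      wt Ent.r (s.pool.filter (zsel z e)) < (1/2) ^ (K + l) := by
  have := List.mem_of_mem_head? (show e ∈ _ from h)
  rw [List.mem_filter, List.mem_range, lack_iff] at this
  exact this

theorem lackE_none {V : Env} {K : ℕ} {s : St} {z : Bool} (h : lackE V K s z = none) :
    ∀ e < s.j z, ∀ l σ, V.en e = some (l, σ) →
      (1/2:ℝ) ^ (K + l) ≤ wt Ent.r (s.pool.filter (zsel z e)) := by
  intro e he l σ hen
  unfold lackE at h
  rw [List.head?_eq_none_iff, List.filter_eq_nil_iff] at h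
  by_contra hc
  push Not at hc
  exact h e (List.mem_range.2 he) ((lack_iff ..).2 ⟨l, σ, hen, hc⟩)

theorem not_waiting {s : St} (h : waiting s = false) {E : Ent} (hE : E ∈ s.pool) :
    ∃ z, E.side = some z := by
  unfold waiting at h
  rw [List.any_eq_false] at h
  have := h E hE
  cases hs : E.side with
  | none => simp [hs] at this
  | some z => exact ⟨z, rfl⟩

theorem post_cases (V : Env) (d k K : ℕ) (s : St) (h1 : s.stuck = false) (h2 : doneH k s = false) :
    (waiting s = true ∧ ∀ res, post V d k K s res = advance V d (s.t + 1) [] s) ∨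
    (waiting s = false ∧ ∃ z, lackE V K s z = none ∧
      ∀ res, post V d k K s res = bump z (advance V d (s.t + 1) [] s)) ∨
    (waiting s = false ∧ (∃ e : Bool → ℕ, ∀ z, lackE V K s z = some (e z)) ∧
      ∀ res, post V d k K s res = callPost V d K s res) := by
  unfold post
  simp only [h1, h2]
  cases hw : waiting s with
  | true => left; simp
  | false =>
    right
    cases ht : lackE V K s true with
    | none => left; exact ⟨rfl, true, ht, by simp⟩
    | some e0 =>
      cases hf : lackE V K s false with
      | none => left; exact ⟨rfl, false, hf, by simp⟩
      | some e1 =>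
        right
        refine ⟨rfl, ⟨fun z => bif z then e0 else e1, fun z => ?_⟩, by simp⟩
        cases z <;> simp [ht, hf]

theorem post_halted (V : Env) (d k K : ℕ) (s : St) (res : Res)
    (h : s.stuck = true ∨ doneH k s = true) : post V d k K s res = s := by
  unfold post
  rcases h with h | h <;> simp [h]

theorem sum_en_le {V : Env} (hV : EnvOK V) (S : Finset ℕ) (f : ℕ → ℝ) (c : ℝ) (hc : 0 ≤ c)
    (h : ∀ e ∈ S, f e ≤ c * pw ((V.en e).map Prod.fst)) : ∑ e ∈ S, f e ≤ c :=
  calc ∑ e ∈ S, f e ≤ ∑ e ∈ S, c * pw ((V.en e).map Prod.fst) := Finset.sum_le_sum h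
    _ = c * ∑ e ∈ S, pw ((V.en e).map Prod.fst) := by rw [Finset.mul_sum]
    _ ≤ c * 1 := by gcongr; exact hV.kraft S
    _ = c := mul_one c

theorem pool_le {V : Env} (hV : EnvOK V) {i d k K t0 : ℕ} {s : St} (h : Inv V i d k K t0 s) :
    wt Ent.r s.pool ≤ 6 * (1/2) ^ K := by
  have key : ∀ z : Bool, wt Ent.r (s.pool.filter fun E => !decide (E.side = some !z)) ≤
      3 * (1/2) ^ K := by
    intro z
    let S : Finset ℕ := (s.pool.map fun E => E.tag z).toFinset
    refine (wt_le_group Ent.r S (fun e => zfree z e) ?_).trans ?_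
    · intro E hE
      rw [List.mem_filter] at hE
      refine ⟨E.tag z, by simp only [S, List.mem_toFinset, List.mem_map]; exact ⟨E, hE.1, rfl⟩, ?_⟩
      simpa [zfree] using hE.2
    · refine sum_en_le hV S _ _ (by positivity) fun e he => ?_
      simp only [S, List.mem_toFinset, List.mem_map] at he
      obtain ⟨E, hE, rfl⟩ := he
      obtain ⟨l, σ, hen, -⟩ := (h.ent E (List.mem_append_right _ hE)).tag z
      have h1 := h.poolz z _ l σ hen
      have h2 : wt Ent.r ((s.pool.filter fun E => !decide (E.side = some !z)).filter
          (zfree z (E.tag z))) ≤ wt Ent.r (s.pool.filter (zfree z (E.tag z))) := by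
        rw [List.filter_filter]
        refine wt_filter_mono _ fun E _ h => ?_
        rw [Bool.and_eq_true] at h
        exact h.1
      rw [hen]
      simp only [Option.map_some, pw, Option.elim]
      calc _ ≤ _ := h2
        _ ≤ _ := h1
        _ = _ := by rw [pow_add]; ring
  have h1 := key true
  have h2 := key false
  have h3 := wt_filter_add Ent.r (fun E => decide (E.side = some false)) s.pool
  have h4 : wt Ent.r (s.pool.filter fun E => decide (E.side = some false)) ≤
      wt Ent.r (s.pool.filter fun E => !decide (E.side = some !false)) := by
    refine wt_filter_mono _ fun E _ h => ?_
    simp at h; simp [h]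
  simp only [Bool.not_true] at h1
  linarith

theorem inv_call {V : Env} (hV : EnvOK V) {i d k K t0 : ℕ} {s : St} (h : Inv V i d k K t0 s)
    (hs : s.stuck = false) (hd : doneH k s = false) (hw : waiting s = false)
    {e : Bool → ℕ} (he : ∀ z, lackE V K s z = some (e z)) {res : Res}
    (hr : SpecAt V i d (argK V K s) (argT V K s) res) :
    Inv V i d k K t0 (callPost V d K s res) := by
  have htag : ∀ z, tagE V K s z = e z := fun z => by simp [tagE, he z]
  have hK : ∀ z, K + enL V (e z) ≤ argK V K s := by
    intro z; unfold argK; rw [htag, htag]; cases z <;> omega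
  have hT : ∀ z, max s.t (enN V (e z)) < argT V K s := by
    intro z; unfold argT; rw [htag, htag]; cases z <;> omega
  have hpw : ∀ z, (1/2:ℝ) ^ argK V K s ≤ (1/2) ^ (K + enL V (e z)) := fun z =>
    pow_le_pow_of_le_one (by norm_num) (by norm_num) (hK z)
  have hpwK : (1/2:ℝ) ^ argK V K s ≤ (1/2) ^ K :=
    pow_le_pow_of_le_one (by norm_num) (by norm_num) (by have := hK true; omega)
  have hp0 : (0:ℝ) < (1/2) ^ argK V K s := by positivity
  have hcc := cc_le i
  have hcc1 := cc_ge i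
  have hbd : cc i * (1/2) ^ argK V K s ≤ 2 * (1/2) ^ argK V K s := by gcongr
  unfold callPost
  obtain ⟨lr, o⟩ := res
  cases o with
  | none =>
    refine inv_stuck h hs ?_
    have := hr.wreq
    simp only at this ⊢
    linarith
  | some q =>
    simp only [htag]
    have ht' := hr.time q rfl
    have hT1 := hT true
    have hT2 := hT false
    have hwnew : wt Ent.r (q.1.map (mkEnt (e true) (e false))) = wt Prod.snd q.1 := by
      rw [wt_map]; rfl
    have hlo := hr.lo q rfl
    have hhi := hr.hi q rfl
    have htot := pool_le hV h
    have hprom := doneH_false k s hd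
    refine inv_adv hV h (by omega) ?_ ?_ ?_ ?_ ?_
    · intro E hE
      rw [List.mem_map] at hE
      obtain ⟨p, hp, rfl⟩ := hE
      obtain ⟨m1, m2, m3, m4⟩ := hr.mem q rfl p hp
      have := h.time
      refine ⟨rfl, ?_, ⟨?_, m2, ?_, m4⟩, m3⟩
      · simp only [mkEnt]; omega
      · simp only [mkEnt]; omega
      · intro z
        have hz : (mkEnt (e true) (e false) p).tag z = e z := by cases z <;> rfl
        rw [hz]
        obtain ⟨_, l, σ, hen, _⟩ := lackE_some (he z)
        refine ⟨l, σ, hen, ?_⟩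
        have := hT z
        simp only [enN, hen, Option.map_some, Option.getD_some] at this
        simp only [mkEnt]; omega
    · rw [List.map_map]
      exact hr.nodup q rfl
    · intro z e' l σ hen
      by_cases hee : e' = e z
      · subst hee
        obtain ⟨_, l', σ', hen', hlt⟩ := lackE_some (he z)
        rw [hen] at hen'
        cases hen'
        have h1 : wt Ent.r (s.pool.filter (zfree z (e z))) ≤
            wt Ent.r (s.pool.filter (zsel z (e z))) := by
          refine wt_filter_mono _ fun E hE h => ?_
          obtain ⟨z', hz'⟩ := not_waiting hw hE
          revert h
          simp only [zfree, zsel, hz']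
          cases z <;> cases z' <;> simp
        have h2 := wt_filter_le Ent.r (zfree z (e z)) (q.1.map (mkEnt (e true) (e false)))
        have h3 := hpw z
        simp only [enL, hen, Option.map_some, Option.getD_some] at h3
        linarith
      · have : (q.1.map (mkEnt (e true) (e false))).filter (zfree z e') = [] := by
          rw [List.filter_eq_nil_iff]
          intro E hE
          rw [List.mem_map] at hE
          obtain ⟨p, hp, rfl⟩ := hE
          have hz : (mkEnt (e true) (e false) p).tag z = e z := by cases z <;> rfl
          simp only [zfree, hz]
          simp [Ne.symm hee]
        rw [this, wt_nil, add_zero]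
        exact h.poolz z e' l σ hen
    · rw [hwnew]; linarith
    · rw [hwnew]
      refine hr.wreq.trans ?_
      gcongr

theorem inv_post {V : Env} (hV : EnvOK V) {i d k K t0 : ℕ} {s : St} (h : Inv V i d k K t0 s)
    {res : Res} (hr : SpecAt V i d (argK V K s) (argT V K s) res) :
    Inv V i d k K t0 (post V d k K s res) := by
  cases h1 : s.stuck with
  | true => rwa [post_halted _ _ _ _ _ _ (Or.inl h1)]
  | false =>
  cases h2 : doneH k s with
  | true => rwa [post_halted _ _ _ _ _ _ (Or.inr h2)]
  | false =>
  rcases post_cases V d k K s h1 h2 with ⟨_, h3⟩ | ⟨_, z, _, h3⟩ | ⟨hw, ⟨e, he⟩, h3⟩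
  · rw [h3]; exact inv_adv0 hV h
  · rw [h3]; exact inv_bump z (inv_adv0 hV h)
  · rw [h3]; exact inv_call hV h h1 h2 hw he hr

theorem runSt_succ (V : Env) (g : Args → Res) (d k K t0 T m : ℕ) :
    runSt V g d k K t0 T (m + 1) = post V d k K (runSt V g d k K t0 T m)
      (g (argsOf V d K T (runSt V g d k K t0 T m))) := rfl

theorem inv_run {V : Env} (hV : EnvOK V) {i d : ℕ} {g : Args → Res} (hg : Spec V i d g)
    (k K t0 T m : ℕ) : Inv V i d k K t0 (runSt V g d k K t0 T m) := by
  induction m with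
  | zero => exact inv_init ..
  | succ m ih => rw [runSt_succ]; exact inv_post hV ih (hg _ _ _)

theorem out_some {k : ℕ} {s : St} {q} (h : (outSt k s).2 = some q) :
    s.stuck = false ∧ doneH k s = true ∧ q = (s.prom.map (fun E => (E.v, E.r)), s.t) := by
  unfold outSt at h
  cases h1 : s.stuck <;> cases h2 : doneH k s <;> simp [h1, h2] at h
  exact ⟨rfl, rfl, h.symm⟩

theorem spec_P {V : Env} (hV : EnvOK V) (d i : ℕ) : Spec V i d (P V i) := by
  induction i with
  | zero =>
    intro k t0 T
    have e : P V 0 (d, k, t0, T) = ([(t0, k)], some ([(t0, k)], t0 + 1)) := rfl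
    rw [e]
    constructor <;> simp [cc] <;> norm_num
  | succ i ih =>
    intro k t0 T
    have e : P V (i + 1) (d, k, t0, T) =
      outSt k (runSt V (P V i) d k (k + (i + 6)) t0 T T) := rfl
    rw [e]
    have h := inv_run hV ih k (k + (i + 6)) t0 T T
    generalize hsd : runSt V (P V i) d k (k + (i + 6)) t0 T T = s at h
    have hK : (1/2:ℝ) ^ (k + (i + 6)) = (1/2) ^ i * (1/2) ^ k / 64 := by
      rw [pow_add, pow_add]; norm_num; ring
    have hcc1 : cc (i + 1) = 2 - (1/2) ^ i / 2 := by unfold cc; rw [pow_succ]; ring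
    have htot := h.tot
    rw [hK] at htot
    have hp : (0:ℝ) < (1/2) ^ k := by positivity
    have hi : (0:ℝ) < (1/2) ^ i := by positivity
    have hi1 : (1/2:ℝ) ^ i ≤ 1 := pow_le_one₀ (by norm_num) (by norm_num)
    have hip : (0:ℝ) < (1/2) ^ i * (1/2) ^ k := by positivity
    have hip1 : (1/2:ℝ) ^ i * (1/2) ^ k ≤ (1/2) ^ k := by nlinarith
    have hwq : wt Prod.snd (s.prom.map fun E => (E.v, E.r)) = wt Ent.r s.prom := by
      rw [wt_map]
    constructor
    · have hr := h.reqw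
      rw [hK] at hr
      have hst : (bif s.stuck then 2 * ((1/2:ℝ) ^ i * (1/2) ^ k / 64) else 0) ≤
          2 * ((1/2:ℝ) ^ i * (1/2) ^ k / 64) := by
        cases s.stuck
        · simp only [cond_false]; positivity
        · simp
      have h2 : cc i * (wt Ent.r s.prom + wt Ent.r s.pool) ≤
          cc i * ((1/2) ^ k + 8 * ((1/2) ^ i * (1/2) ^ k / 64)) :=
        mul_le_mul_of_nonneg_left htot (by have := cc_ge i; linarith)
      have e1 : (outSt k s).1 = s.reqs := rfl
      rw [e1, hcc1]
      have h3 : cc i * ((1/2) ^ k + 8 * ((1/2) ^ i * (1/2) ^ k / 64)) ≤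
          cc i * (1/2) ^ k + 2 * (8 * ((1/2) ^ i * (1/2) ^ k / 64)) := by
        rw [mul_add]
        have := cc_le i
        gcongr
      have h4 : cc i * (1/2:ℝ) ^ k = 2 * (1/2) ^ k - (1/2) ^ i * (1/2) ^ k := by
        unfold cc; ring
      nlinarith
    · intro q hq
      obtain ⟨_, h2, rfl⟩ := out_some hq
      rw [hwq]
      exact (doneH_iff k s).1 h2
    · intro q hq
      obtain ⟨_, h2, rfl⟩ := out_some hq
      rw [hwq, hcc1]
      have := wt_nonneg Ent.r s.pool
      nlinarith
    · intro q hq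
      obtain ⟨_, h2, rfl⟩ := out_some hq
      rw [doneH_iff] at h2
      have : s.prom ≠ [] := by
        intro hn; rw [hn, wt_nil] at h2; linarith
      obtain ⟨E, hE⟩ := List.exists_mem_of_ne_nil _ this
      have := h.ent E (List.mem_append_left _ hE)
      exact lt_of_le_of_lt this.lo this.hi
    · intro q hq
      obtain ⟨_, h2, rfl⟩ := out_some hq
      have hn := h.nodup
      rw [List.map_append] at hn
      simpa [Function.comp_def] using hn.of_append_left
    · intro q hq p hp
      obtain ⟨_, h2, rfl⟩ := out_some hq
      simp only [List.mem_map] at hp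
      obtain ⟨E, hE, rfl⟩ := hp
      have h3 := h.ent E (List.mem_append_left _ hE)
      exact ⟨h3.lo, h3.hi, h.stprom E hE, h3.req⟩

end PartC4

section PartC5

/-! monotonicity in the time bound -/

def ResLe (r r' : Res) : Prop := (∀ p ∈ r.1, p ∈ r'.1) ∧ ∀ q, r.2 = some q → r' = r

def StLe (s s' : St) : Prop := s' = s ∨ (s.stuck = true ∧ ∀ p ∈ s.reqs, p ∈ s'.reqs)

theorem reqs_post (V : Env) (d k K : ℕ) (s : St) (res : Res) :
    ∀ p ∈ s.reqs, p ∈ (post V d k K s res).reqs := by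
  intro p hp
  cases h1 : s.stuck with
  | true => rwa [post_halted _ _ _ _ _ _ (Or.inl h1)]
  | false =>
  cases h2 : doneH k s with
  | true => rwa [post_halted _ _ _ _ _ _ (Or.inr h2)]
  | false =>
  rcases post_cases V d k K s h1 h2 with ⟨_, h3⟩ | ⟨_, z, _, h3⟩ | ⟨hw, ⟨e, he⟩, h3⟩
  · rw [h3]; exact hp
  · rw [h3]; exact hp
  · rw [h3]
    unfold callPost
    obtain ⟨lr, o⟩ := res
    cases o <;> exact List.mem_append_left _ hp

theorem reqs_run (V : Env) (g : Args → Res) (d k K t0 T : ℕ) {m m' : ℕ} (h : m ≤ m') :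
    ∀ p ∈ (runSt V g d k K t0 T m).reqs, p ∈ (runSt V g d k K t0 T m').reqs := by
  induction h with
  | refl => exact fun p hp => hp
  | step h ih => intro p hp; rw [Nat.succ_eq_add_one, runSt_succ]; exact reqs_post _ _ _ _ _ _ _ (ih p hp)

theorem runSt_halted (V : Env) (g : Args → Res) (d k K t0 T : ℕ) {m m' : ℕ} (h : m ≤ m')
    (hs : (runSt V g d k K t0 T m).stuck = true ∨ doneH k (runSt V g d k K t0 T m) = true) :
    runSt V g d k K t0 T m' = runSt V g d k K t0 T m := by
  induction h with
  | refl => rfl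
  | step h ih => rw [Nat.succ_eq_add_one, runSt_succ, ih]; exact post_halted _ _ _ _ _ _ hs

theorem stLe_post {V : Env} {d k K : ℕ} {s s' : St} (h : StLe s s') {res res' : Res}
    (hr : s' = s → ResLe res res') : StLe (post V d k K s res) (post V d k K s' res') := by
  rcases h with rfl | ⟨h1, h2⟩
  · have hr := hr rfl
    cases h1 : s'.stuck with
    | true => left; rw [post_halted _ _ _ _ _ _ (Or.inl h1), post_halted _ _ _ _ _ _ (Or.inl h1)]
    | false =>
    cases h2 : doneH k s' with
    | true => left; rw [post_halted _ _ _ _ _ _ (Or.inr h2), post_halted _ _ _ _ _ _ (Or.inr h2)]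
    | false =>
    rcases post_cases V d k K s' h1 h2 with ⟨_, h3⟩ | ⟨_, z, _, h3⟩ | ⟨hw, ⟨e, he⟩, h3⟩
    · left; rw [h3, h3]
    · left; rw [h3, h3]
    · rw [h3, h3]
      obtain ⟨lr, o⟩ := res
      obtain ⟨lr', o'⟩ := res'
      cases o with
      | some q => left; rw [hr.2 q rfl]
      | none =>
        right
        refine ⟨rfl, fun p hp => ?_⟩
        have : p ∈ s'.reqs ++ lr' := by
          rcases List.mem_append.1 (show p ∈ s'.reqs ++ lr from hp) with hp | hp
          · exact List.mem_append_left _ hp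
          · exact List.mem_append_right _ (hr.1 p hp)
        cases o' <;> exact this
  · right
    rw [post_halted _ _ _ _ _ _ (Or.inl h1)]
    exact ⟨h1, fun p hp => reqs_post _ _ _ _ _ _ _ (h2 p hp)⟩

def Mono (d : ℕ) (g : Args → Res) : Prop :=
  ∀ k t0 T T', T ≤ T' → ResLe (g (d, k, t0, T)) (g (d, k, t0, T'))

theorem stLe_run {V : Env} {d : ℕ} {g : Args → Res} (hg : Mono d g) (k K t0 : ℕ) {T T' : ℕ}
    (h : T ≤ T') (m : ℕ) : StLe (runSt V g d k K t0 T m) (runSt V g d k K t0 T' m) := by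
  induction m with
  | zero => left; rfl
  | succ m ih =>
    rw [runSt_succ, runSt_succ]
    refine stLe_post ih fun e => ?_
    rw [e]
    exact hg _ _ _ _ h

theorem mono_P (V : Env) (d i : ℕ) : Mono d (P V i) := by
  induction i with
  | zero => intro k t0 T T' _; exact ⟨fun p hp => hp, fun q _ => rfl⟩
  | succ i ih =>
    intro k t0 T T' h
    have e : ∀ T, P V (i + 1) (d, k, t0, T) =
      outSt k (runSt V (P V i) d k (k + (i + 6)) t0 T T) := fun _ => rfl
    rw [e, e]
    have h1 := stLe_run (V := V) ih k (k + (i + 6)) t0 h T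
    constructor
    · intro p hp
      refine reqs_run _ _ _ _ _ _ _ h p ?_
      rcases h1 with h1 | ⟨_, h1⟩
      · rw [h1]; exact hp
      · exact h1 p hp
    · intro q hq
      obtain ⟨h2, h3, _⟩ := out_some hq
      rcases h1 with h1 | ⟨h1, _⟩
      · rw [runSt_halted _ _ _ _ _ _ _ h (by rw [h1]; exact Or.inr h3), h1]
      · rw [h2] at h1; exact absurd h1 (by simp)

/-! the limit run -/

def Settled (V : Env) (d v r : ℕ) : Prop :=
  ∃ B, ∀ t ≥ B, ∃ z, descOf V t (V.xs z t v) (r + (V.b + d)) = true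

def GoodAt (V : Env) (k K : ℕ) (z : Bool) (s : St) : Prop :=
  s.stuck = false ∧ doneH k s = false ∧ waiting s = false ∧ lackE V K s z = none

inductive StepOK (V : Env) (i d k K : ℕ) (s s' : St) : Prop
  | wait : waiting s = true → s' = advance V d (s.t + 1) [] s → StepOK V i d k K s s'
  | good (z : Bool) : GoodAt V k K z s → s' = bump z (advance V d (s.t + 1) [] s) →
      StepOK V i d k K s s'
  | call (e : Bool → ℕ) (res : Res) (q : List (ℕ × ℕ) × ℕ) : waiting s = false →
      (∀ z, lackE V K s z = some (e z)) →
      res.2 = some q → SpecAt V i d (argK V K s) (argT V K s) res →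
      s' = addReqs res.1 (advance V d q.2
        (q.1.map (mkEnt (tagE V K s true) (tagE V K s false))) s) → StepOK V i d k K s s'

structure LimRun (V : Env) (i d k K t0 : ℕ) (g : Args → Res) (S : ℕ → St) : Prop where
  lim : ∀ m, ∃ T0, ∀ T ≥ T0, runSt V g d k K t0 T m = S m
  inv : ∀ m, Inv V i d k K t0 (S m)
  step : ∀ m, StepOK V i d k K (S m) (S (m + 1))
  settled : ∀ m, ∀ p ∈ (S m).reqs, Settled V d p.1 p.2

theorem exists_limRun {V : Env} (hV : EnvOK V) {i d k K t0 : ℕ} {g : Args → Res}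
    (hg : Spec V i d g) (hm : Mono d g)
    (hret : ∀ k t0, (∀ T, ∀ p ∈ (g (d, k, t0, T)).1, Settled V d p.1 p.2) →
      ∃ T q, (g (d, k, t0, T)).2 = some q)
    (hset : ∀ T, ∀ p ∈ (runSt V g d k K t0 T T).reqs, Settled V d p.1 p.2)
    (hno : ∀ T, (outSt k (runSt V g d k K t0 T T)).2 = none) :
    ∃ S, LimRun V i d k K t0 g S := by
  have key : ∀ m, ∀ S, (∃ T0 ≥ m, ∀ T ≥ T0, runSt V g d k K t0 T m = S) → S.stuck = false →
      ∃ S', (∃ T0 ≥ m + 1, ∀ T ≥ T0, runSt V g d k K t0 T (m + 1) = S') ∧ S'.stuck = false ∧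
        StepOK V i d k K S S' := by
    rintro m S ⟨T0, hT0, hT⟩ hst
    have hnd : doneH k S = false := by
      by_contra hc
      rw [Bool.not_eq_false] at hc
      have h1 := hT T0 le_rfl
      have h2 := runSt_halted V g d k K t0 T0 hT0 (by rw [h1]; exact Or.inr hc)
      have h3 := hno T0
      rw [h2, h1] at h3
      simp [outSt, hst, hc] at h3
    have hrun : ∀ T ≥ T0, runSt V g d k K t0 T (m + 1) =
        post V d k K S (g (argsOf V d K T S)) := by
      intro T h; rw [runSt_succ, hT T h]
    rcases post_cases V d k K S hst hnd with ⟨hw, h3⟩ | ⟨hw, z, hz, h3⟩ | ⟨hw, ⟨e, he⟩, h3⟩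
    · refine ⟨_, ⟨max T0 (m + 1), le_max_right _ _, fun T h => ?_⟩, ?_, StepOK.wait hw rfl⟩
      · rw [hrun T (le_trans (le_max_left _ _) h), h3]
      · exact hst
    · refine ⟨_, ⟨max T0 (m + 1), le_max_right _ _, fun T h => ?_⟩, ?_,
        StepOK.good z ⟨hst, hnd, hw, hz⟩ rfl⟩
      · rw [hrun T (le_trans (le_max_left _ _) h), h3]
      · exact hst
    · obtain ⟨T1, q, hq⟩ := hret (argK V K S) (argT V K S) (by
        intro T p hp
        have hT' : T ≤ max T (max T0 (m + 1)) := le_max_left _ _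
        have hT2 : T0 ≤ max T (max T0 (m + 1)) := by omega
        have hT3 : m + 1 ≤ max T (max T0 (m + 1)) := by omega
        generalize max T (max T0 (m + 1)) = T' at *
        refine hset T' p (reqs_run V g d k K t0 T' hT3 p ?_)
        rw [hrun T' hT2, h3]
        have := (hm _ _ _ _ hT').1 p hp
        have h4 : p ∈ S.reqs ++ (g (argsOf V d K T' S)).1 := List.mem_append_right _ this
        unfold callPost
        cases (g (argsOf V d K T' S)).2 <;> exact h4)
      have hgT : ∀ T ≥ T1, g (argsOf V d K T S) = g (argsOf V d K T1 S) := fun T h =>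
        (hm _ _ _ _ h).2 q hq
      have hq' : (g (argsOf V d K T1 S)).2 = some q := hq
      refine ⟨addReqs (g (argsOf V d K T1 S)).1 (advance V d q.2
        (q.1.map (mkEnt (tagE V K S true) (tagE V K S false))) S),
        ⟨max (max T0 T1) (m + 1), le_max_right _ _, fun T h => ?_⟩, hst,
        StepOK.call e _ q hw he hq' (hg _ _ _) rfl⟩
      rw [hrun T (by omega), h3, hgT T (by omega)]
      unfold callPost
      rw [hq']
  let Good : ℕ → St → Prop := fun m S =>
    (∃ T0 ≥ m, ∀ T ≥ T0, runSt V g d k K t0 T m = S) ∧ S.stuck = false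
  have hall : ∀ m, ∃ S, Good m S := by
    intro m
    induction m with
    | zero => exact ⟨initSt t0, ⟨0, le_rfl, fun T _ => rfl⟩, rfl⟩
    | succ m ih =>
      obtain ⟨S, h1, h2⟩ := ih
      obtain ⟨S', h3, h4, _⟩ := key m S h1 h2
      exact ⟨S', h3, h4⟩
  choose S hS using hall
  refine ⟨S, ?_, ?_, ?_, ?_⟩
  · intro m
    obtain ⟨⟨T0, _, h⟩, _⟩ := hS m
    exact ⟨T0, h⟩
  · intro m
    obtain ⟨⟨T0, _, h⟩, _⟩ := hS m
    rw [← h T0 le_rfl]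
    exact inv_run hV hg ..
  · intro m
    obtain ⟨S', ⟨T0, _, h3⟩, h4, h5⟩ := key m (S m) (hS m).1 (hS m).2
    obtain ⟨⟨T1, _, h⟩, _⟩ := hS (m + 1)
    rw [← h (max T0 T1) (le_max_right _ _), h3 _ (le_max_left _ _)]
    exact h5
  · intro m p hp
    obtain ⟨⟨T0, hT, h⟩, _⟩ := hS m
    rw [← h T0 le_rfl] at hp
    exact hset T0 p (reqs_run V g d k K t0 T0 hT p hp)

end PartC5

section PartC6

section lim
variable {V : Env} {i d k K t0 : ℕ} {g : Args → Res} {S : ℕ → St}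

/-- every step is an advance as far as time and the lists are concerned -/
theorem step_adv {s s' : St} (h : StepOK V i d k K s s') :
    ∃ t' new, s.t < t' ∧ s'.t = t' ∧ s'.pool = (advance V d t' new s).pool ∧
      s'.prom = (advance V d t' new s).prom ∧ (waiting s = true → new = []) := by
  rcases h with ⟨hw, rfl⟩ | ⟨z, hg, rfl⟩ | ⟨e, res, q, hw, he, hq, hsp, rfl⟩
  · exact ⟨s.t + 1, [], by omega, rfl, rfl, rfl, fun _ => rfl⟩
  · exact ⟨s.t + 1, [], by omega, rfl, rfl, rfl, fun _ => rfl⟩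
  · refine ⟨q.2, _, ?_, rfl, rfl, rfl, fun h => ?_⟩
    · have := hsp.time q hq
      unfold argT at this
      omega
    · rw [hw] at h; exact absurd h (by simp)

theorem lim_time (h : LimRun V i d k K t0 g S) (m : ℕ) : (S m).t < (S (m + 1)).t := by
  obtain ⟨t', new, h1, h2, _⟩ := step_adv (h.step m)
  omega

theorem lim_time_ge (h : LimRun V i d k K t0 g S) (m : ℕ) : m ≤ (S m).t := by
  induction m with
  | zero => omega
  | succ m ih => have := lim_time h m; omega

theorem lim_time_mono (h : LimRun V i d k K t0 g S) {m m' : ℕ} (hm : m ≤ m') :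
    (S m).t ≤ (S m').t :=
  monotone_nat_of_le_succ (fun m => (lim_time h m).le) hm

theorem lim_not_waiting (h : LimRun V i d k K t0 g S) (m : ℕ) :
    ∃ m' ≥ m, waiting (S m') = false := by
  by_contra hc
  push Not at hc
  have hB : ∃ B, ∀ E ∈ (S m).pool, ∀ t ≥ B, ∃ z,
      descOf V t (V.xs z t E.v) (E.r + (V.b + d)) = true := by
    have hs : ∀ E ∈ (S m).pool, Settled V d E.v E.r := fun E hE =>
      h.settled m _ ((h.inv m).ent E (List.mem_append_right _ hE)).req
    generalize (S m).pool = l at hs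
    induction l with
    | nil => exact ⟨0, by simp⟩
    | cons a l ih =>
      obtain ⟨B, hB⟩ := ih fun E hE => hs E (List.mem_cons_of_mem _ hE)
      obtain ⟨B', hB'⟩ := hs a List.mem_cons_self
      refine ⟨max B B', fun E hE t ht => ?_⟩
      rcases List.mem_cons.1 hE with rfl | hE
      · exact hB' t (le_trans (le_max_right _ _) ht)
      · exact hB E hE t (le_trans (le_max_left _ _) ht)
  obtain ⟨B, hB⟩ := hB
  have hall : ∀ m' ≥ m, ∀ E ∈ (S m').pool, ∀ t ≥ B, ∃ z,
      descOf V t (V.xs z t E.v) (E.r + (V.b + d)) = true := by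
    intro m' hm'
    induction m', hm' using Nat.le_induction with
    | base => exact hB
    | succ m' hm' ih =>
      intro E hE
      obtain ⟨t', new, h1, h2, h3, h4, h5⟩ := step_adv (h.step m')
      have h6 := h5 (by have := hc m' hm'; simpa using this)
      rw [h3, h6] at hE
      simp only [advance, List.append_nil, List.mem_map, List.mem_filter] at hE
      obtain ⟨E', ⟨hE', _⟩, rfl⟩ := hE
      exact ih E' hE'
  let m' := max m B
  have hw1 : waiting (S (m' + 1)) = true := by
    have := hc (m' + 1) (by omega); simpa using this
  obtain ⟨t', new, h1, h2, h3, h4, h5⟩ := step_adv (h.step m')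
  have h6 := h5 (by have := hc m' (le_max_left _ _); simpa using this)
  unfold waiting at hw1
  rw [List.any_eq_true] at hw1
  obtain ⟨E, hE, hs⟩ := hw1
  rw [h3, h6] at hE
  simp only [advance, List.append_nil, List.mem_map, List.mem_filter] at hE
  obtain ⟨E', ⟨hE', _⟩, rfl⟩ := hE
  have ht : t' ≥ B := by
    have := lim_time_ge h m'
    omega
  obtain ⟨z, hz⟩ := hall m' (le_max_left _ _) E' hE' t' ht
  simp only [decide_eq_true_eq, settle] at hs
  cases hsd : E'.side with
  | some z => simp [hsd] at hs
  | none =>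
    simp only [hsd, newSide] at hs
    cases z
    · rw [hz] at hs
      cases h7 : descOf V t' (V.xs true t' E'.v) (E'.r + (V.b + d)) <;> simp [h7] at hs
    · rw [hz] at hs
      simp at hs

theorem j_bump (z z' : Bool) (s : St) : (bump z s).j z' = if z' = z then s.j z' + 1 else s.j z' := by
  cases z <;> cases z' <;> simp [bump, St.j]

theorem step_j {s s' : St} (h : StepOK V i d k K s s') (z : Bool) :
    s'.j z = s.j z ∨ (s'.j z = s.j z + 1 ∧ GoodAt V k K z s) := by
  rcases h with ⟨hw, rfl⟩ | ⟨z', hg, rfl⟩ | ⟨e, res, q, hw, he, hq, hsp, rfl⟩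
  · left; rfl
  · by_cases hz : z = z'
    · subst hz
      right
      refine ⟨?_, hg⟩
      rw [j_bump, if_pos rfl]; rfl
    · left
      rw [j_bump, if_neg hz]; rfl
  · left; rfl

theorem lim_j_mono (h : LimRun V i d k K t0 g S) (z : Bool) {m m' : ℕ} (hm : m ≤ m') :
    (S m).j z ≤ (S m').j z :=
  monotone_nat_of_le_succ (f := fun m => (S m).j z)
    (fun m => by rcases step_j (h.step m) z with h | h <;> omega) hm

theorem lim_unbounded (h : LimRun V i d k K t0 g S) :
    ∃ z, ∀ J, ∃ m, J < (S m).j z := by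
  by_contra hc
  push Not at hc
  obtain ⟨J1, hJ1⟩ := hc true
  obtain ⟨J0, hJ0⟩ := hc false
  let M := ∑ e ∈ Finset.range (J0 + J1), enL V e
  have hM : ∀ e < J0 + J1, enL V e ≤ M := fun e he =>
    Finset.single_le_sum (f := enL V) (fun _ _ => Nat.zero_le _) (Finset.mem_range.2 he)
  let ε : ℝ := (1/2) ^ (K + M)
  have hε : 0 < ε := by positivity
  let Φ : ℕ → ℝ := fun m => wt Ent.r (S m).prom + wt Ent.r (S m).pool +
    ε * ((S m).j true + (S m).j false)
  have hstep : ∀ m, Φ m ≤ Φ (m + 1) ∧ (waiting (S m) = false → Φ m + ε ≤ Φ (m + 1)) := by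
    intro m
    have hst := h.step m
    have hj1 := hJ1 m
    have hj0 := hJ0 m
    simp only [Φ]
    generalize S m = s at *
    generalize S (m + 1) = s' at *
    rcases hst with ⟨hw, rfl⟩ | ⟨z', hg, rfl⟩ | ⟨e, res, q, hw, he, hq, hsp, rfl⟩
    · have := wt_adv V d (s.t + 1) [] s
      rw [this]
      constructor
      · simp [St.j, advance]
      · intro h; rw [hw] at h; exact absurd h (by simp)
    · have e1 : ∀ s, wt Ent.r (bump z' s).prom = wt Ent.r s.prom := fun _ => rfl
      have e2 : ∀ s, wt Ent.r (bump z' s).pool = wt Ent.r s.pool := fun _ => rfl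
      have e3 : ((bump z' (advance V d (s.t + 1) [] s)).j true : ℝ) +
          (bump z' (advance V d (s.t + 1) [] s)).j false = s.j true + s.j false + 1 := by
        rw [j_bump, j_bump]
        cases z' <;> simp [St.j, advance] <;> ring
      have := wt_adv V d (s.t + 1) [] s
      rw [e1, e2, e3, this, wt_nil]
      constructor
      · nlinarith
      · intro _; nlinarith
    · have e1 : ∀ l s, wt Ent.r (addReqs l s).prom = wt Ent.r s.prom := fun _ _ => rfl
      have e2 : ∀ l s, wt Ent.r (addReqs l s).pool = wt Ent.r s.pool := fun _ _ => rfl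
      have e3 : ∀ z, (addReqs res.1 (advance V d q.2
        (q.1.map (mkEnt (tagE V K s true) (tagE V K s false))) s)).j z = s.j z := fun _ => rfl
      have := wt_adv V d q.2 (q.1.map (mkEnt (tagE V K s true) (tagE V K s false))) s
      rw [e1, e2, e3, e3, this]
      have hlo := hsp.lo q hq
      have hwq : wt Ent.r (q.1.map (mkEnt (tagE V K s true) (tagE V K s false))) =
          wt Prod.snd q.1 := by rw [wt_map]; rfl
      have hε2 : ε ≤ (1/2) ^ argK V K s := by
        refine pow_le_pow_of_le_one (by norm_num) (by norm_num) ?_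
        unfold argK
        have l1 := (lackE_some (he true)).1
        have l0 := (lackE_some (he false)).1
        have t1 : tagE V K s true = e true := by simp [tagE, he true]
        have t2 : tagE V K s false = e false := by simp [tagE, he false]
        rw [t1, t2]
        have := hM (e true) (by omega)
        have := hM (e false) (by omega)
        omega
      rw [hwq]
      constructor
      · linarith
      · intro _; linarith
  have hmono : Monotone Φ := monotone_nat_of_le_succ fun m => (hstep m).1
  have hgrow : ∀ N : ℕ, ∃ m, N * ε ≤ Φ m := by
    intro N
    induction N with
    | zero =>
      refine ⟨0, ?_⟩
      have := wt_nonneg Ent.r (S 0).prom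
      have := wt_nonneg Ent.r (S 0).pool
      simp only [Φ]
      push_cast
      rw [zero_mul]
      positivity
    | succ N ih =>
      obtain ⟨m, hm⟩ := ih
      obtain ⟨m', hm', hw⟩ := lim_not_waiting h m
      refine ⟨m' + 1, ?_⟩
      have h1 := (hstep m').2 hw
      have h2 := hmono hm'
      push_cast
      linarith
  obtain ⟨N, hN⟩ := exists_nat_gt (((1/2) ^ k + 8 * (1/2) ^ K + ε * (J1 + J0)) / ε)
  rw [div_lt_iff₀ hε] at hN
  obtain ⟨m, hm⟩ := hgrow N
  have h1 := (h.inv m).tot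
  have h2 : ((S m).j true : ℝ) + (S m).j false ≤ J1 + J0 := by
    exact_mod_cast Nat.add_le_add (hJ1 m) (hJ0 m)
  have h3 : ε * (((S m).j true : ℝ) + (S m).j false) ≤ ε * (J1 + J0) := by gcongr
  simp only [Φ] at hm
  linarith

theorem exists_good (h : LimRun V i d k K t0 g S) {z : Bool} (hz : ∀ J, ∃ m, J < (S m).j z)
    (e T : ℕ) : ∃ m ≥ T, e < (S m).j z ∧ GoodAt V k K z (S m) := by
  let J := max (e + 1) ((S T).j z)
  have hex := hz J
  classical
  let m' := Nat.find hex
  have hm' : J < (S m').j z := Nat.find_spec hex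
  have hTm : T < m' := by
    by_contra hc
    have := lim_j_mono h z (not_lt.1 hc)
    omega
  obtain ⟨m, hm⟩ : ∃ m, m' = m + 1 := ⟨m' - 1, by omega⟩
  have hmin : ¬ J < (S m).j z := Nat.find_min hex (show m < m' by omega)
  rw [hm] at hm'
  rcases step_j (h.step m) z with h1 | ⟨h1, h2⟩
  · omega
  · exact ⟨m, by omega, by omega, h2⟩

open scoped Classical in
noncomputable def Qset (V : Env) (k K : ℕ) (S : ℕ → St) (z : Bool) (e n m : ℕ) : Finset Str :=
  ((Finset.range m).filter fun m' => GoodAt V k K z (S m') ∧ e < (S m').j z).image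
    fun m' => V.xs z (S m').t n

theorem Qset_succ (z : Bool) (e n m : ℕ) :
    Qset V k K S z e n (m + 1) = Qset V k K S z e n m ∨
    (Qset V k K S z e n (m + 1) = insert (V.xs z (S m).t n) (Qset V k K S z e n m) ∧
      GoodAt V k K z (S m) ∧ e < (S m).j z) := by
  classical
  by_cases hg : GoodAt V k K z (S m) ∧ e < (S m).j z
  · right
    refine ⟨?_, hg⟩
    ext σ
    simp only [Qset, Finset.mem_image, Finset.mem_filter, Finset.mem_range, Finset.mem_insert]
    constructor
    · rintro ⟨m', ⟨h1, h2⟩, rfl⟩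
      rcases Nat.lt_succ_iff_lt_or_eq.1 h1 with h1 | rfl
      · right; exact ⟨m', ⟨h1, h2⟩, rfl⟩
      · left; rfl
    · rintro (rfl | ⟨m', ⟨h1, h2⟩, rfl⟩)
      · exact ⟨m, ⟨by omega, hg⟩, rfl⟩
      · exact ⟨m', ⟨by omega, h2⟩, rfl⟩
  · left
    ext σ
    simp only [Qset, Finset.mem_image, Finset.mem_filter, Finset.mem_range]
    constructor
    · rintro ⟨m', ⟨h1, h2⟩, rfl⟩
      rcases Nat.lt_succ_iff_lt_or_eq.1 h1 with h1 | rfl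
      · exact ⟨m', ⟨h1, h2⟩, rfl⟩
      · exact absurd h2 hg
    · rintro ⟨m', ⟨h1, h2⟩, rfl⟩
      exact ⟨m', ⟨by omega, h2⟩, rfl⟩

theorem Q_bound (hV : EnvOK V) (h : LimRun V i d k K t0 g S) (z : Bool) {e l : ℕ} {σ : Str}
    (hen : V.en e = some (l, σ)) (m : ℕ) :
    (1/2:ℝ) ^ (K + l) * (Qset V k K S z e σ.length m).card ≤
      wt Ent.r ((S m).prom.filter (zsel z e)) + wt Ent.r ((S m).pool.filter (zsel z e)) ∧
    (1/2:ℝ) ^ (K + l) * ((Qset V k K S z e σ.length m).erase (V.xs z (S m).t σ.length)).card ≤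
      wt Ent.r ((S m).prom.filter (zsel z e)) := by
  induction m with
  | zero =>
    have : Qset V k K S z e σ.length 0 = ∅ := by simp [Qset]
    rw [this]
    simp only [Finset.card_empty, Nat.cast_zero, mul_zero, Finset.erase_empty]
    exact ⟨add_nonneg (wt_nonneg _ _) (wt_nonneg _ _), wt_nonneg _ _⟩
  | succ m ih =>
    obtain ⟨ih1, ih2⟩ := ih
    have hq := Qset_succ (V := V) (k := k) (K := K) (S := S) z e σ.length m
    obtain ⟨t', new, h1, h2, h3, h4, h5⟩ := step_adv (h.step m)
    have hent := (h.inv m).ent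
    rw [h3, h4, h2]
    generalize Qset V k K S z e σ.length (m + 1) = Q' at *
    generalize Qset V k K S z e σ.length m = Q at *
    generalize S m = s at *
    have hp : (0:ℝ) < (1/2) ^ (K + l) := by positivity
    have c1 : (1/2:ℝ) ^ (K + l) * Q'.card ≤
        wt Ent.r (s.prom.filter (zsel z e)) + wt Ent.r (s.pool.filter (zsel z e)) ∧
        (1/2:ℝ) ^ (K + l) * (Q'.erase (V.xs z s.t σ.length)).card ≤
          wt Ent.r (s.prom.filter (zsel z e)) := by
      rcases hq with rfl | ⟨rfl, hg, hj⟩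
      · exact ⟨ih1, ih2⟩
      · have hl := lackE_none hg.2.2.2 e hj l σ hen
        constructor
        · have : (insert (V.xs z s.t σ.length) Q).card ≤
              (Q.erase (V.xs z s.t σ.length)).card + 1 := by
            rw [← Finset.card_erase_add_one (Finset.mem_insert_self _ Q),
              Finset.erase_insert_eq_erase]
          have h6 : ((insert (V.xs z s.t σ.length) Q).card : ℝ) ≤
              (Q.erase (V.xs z s.t σ.length)).card + 1 := by exact_mod_cast this
          calc _ ≤ (1/2:ℝ) ^ (K + l) * ((Q.erase (V.xs z s.t σ.length)).card + 1) := by gcongr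
            _ ≤ _ := by rw [mul_add, mul_one]; linarith
        · rw [Finset.erase_insert_eq_erase]; exact ih2
    obtain ⟨c1, c2⟩ := c1
    have eprom : wt Ent.r ((advance V d t' new s).prom.filter (zsel z e)) =
        wt Ent.r (s.prom.filter (zsel z e)) +
        wt Ent.r ((s.pool.filter (fun E => moved V s.t t' E)).filter (zsel z e)) := by
      simp only [advance, List.filter_append, wt_append]
    have hcomm : ∀ p q : Ent → Bool, ∀ l : List Ent, (l.filter p).filter q =
        (l.filter q).filter p := fun p q l => List.filter_comm ..
    have epool : wt Ent.r ((s.pool.filter (fun E => !moved V s.t t' E)).filter (zsel z e)) ≤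
        wt Ent.r ((advance V d t' new s).pool.filter (zsel z e)) := by
      simp only [advance, List.filter_append, wt_append]
      have := wt_nonneg Ent.r (new.filter (zsel z e))
      rw [List.filter_map, wt_map]
      have h6 : wt Ent.r ((s.pool.filter (fun E => !moved V s.t t' E)).filter (zsel z e)) ≤
        wt Ent.r ((s.pool.filter (fun E => !moved V s.t t' E)).filter
          (zsel z e ∘ settle V d t')) := by
        refine wt_filter_mono _ fun E _ hE => ?_
        have hs : E.side = some z := by
          simp only [zsel, Bool.and_eq_true, decide_eq_true_eq] at hE; exact hE.1
        simp only [Function.comp]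
        rw [settle_of_some hs]; exact hE
      have h7 : wt (fun b => (settle V d t' b).r) ((s.pool.filter
          (fun E => !moved V s.t t' E)).filter (zsel z e ∘ settle V d t')) =
        wt Ent.r ((s.pool.filter (fun E => !moved V s.t t' E)).filter
          (zsel z e ∘ settle V d t')) := rfl
      rw [h7]
      linarith
    have esplit : wt Ent.r ((s.pool.filter (fun E => !moved V s.t t' E)).filter (zsel z e)) +
        wt Ent.r ((s.pool.filter (fun E => moved V s.t t' E)).filter (zsel z e)) =
        wt Ent.r (s.pool.filter (zsel z e)) := by
      rw [hcomm, hcomm (fun E => moved V s.t t' E)]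
      exact wt_filter_add Ent.r (fun E => moved V s.t t' E) _
    have hn1 := wt_nonneg Ent.r ((s.pool.filter (fun E => moved V s.t t' E)).filter (zsel z e))
    refine ⟨by rw [eprom]; linarith, ?_⟩
    rw [eprom]
    by_cases hcur : V.xs z s.t σ.length = V.xs z t' σ.length
    · rw [← hcur]; linarith
    · have hzero : (s.pool.filter (fun E => !moved V s.t t' E)).filter (zsel z e) = [] := by
        rw [List.filter_eq_nil_iff]
        intro E hE hz
        rw [List.mem_filter, Bool.not_eq_true'] at hE
        simp only [zsel, Bool.and_eq_true, decide_eq_true_eq] at hz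
        have hnm := not_moved V hE.2 hz.1
        obtain ⟨l', σ', hen', hlt⟩ := (hent E (List.mem_append_right _ hE.1)).tag z
        rw [hz.2, hen] at hen'
        cases hen'
        apply hcur
        rw [hV.pre z s.t _ _ hlt.le, hV.pre z t' _ _ hlt.le, hnm]
      rw [hzero, wt_nil, zero_add] at esplit
      have h8 : ((Q'.erase (V.xs z t' σ.length)).card : ℝ) ≤ Q'.card := by
        exact_mod_cast Finset.card_erase_le
      have : (1/2:ℝ) ^ (K + l) * (Q'.erase (V.xs z t' σ.length)).card ≤
        (1/2:ℝ) ^ (K + l) * Q'.card := by gcongr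
      linarith
end lim

end PartC6

section PartC7

def goodReq (V : Env) (k K : ℕ) (z : Bool) (s : St) (e : ℕ) : Option (ℕ × Str) :=
  bif (!s.stuck && (!doneH k s && (!waiting s && (!(lackE V K s z).isSome &&
    Nat.ble (e + 1) (s.j z))))) then (V.en e).map fun p => (p.1, V.xs z s.t p.2.length) else none

theorem goodReq_iff (V : Env) (k K : ℕ) (z : Bool) (s : St) (e : ℕ) (p : ℕ × Str) :
    goodReq V k K z s e = some p ↔ GoodAt V k K z s ∧ e < s.j z ∧
      ∃ l σ, V.en e = some (l, σ) ∧ p = (l, V.xs z s.t σ.length) := by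
  have hc : (!s.stuck && (!doneH k s && (!waiting s && (!(lackE V K s z).isSome &&
    Nat.ble (e + 1) (s.j z))))) = true ↔ GoodAt V k K z s ∧ e < s.j z := by
    simp only [Bool.and_eq_true, Bool.not_eq_true', Option.isSome_eq_false_iff, Nat.ble_eq,
      GoodAt, Option.isNone_iff_eq_none, and_assoc, Nat.succ_le_iff]
  unfold goodReq
  by_cases h : GoodAt V k K z s ∧ e < s.j z
  · rw [hc.2 h, cond_true]
    cases hen : V.en e with
    | none => simp
    | some q =>
      simp only [Option.map_some, Option.some.injEq]
      constructor
      · rintro rfl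
        exact ⟨h.1, h.2, q.1, q.2, rfl, rfl⟩
      · rintro ⟨_, _, l, σ, rfl, rfl⟩
        rfl
  · have : (!s.stuck && (!doneH k s && (!waiting s && (!(lackE V K s z).isSome &&
      Nat.ble (e + 1) (s.j z))))) = false := by
      rw [← Bool.not_eq_true, hc]; exact h
    rw [this, cond_false]
    constructor
    · intro h; cases h
    · rintro ⟨h1, h2, _⟩; exact absurd ⟨h1, h2⟩ h

theorem comp_goodReq {V : Env} (hV : EnvComp V) {α : Type*} [Primcodable α] (k K : ℕ) (z : Bool)
    {s : α → St} {e : α → ℕ} (hs : Computable s) (he : Computable e) :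
    Computable fun a => goodReq V k K z (s a) (e a) := by
  refine Computable.cond ?_ ?_ (Computable.const _)
  · refine comp_and (comp_not (comp_stuck hs)) (comp_and (comp_not (comp_doneH hV hs
      (Computable.const k))) (comp_and (comp_not (comp_waiting hV hs)) (comp_and (comp_not ?_) ?_)))
    · exact Primrec.option_isSome.to_comp.comp (comp_lackE hV (Computable.const K) hs
        (Computable.const z))
    · exact comp_le (Computable.succ.comp he) (comp_j hs (Computable.const z))
  · refine Computable.option_map (hV.en.comp he) ?_
    refine Computable.pair (c1 Computable.snd) ?_
    exact comp_xs hV (Computable.const z) (comp_t (hs.comp Computable.fst))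
      (Computable.list_length.comp (c2 Computable.snd))

theorem good_sum {V : Env} (hV : EnvOK V) {i d k K t0 : ℕ} {g : Args → Res} {S : ℕ → St}
    (h : LimRun V i d k K t0 g S) (z : Bool) (F : Finset (ℕ × Str))
    (hF : ∀ p ∈ F, ∃ m e, goodReq V k K z (S m) e = some p) :
    ∑ p ∈ F, (1/2:ℝ) ^ p.1 ≤ 2 ^ (K + 4) := by
  classical
  have hF' : ∀ p : ℕ × Str, ∃ m e, p ∈ F → goodReq V k K z (S m) e = some p := by
    intro p
    by_cases hp : p ∈ F
    · obtain ⟨m, e, h⟩ := hF p hp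
      exact ⟨m, e, fun _ => h⟩
    · exact ⟨0, 0, fun h => absurd h hp⟩
  choose mm ee hme using hF'
  let M := F.sup mm + 1
  let ES := F.image ee
  have hFp : ∀ p ∈ F, p.1 = enL V (ee p) ∧ p.2 ∈ Qset V k K S z (ee p) (enN V (ee p)) M := by
    intro p hp
    obtain ⟨hg, hj, l, σ, hen, hpe⟩ := (goodReq_iff ..).1 (hme p hp)
    constructor
    · have := congrArg Prod.fst hpe; simpa [enL, hen] using this
    · simp only [enN, hen, Option.map_some, Option.getD_some, Qset, Finset.mem_image,
        Finset.mem_filter, Finset.mem_range]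
      refine ⟨_, ⟨Nat.lt_succ_of_le (Finset.le_sup (f := mm) hp), hg, hj⟩, (congrArg Prod.snd hpe).symm⟩
  have h1 : ∑ p ∈ F, (1/2:ℝ) ^ p.1 ≤
      ∑ x ∈ ES.sigma fun e => Qset V k K S z e (enN V e) M, (1/2:ℝ) ^ enL V x.1 := by
    refine sum_le_of_inj (fun p => (⟨ee p, p.2⟩ : Σ _ : ℕ, Str)) ?_ ?_ ?_ ?_
    · intro p hp
      rw [Finset.mem_sigma]
      exact ⟨Finset.mem_image_of_mem _ hp, (hFp p hp).2⟩
    · intro p hp q hq hpq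
      simp only [Sigma.mk.injEq, heq_eq_eq] at hpq
      refine Prod.ext ?_ hpq.2
      rw [(hFp p hp).1, (hFp q hq).1, hpq.1]
    · intro p hp
      rw [(hFp p hp).1]
    · intro b _; positivity
  refine h1.trans ?_
  rw [Finset.sum_sigma]
  simp only [Finset.sum_const, nsmul_eq_mul]
  have hKK : (2:ℝ) ^ K * (1/2) ^ K = 1 := by rw [← mul_pow]; norm_num
  have h2 : ∀ e ∈ ES, ((Qset V k K S z e (enN V e) M).card : ℝ) * (1/2) ^ enL V e ≤
      2 ^ K * (wt Ent.r ((S M).prom.filter (zsel z e)) +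
        wt Ent.r ((S M).pool.filter (zsel z e))) := by
    intro e he
    obtain ⟨p, hp, rfl⟩ := Finset.mem_image.1 he
    obtain ⟨hg, hj, l, σ, hen, _⟩ := (goodReq_iff ..).1 (hme p hp)
    have h3 := (Q_bound hV h z hen M).1
    have e1 : enN V (ee p) = σ.length := by simp [enN, hen]
    have e2 : enL V (ee p) = l := by simp [enL, hen]
    rw [e1, e2]
    calc _ = 2 ^ K * ((1/2:ℝ) ^ (K + l) * (Qset V k K S z (ee p) σ.length M).card) := by
            rw [pow_add]
            calc _ = (2 ^ K * (1/2) ^ K) * (((Qset V k K S z (ee p) σ.length M).card : ℝ) *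
                (1/2) ^ l) := by rw [hKK, one_mul]
              _ = _ := by ring
      _ ≤ _ := by gcongr
  refine (Finset.sum_le_sum h2).trans ?_
  rw [← Finset.mul_sum, Finset.sum_add_distrib]
  have hdis : ∀ E : Ent, ∀ e e', zsel z e E = true → zsel z e' E = true → e = e' := by
    intro E e e' h1 h2
    simp only [zsel, Bool.and_eq_true, decide_eq_true_eq] at h1 h2
    rw [← h1.2, ← h2.2]
  have g1 := group_le_wt Ent.r ES (fun e => zsel z e) (l := (S M).prom) fun E _ => hdis E
  have g2 := group_le_wt Ent.r ES (fun e => zsel z e) (l := (S M).pool) fun E _ => hdis E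
  have htot := (h.inv M).tot
  have hk1 : (1/2:ℝ) ^ k ≤ 1 := pow_le_one₀ (by norm_num) (by norm_num)
  have hK1 : (1:ℝ) ≤ 2 ^ K := one_le_pow₀ (by norm_num)
  calc _ ≤ (2:ℝ) ^ K * (1 + 8 * (1/2) ^ K) :=
      mul_le_mul_of_nonneg_left (by linarith) (by positivity)
    _ = 2 ^ K + 8 * (2 ^ K * (1/2) ^ K) := by ring
    _ = 2 ^ K + 8 := by rw [hKK, mul_one]
    _ ≤ 2 ^ (K + 4) := by rw [pow_add]; linarith

structure EnvLim (U : Str →. Str) (V : Env) (X : Bool → ℕ → Bool) : Prop where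
  opt : OptimalPF U
  ok : EnvOK V
  comp : EnvComp V
  lim : ∀ z n, ∃ T, ∀ t ≥ T, V.xs z t n = restrSeq (X z) n
  spec : ∀ σ (ℓ : ℕ), KC U σ ≤ ℓ ↔ ∃ e l, l ≤ ℓ ∧ V.en e = some (l, σ)

theorem ktriv_of_unbounded {U : Str →. Str} {V : Env} {X : Bool → ℕ → Bool} (hL : EnvLim U V X)
    {i d k K t0 : ℕ} {g : Args → Res} {S : ℕ → St} (hgc : Computable g) (hgm : Mono d g)
    (h : LimRun V i d k K t0 g S) {z : Bool} (hz : ∀ J, ∃ m, J < (S m).j z) :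
    KTrivialSeq U (X z) := by
  let req : ℕ → Option (ℕ × Str) := fun n =>
    goodReq V k K z (runSt V g d k K t0 n.unpair.1 n.unpair.2.unpair.1) n.unpair.2.unpair.2
  have hreq : Computable req := by
    have hu : Computable Nat.unpair := Primrec.unpair.to_comp
    have h1 : Computable fun n : ℕ => n.unpair.1 := c1 hu
    have h2 : Computable fun n : ℕ => n.unpair.2.unpair := hu.comp (c2 hu)
    exact comp_goodReq hL.comp k K z (comp_run hL.comp hgc (Computable.const d)
      (Computable.const k) (Computable.const K) (Computable.const t0) h1 (c1 h2)) (c2 h2)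
  obtain ⟨c, hc⟩ := kc_theorem hL.opt req hreq (K + 4) (by
    intro F hF
    refine good_sum hL.ok h z F fun p hp => ?_
    obtain ⟨n, hn⟩ := hF p hp
    refine ⟨n.unpair.2.unpair.1, n.unpair.2.unpair.2, ?_⟩
    have hns := ((goodReq_iff ..).1 hn).1.1
    obtain ⟨T0, hT0⟩ := h.lim n.unpair.2.unpair.1
    have hle := stLe_run (V := V) hgm k K t0 (le_max_left n.unpair.1 T0) n.unpair.2.unpair.1
    rw [hT0 _ (le_max_right _ _)] at hle
    rcases hle with hle | ⟨hle, _⟩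
    · rw [hle]; exact hn
    · rw [hle] at hns; exact absurd hns (by simp))
  refine ktriv_of c fun n l hl => ?_
  obtain ⟨e, l', hl', hen⟩ := (hL.spec _ _).1 hl
  obtain ⟨T, hT⟩ := hL.lim z n
  obtain ⟨m, hm, hj, hg⟩ := exists_good h hz e T
  obtain ⟨T0, hT0⟩ := h.lim m
  have hr : req (Nat.pair T0 (Nat.pair m e)) = some (l', V.xs z (S m).t n) := by
    simp only [req, Nat.unpair_pair]
    rw [hT0 T0 le_rfl, goodReq_iff]
    exact ⟨hg, hj, l', _, hen, by rw [zeroStr_length]⟩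
  have h1 := hc _ _ _ hr
  rw [hT _ (hm.trans (lim_time_ge h m))] at h1
  refine h1.trans ?_
  gcongr

theorem comp_Pi {V : Env} (hV : EnvComp V) (i : ℕ) : Computable (P V i) :=
  (comp_P hV).comp (Computable.pair (Computable.const i) Computable.id)

theorem return_lemma {U : Str →. Str} {V : Env} {X : Bool → ℕ → Bool} (hL : EnvLim U V X)
    (hX : ∀ z, ¬ KTrivialSeq U (X z)) (d i : ℕ) : ∀ k t0,
    (∀ T, ∀ p ∈ (P V i (d, k, t0, T)).1, Settled V d p.1 p.2) →
      ∃ T q, (P V i (d, k, t0, T)).2 = some q := by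
  induction i with
  | zero => intro k t0 _; exact ⟨0, _, rfl⟩
  | succ i ih =>
    intro k t0 hset
    by_contra hc
    push Not at hc
    obtain ⟨S, hS⟩ := exists_limRun (k := k) (K := k + (i + 6)) (t0 := t0) hL.ok
      (spec_P hL.ok d i) (mono_P V d i) ih hset (by
        intro T
        have : ∀ q, (outSt k (runSt V (P V i) d k (k + (i + 6)) t0 T T)).2 ≠ some q := hc T
        exact Option.eq_none_iff_forall_ne_some.2 this)
    obtain ⟨z, hz⟩ := lim_unbounded hS
    exact hX z (ktriv_of_unbounded hL (comp_Pi hL.comp i) (mono_P V d i) hS hz)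

end PartC7

section PartE

theorem finset_le_wt {α : Type*} (f : α → ℕ × Str) (l : List α) : ∀ F : Finset (ℕ × Str),
    (∀ p ∈ F, ∃ a ∈ l, f a = p) → ∑ p ∈ F, (1/2:ℝ) ^ p.1 ≤ wt (fun a => (f a).1) l := by
  induction l with
  | nil =>
    intro F hF
    have : F = ∅ := Finset.eq_empty_of_forall_notMem fun p hp => by
      obtain ⟨a, ha, _⟩ := hF p hp
      simp at ha
    simp [this]
  | cons a l ih =>
    intro F hF
    have h1 := ih (F.erase (f a)) (by
      intro p hp
      rw [Finset.mem_erase] at hp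
      obtain ⟨b, hb, rfl⟩ := hF p hp.2
      rcases List.mem_cons.1 hb with rfl | hb
      · exact absurd rfl hp.1
      · exact ⟨b, hb, rfl⟩)
    rw [wt_cons]
    by_cases ha : f a ∈ F
    · rw [← Finset.add_sum_erase F _ ha]; linarith
    · rw [Finset.erase_eq_of_notMem ha] at h1
      have : (0:ℝ) < (1/2) ^ (f a).1 := by positivity
      linarith

theorem kraft_stale {V : Env} (hV : EnvOK V) (d t : ℕ) (l : List (ℕ × ℕ))
    (hl : (l.map Prod.fst).Nodup) (z : Bool) :
    ∑ p ∈ l.toFinset, ((staleSet V d t p.1 p.2 z).card : ℝ) * (1/2) ^ (p.2 + (V.b + d)) ≤ 1 := by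
  classical
  have h0 : ∑ p ∈ l.toFinset, ((staleSet V d t p.1 p.2 z).card : ℝ) * (1/2) ^ (p.2 + (V.b + d)) =
      ∑ x ∈ l.toFinset.sigma fun p => staleSet V d t p.1 p.2 z,
        (1/2:ℝ) ^ (x.1.2 + (V.b + d)) := by
    rw [Finset.sum_sigma]
    simp only [Finset.sum_const, nsmul_eq_mul]
  rw [h0]
  have hex : ∀ x : (Σ _ : ℕ × ℕ, Str), ∃ e, x ∈ (l.toFinset.sigma fun p =>
      staleSet V d t p.1 p.2 z) → e < t ∧ ∃ l', l' ≤ x.1.2 + (V.b + d) ∧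
        V.en e = some (l', x.2) := by
    intro x
    by_cases hx : x ∈ (l.toFinset.sigma fun p => staleSet V d t p.1 p.2 z)
    · have h1 := (Finset.mem_sigma.1 hx).2
      simp only [staleSet, Finset.mem_filter] at h1
      obtain ⟨e, l', h2, h3, h4⟩ := (descOf_iff ..).1 h1.2.2
      exact ⟨e, fun _ => ⟨h2, l', h3, h4⟩⟩
    · exact ⟨0, fun h => absurd h hx⟩
  choose ee hee using hex
  have hlen : ∀ x ∈ (l.toFinset.sigma fun p => staleSet V d t p.1 p.2 z),
      x.2.length = x.1.1 := by
    intro x hx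
    have h1 := (Finset.mem_sigma.1 hx).2
    simp only [staleSet, Finset.mem_filter, Finset.mem_image] at h1
    obtain ⟨⟨s, _, hs⟩, _⟩ := h1
    rw [← hs, hV.len]
  refine (sum_le_of_inj (t := Finset.range t) (g := fun e => pw ((V.en e).map Prod.fst)) ee
    ?_ ?_ ?_ ?_).trans (hV.kraft _)
  · intro x hx; exact Finset.mem_range.2 (hee x hx).1
  · intro x hx y hy hxy
    obtain ⟨_, l1, _, h1⟩ := hee x hx
    obtain ⟨_, l2, _, h2⟩ := hee y hy
    rw [hxy, h2] at h1
    have hσ : y.2 = x.2 := by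
      have := congrArg (fun o => o.map Prod.snd) h1
      simpa using this
    have hv : x.1.1 = y.1.1 := by rw [← hlen x hx, ← hlen y hy, hσ]
    have hx1 := List.mem_toFinset.1 (Finset.mem_sigma.1 hx).1
    have hy1 := List.mem_toFinset.1 (Finset.mem_sigma.1 hy).1
    have hp : x.1 = y.1 := List.inj_on_of_nodup_map hl hx1 hy1 hv
    obtain ⟨x1, x2⟩ := x
    obtain ⟨y1, y2⟩ := y
    simp only at hp hσ
    subst hp; subst hσ; rfl
  · intro x hx
    obtain ⟨_, l1, hl1, h1⟩ := hee x hx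
    rw [h1]
    simp only [Option.map_some, pw, Option.elim]
    exact pow_le_pow_of_le_one (by norm_num) (by norm_num) hl1
  · intro e _
    cases V.en e with
    | none => simp [pw]
    | some p => simp only [Option.map_some, pw, Option.elim]; positivity

def LL (b d : ℕ) : ℕ := 2 ^ (2 * d + b + 3)

theorem wt_toFinset (l : List (ℕ × ℕ)) (hl : (l.map Prod.fst).Nodup) :
    wt Prod.snd l = ∑ p ∈ l.toFinset, (1/2:ℝ) ^ p.2 := by
  rw [List.sum_toFinset _ hl.of_map]; rfl

theorem no_return {V : Env} (hV : EnvOK V) (d t : ℕ) (l : List (ℕ × ℕ))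
    (hl : (l.map Prod.fst).Nodup) (hw : (1/2:ℝ) ^ (d + 1) ≤ wt Prod.snd l)
    (hs : ∀ p ∈ l, LL V.b d ≤ stale V d t p.1 p.2) : False := by
  have h1 := kraft_stale hV d t l hl true
  have h2 := kraft_stale hV d t l hl false
  have h3 : ∑ p ∈ l.toFinset, (LL V.b d : ℝ) * (1/2) ^ (p.2 + (V.b + d)) ≤ 2 := by
    calc _ ≤ ∑ p ∈ l.toFinset, (((staleSet V d t p.1 p.2 true).card : ℝ) *
          (1/2) ^ (p.2 + (V.b + d)) + ((staleSet V d t p.1 p.2 false).card : ℝ) *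
          (1/2) ^ (p.2 + (V.b + d))) := by
          refine Finset.sum_le_sum fun p hp => ?_
          rw [← add_mul]
          have := hs p (List.mem_toFinset.1 hp)
          have h4 : (LL V.b d : ℝ) ≤ (staleSet V d t p.1 p.2 true).card +
            (staleSet V d t p.1 p.2 false).card := by exact_mod_cast this
          gcongr
      _ ≤ 2 := by rw [Finset.sum_add_distrib]; linarith
  have h4 : ∑ p ∈ l.toFinset, (LL V.b d : ℝ) * (1/2) ^ (p.2 + (V.b + d)) =
      LL V.b d * (1/2) ^ (V.b + d) * wt Prod.snd l := by
    rw [wt_toFinset l hl, Finset.mul_sum]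
    refine Finset.sum_congr rfl fun p _ => ?_
    rw [pow_add]; ring
  rw [h4] at h3
  have h5 : (LL V.b d : ℝ) * (1/2) ^ (V.b + d) * (1/2) ^ (d + 1) = 4 := by
    have e1 : 2 * d + V.b + 3 = (V.b + d) + (d + 1) + 2 := by omega
    unfold LL
    rw [e1]
    push_cast
    rw [pow_add, pow_add (2:ℝ) (V.b + d)]
    have a1 : (2:ℝ) ^ (V.b + d) * (1/2) ^ (V.b + d) = 1 := by rw [← mul_pow]; norm_num
    have a2 : (2:ℝ) ^ (d + 1) * (1/2) ^ (d + 1) = 1 := by rw [← mul_pow]; norm_num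
    calc _ = ((2:ℝ) ^ (V.b + d) * (1/2) ^ (V.b + d)) * ((2:ℝ) ^ (d + 1) * (1/2) ^ (d + 1)) *
          2 ^ 2 := by ring
      _ = 4 := by rw [a1, a2]; norm_num
  have h6 : (LL V.b d : ℝ) * (1/2) ^ (V.b + d) * (1/2) ^ (d + 1) ≤
      LL V.b d * (1/2) ^ (V.b + d) * wt Prod.snd l := by gcongr
  linarith

def mainReqs (V : Env) (d T : ℕ) : List (ℕ × ℕ) := (P V (LL V.b d) (d, d + 1, 0, T)).1

theorem main_wt {V : Env} (hV : EnvOK V) (T D : ℕ) :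
    wt Prod.snd ((List.range D).flatMap fun d => mainReqs V d T) ≤ 2 * (1 - (1/2) ^ D) := by
  induction D with
  | zero => simp
  | succ D ih =>
    rw [List.range_succ, List.flatMap_append, wt_append]
    have h1 := (spec_P hV D (LL V.b D) (D + 1) 0 T).wreq
    have h2 := cc_le (LL V.b D)
    have h3 : cc (LL V.b D) * (1/2) ^ (D + 1) ≤ 2 * (1/2) ^ (D + 1) := by gcongr
    have h4 : (List.flatMap (fun d => mainReqs V d T) [D]) =
      (P V (LL V.b D) (D, D + 1, 0, T)).1 := by simp [mainReqs]
    rw [h4]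
    have h5 : (1/2:ℝ) ^ (D + 1) = (1/2) ^ D / 2 := by rw [pow_succ]; ring
    have h6 : 2 * (1 - (1/2:ℝ) ^ (D + 1)) = 2 * (1 - (1/2) ^ D) + 2 * (1/2) ^ (D + 1) := by
      rw [h5]; ring
    rw [h6]
    exact add_le_add ih (h1.trans h3)

theorem comp_LL (b : ℕ) : Computable (LL b) := by
  have hd : Computable fun d : ℕ => d := Computable.id
  exact comp_pow2 (comp_add (comp_add (comp_mul (Computable.const 2) hd) (Computable.const b))
      (Computable.const 3))

attribute [irreducible] LL

theorem comp_zeroStr : Computable zeroStr := by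
  have : Computable fun n : ℕ => (List.range n).map fun _ => false :=
    comp_map (comp_range Computable.id) (Computable.const false)
  refine this.of_eq fun n => ?_
  simp [zeroStr]

theorem comp_P_arg {V : Env} (hV : EnvComp V) {L : ℕ → ℕ} (hL : Computable L) :
    Computable fun p : ℕ × ℕ => (P V (L p.1) (p.1, p.1 + 1, 0, p.2)).1 := by
  have hd : Computable fun p : ℕ × ℕ => p.1 := Computable.fst
  have h1 : Computable fun p : ℕ × ℕ => ((L p.1, (p.1, p.1 + 1, 0, p.2)) : ℕ × Args) :=
    Computable.pair (hL.comp hd) (Computable.pair hd (Computable.pair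
    (Computable.succ.comp hd) (Computable.pair (Computable.const 0) Computable.snd)))
  have h2 := (comp_P hV).comp h1
  exact c1 h2

theorem comp_mainReqs {V : Env} (hV : EnvComp V) :
    Computable fun p : ℕ × ℕ => mainReqs V p.1 p.2 := by
  have hL := comp_LL V.b
  exact (comp_P_arg hV hL).of_eq fun p => rfl

theorem mainReqs_mono (V : Env) (d T T' : ℕ) (h : T ≤ T') :
    ∀ a ∈ mainReqs V d T, a ∈ mainReqs V d T' := (mono_P V d (LL V.b d) _ _ _ _ h).1

theorem mainReqs_eq (V : Env) (d T : ℕ) :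
    mainReqs V d T = (P V (LL V.b d) (d, d + 1, 0, T)).1 := rfl

attribute [irreducible] mainReqs

def reqOf (V : Env) (n : ℕ) : Option (ℕ × Str) :=
  ((mainReqs V n.unpair.1 n.unpair.2.unpair.1)[n.unpair.2.unpair.2]?).map
      fun p => (p.2, zeroStr p.1)

theorem comp_reqOf {V : Env} (hV : EnvComp V) : Computable (reqOf V) := by
  have hu : Computable Nat.unpair := Primrec.unpair.to_comp
  have h1 : Computable fun n : ℕ => n.unpair.1 := c1 hu
  have h2 : Computable fun n : ℕ => n.unpair.2.unpair := hu.comp (c2 hu)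
  have h3 : Computable fun n : ℕ => (n.unpair.1, n.unpair.2.unpair.1) :=
    Computable.pair h1 (c1 h2)
  have h4 : Computable fun n : ℕ => mainReqs V n.unpair.1 n.unpair.2.unpair.1 :=
    (comp_mainReqs hV).comp h3
  have h5 : Computable fun n : ℕ =>
      (mainReqs V n.unpair.1 n.unpair.2.unpair.1)[n.unpair.2.unpair.2]? :=
    Computable.list_getElem?.comp h4 (c2 h2)
  have h6 : Computable₂ fun (_ : ℕ) (p : ℕ × ℕ) => (p.2, zeroStr p.1) :=
    Computable.pair (c2 Computable.snd) (comp_zeroStr.comp (c1 Computable.snd))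
  exact Computable.option_map h5 h6

theorem main_lemma {U : Str →. Str} {V : Env} {X : Bool → ℕ → Bool} (hL : EnvLim U V X)
    (hb : ∀ n, ∃ z, KC U (restrSeq (X z) n) ≤ KC U (zeroStr n) + V.b) :
    ∃ z, KTrivialSeq U (X z) := by
  by_contra hc
  push Not at hc
  obtain ⟨c, hkc⟩ := kc_theorem hL.opt (reqOf V) (comp_reqOf hL.comp) 1 (by
    intro F hF
    classical
    have hF' : ∀ p : ℕ × Str, ∃ n, p ∈ F → reqOf V n = some p := by
      intro p
      by_cases hp : p ∈ F
      · obtain ⟨n, h⟩ := hF p hp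
        exact ⟨n, fun _ => h⟩
      · exact ⟨0, fun h => absurd h hp⟩
    choose nn hnn using hF'
    let D := F.sup (fun p => (nn p).unpair.1) + 1
    let T := F.sup (fun p => (nn p).unpair.2.unpair.1)
    have h1 := finset_le_wt (fun p : ℕ × ℕ => (p.2, zeroStr p.1))
      ((List.range D).flatMap fun d => mainReqs V d T) F (by
        intro p hp
        have h2 := hnn p hp
        simp only [reqOf, Option.map_eq_some_iff] at h2
        obtain ⟨a, ha, hap⟩ := h2
        refine ⟨a, ?_, hap⟩
        rw [List.mem_flatMap]
        refine ⟨(nn p).unpair.1, List.mem_range.2 (Nat.lt_succ_of_le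
          (Finset.le_sup (f := fun p => (nn p).unpair.1) hp)), ?_⟩
        have hT : (nn p).unpair.2.unpair.1 ≤ T :=
          Finset.le_sup (f := fun p => (nn p).unpair.2.unpair.1) hp
        exact mainReqs_mono V _ _ _ hT a (List.mem_of_getElem? ha))
    have h2 := main_wt hL.ok T D
    have h3 : (0:ℝ) < (1/2) ^ D := by positivity
    have h4 : wt (fun p : ℕ × ℕ => (p.2, zeroStr p.1).1)
      ((List.range D).flatMap fun d => mainReqs V d T) = wt Prod.snd
      ((List.range D).flatMap fun d => mainReqs V d T) := rfl
    rw [h4] at h1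
    linarith)
  have hset : ∀ T, ∀ p ∈ (P V (LL V.b c) (c, c + 1, 0, T)).1, Settled V c p.1 p.2 := by
    intro T p hp
    rw [← mainReqs_eq] at hp
    obtain ⟨j, hj⟩ := List.getElem?_of_mem hp
    have hr : reqOf V (Nat.pair c (Nat.pair T j)) = some (p.2, zeroStr p.1) := by
      simp only [reqOf, Nat.unpair_pair, Option.map_eq_some_iff]
      exact ⟨p, hj, rfl⟩
    have h1 := hkc _ _ _ hr
    obtain ⟨z, hz⟩ := hb p.1
    have h2 : KC U (restrSeq (X z) p.1) ≤ ((p.2 + (V.b + c) : ℕ) : ℕ∞) := by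
      refine hz.trans ?_
      calc KC U (zeroStr p.1) + (V.b : ℕ∞) ≤ ((p.2 : ℕ∞) + c) + V.b := by gcongr
        _ = _ := by push_cast; ring
    obtain ⟨e, l, hl, hen⟩ := (hL.spec _ _).1 h2
    obtain ⟨T0, hT0⟩ := hL.lim z p.1
    refine ⟨max T0 (e + 1), fun t ht => ⟨z, ?_⟩⟩
    rw [hT0 t (le_trans (le_max_left _ _) ht), descOf_iff]
    exact ⟨e, l, by omega, hl, hen⟩
  obtain ⟨T, q, hq⟩ := return_lemma hL hc c (LL V.b c) (c + 1) 0 hset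
  have hsp := spec_P hL.ok c (LL V.b c) (c + 1) 0 T
  exact no_return hL.ok c q.2 q.1 (hsp.nodup q hq) (hsp.lo q hq)
    fun p hp => (hsp.mem q hq p hp).2.2.1

theorem stmt13_aux (U : Str →. Str) (hU : OptimalPF U)
    (X Y : ℕ → Bool) (hX : CEReal X) (hY : CEReal Y)
    (h : ∃ b : ℕ, ∀ n, min (KC U (restrSeq X n)) (KC U (restrSeq Y n)) ≤ KC U (zeroStr n) + b) :
    KTrivialSeq U X ∨ KTrivialSeq U Y := by
  obtain ⟨b, hb⟩ := h
  rcases ce_approx hU hX with h1 | ⟨xs, hxs⟩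
  · exact Or.inl h1
  rcases ce_approx hU hY with h1 | ⟨ys, hys⟩
  · exact Or.inr h1
  obtain ⟨en, hen, hkr, hspec⟩ := exists_en hU.1
  let V : Env := ⟨en, fun z => bif z then xs else ys, b⟩
  let XX : Bool → ℕ → Bool := fun z => bif z then X else Y
  have hL : EnvLim U V XX := by
    refine ⟨hU, ⟨hkr, ?_, ?_, ?_⟩, ⟨hen, ?_⟩, ?_, hspec⟩
    · intro z; cases z
      · exact hys.len
      · exact hxs.len
    · intro z t n m hnm; cases z
      · exact hys.pre t n m hnm
      · exact hxs.pre t n m hnm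
    · intro z n t t' t'' h1 h2 h3; cases z
      · exact hys.noret t t' t'' n h1 h2 h3
      · exact hxs.noret t t' t'' n h1 h2 h3
    · have h1 : Computable fun p : Bool × ℕ × ℕ =>
          bif p.1 then xs p.2.1 p.2.2 else ys p.2.1 p.2.2 :=
        Computable.cond Computable.fst
          (hxs.comp.comp (c1 Computable.snd) (c2 Computable.snd))
          (hys.comp.comp (c1 Computable.snd) (c2 Computable.snd))
      refine h1.of_eq fun p => ?_
      obtain ⟨z, t, n⟩ := p
      cases z <;> rfl
    · intro z n; cases z
      · exact hys.lim n
      · exact hxs.lim n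
  obtain ⟨z, hz⟩ := main_lemma hL (by
    intro n
    rcases min_le_iff.1 (hb n) with h1 | h1
    · exact ⟨true, h1⟩
    · exact ⟨false, h1⟩)
  cases z
  · exact Or.inr hz
  · exact Or.inl hz

end PartE

/-- If `X` and `Y` are c.e. reals and `min{K(X↾n), K(Y↾n)} − K(n)` is
bounded above by a constant, then at least one of `X`, `Y` is `K`-trivial. -/
theorem stmt13 (U : Str →. Str) (hU : OptimalPF U)
    (X Y : ℕ → Bool) (hX : CEReal X) (hY : CEReal Y)
    (h : ∃ b : ℕ, ∀ n, min (KC U (restrSeq X n)) (KC U (restrSeq Y n)) ≤ KC U (zeroStr n) + b) :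
    KTrivialSeq U X ∨ KTrivialSeq U Y := by
  exact stmt13_aux U hU X Y hX hY h

end KPaper
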